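/- arXiv:2105.11930 — 2 statements merged into one kernel-verified Lean document; each statement's English description precedes it below -/
import Mathlib

section
/- Let X₀ be a smooth, embedded, closed plane curve with enclosed area A₀. If Gage's area-preserving flow with initial curve X₀ has a smooth solution X(·,t) on the whole time interval [0, +∞) (does not blow up in finite time), then the evolving curve converges to a circle of radius √(A₀/π) as t → ∞; in particular, there is a finite time after which the evolving curve is convex, and its curvature converges uniformly (indeed in the C^∞ metric) to √(π/A₀). -/
open Real Set MeasureTheory Filter

noncomputable section

/-- Euclidean norm of a plane vector. -/
def vnorm (v : ℝ × ℝ) : ℝ := Real.sqrt (v.1 ^ 2 + v.2 ^ 2)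

/-- Determinant of the 2×2 matrix whose rows are the plane vectors `a`, `b`. -/
def vdet (a b : ℝ × ℝ) : ℝ := a.1 * b.2 - a.2 * b.1

/-- Unit tangent vector of a plane curve. -/
def unitTangent (X : ℝ → ℝ × ℝ) (φ : ℝ) : ℝ × ℝ :=
  (vnorm (deriv X φ))⁻¹ • deriv X φ

/-- Inward unit normal: the rotation of the unit tangent by +π/2. -/
def innerNormal (X : ℝ → ℝ × ℝ) (φ : ℝ) : ℝ × ℝ :=
  (-(unitTangent X φ).2, (unitTangent X φ).1)

/-- Curvature of a plane curve. -/
def curv (X : ℝ → ℝ × ℝ) (φ : ℝ) : ℝ :=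
  vdet (deriv X φ) (deriv (deriv X) φ) / vnorm (deriv X φ) ^ 3

/-- Length of a closed plane curve parametrized on `[0, 2π]`. -/
def clen (X : ℝ → ℝ × ℝ) : ℝ := ∫ φ in (0:ℝ)..(2 * π), vnorm (deriv X φ)

/-- Enclosed area of a closed plane curve. -/
def carea (X : ℝ → ℝ × ℝ) : ℝ :=
  (1 / 2) * ∫ φ in (0:ℝ)..(2 * π), vdet (X φ) (deriv X φ)

/-- A smooth closed plane curve: a smooth `2π`-periodic map `ℝ → ℝ²` with
nonvanishing derivative. -/
structure IsSmoothClosedCurve (X : ℝ → ℝ × ℝ) : Prop where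
  smooth : ContDiff ℝ (⊤ : ℕ∞) X
  periodic : Function.Periodic X (2 * π)
  regular : ∀ φ, deriv X φ ≠ 0

/-- An embedded closed curve: injective over one period. -/
def IsEmbeddedCurve (X : ℝ → ℝ × ℝ) : Prop := Set.InjOn X (Set.Ico 0 (2 * π))

/-- Star-shapedness with respect to a point `O`: `det(X − O, T) > 0` everywhere. -/
def StarShapedWrt (X : ℝ → ℝ × ℝ) (O : ℝ × ℝ) : Prop :=
  ∀ φ, 0 < vdet (X φ - O) (unitTangent X φ)

/-- Centrosymmetry with respect to a point `O`: the image of the curve is invariant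
under the point reflection `Z ↦ 2O − Z`. -/
def CentroSymmetricWrt (X : ℝ → ℝ × ℝ) (O : ℝ × ℝ) : Prop :=
  (fun Z => (2 : ℝ) • O - Z) '' Set.range X = Set.range X

/-- `X` is a smooth solution of Gage's area-preserving flow on the time set `I`
with initial curve `X₀`: `∂X/∂t = α T + (κ − 2π/L) N`. -/
structure IsGAPFSolutionOn (X : ℝ → ℝ → ℝ × ℝ) (X₀ : ℝ → ℝ × ℝ) (I : Set ℝ) : Prop where
  init : ∀ φ, X 0 φ = X₀ φ
  curve : ∀ t ∈ I, IsSmoothClosedCurve (X t)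
  smooth : ContDiffOn ℝ (⊤ : ℕ∞) (fun p : ℝ × ℝ => X p.1 p.2) (I ×ˢ Set.univ)
  flow : ∃ α : ℝ → ℝ → ℝ,
    ∀ t ∈ I, ∀ φ,
      HasDerivWithinAt (fun τ => X τ φ)
        (α t φ • unitTangent (X t) φ +
          (curv (X t) φ - 2 * π / clen (X t)) • innerNormal (X t) φ) I t

open scoped ContDiff Topology

def Sm (f : ℝ → ℝ → ℝ) : Prop :=
  ∀ t, 0 < t → (∀ φ, ContDiffAt ℝ ∞ (fun p : ℝ × ℝ => f p.1 p.2) (t, φ)) ∧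
    ∀ φ, f t (φ + 2 * π) = f t φ

def dX (f : ℝ → ℝ → ℝ) : ℝ → ℝ → ℝ := fun t φ => deriv (fun ψ => f t ψ) φ
def dT (f : ℝ → ℝ → ℝ) : ℝ → ℝ → ℝ := fun t φ => deriv (fun τ => f τ φ) t
def In (f : ℝ → ℝ → ℝ) : ℝ → ℝ := fun t => ∫ φ in (0:ℝ)..(2 * π), f t φ

lemma ev_pos {t φ : ℝ} (ht : 0 < t) : ∀ᶠ p : ℝ × ℝ in 𝓝 (t, φ), 0 < p.1 :=
  (continuous_fst.tendsto (t, φ)).eventually (lt_mem_nhds ht)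

lemma hasDX_aux {F : ℝ × ℝ → ℝ} {t φ : ℝ} (h : DifferentiableAt ℝ F (t, φ)) :
    HasDerivAt (fun ψ => F (t, ψ)) (fderiv ℝ F (t, φ) (0, 1)) φ := by
  have h1 : HasDerivAt (fun ψ : ℝ => (t, ψ)) ((0:ℝ), (1:ℝ)) φ :=
    (hasDerivAt_const φ t).prodMk (hasDerivAt_id φ)
  exact h.hasFDerivAt.comp_hasDerivAt φ h1

lemma hasDT_aux {F : ℝ × ℝ → ℝ} {t φ : ℝ} (h : DifferentiableAt ℝ F (t, φ)) :
    HasDerivAt (fun τ => F (τ, φ)) (fderiv ℝ F (t, φ) (1, 0)) t := by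
  have h1 : HasDerivAt (fun τ : ℝ => (τ, φ)) ((1:ℝ), (0:ℝ)) t :=
    (hasDerivAt_id t).prodMk (hasDerivAt_const t φ)
  exact h.hasFDerivAt.comp_hasDerivAt t h1

namespace Sm

variable {f g : ℝ → ℝ → ℝ}

lemma diffAt (hf : Sm f) {t : ℝ} (ht : 0 < t) (φ : ℝ) :
    DifferentiableAt ℝ (fun p : ℝ × ℝ => f p.1 p.2) (t, φ) :=
  ((hf t ht).1 φ).differentiableAt (by simp)

lemma hasX (hf : Sm f) {t : ℝ} (ht : 0 < t) (φ : ℝ) :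
    HasDerivAt (fun ψ => f t ψ) (dX f t φ) φ :=
  (hasDX_aux (hf.diffAt ht φ)).differentiableAt.hasDerivAt

lemma hasT (hf : Sm f) {t : ℝ} (ht : 0 < t) (φ : ℝ) :
    HasDerivAt (fun τ => f τ φ) (dT f t φ) t :=
  (hasDT_aux (hf.diffAt ht φ)).differentiableAt.hasDerivAt

lemma dX_eq (hf : Sm f) {t : ℝ} (ht : 0 < t) (φ : ℝ) :
    dX f t φ = fderiv ℝ (fun p : ℝ × ℝ => f p.1 p.2) (t, φ) (0, 1) :=
  (hasDX_aux (hf.diffAt ht φ)).deriv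

lemma dT_eq (hf : Sm f) {t : ℝ} (ht : 0 < t) (φ : ℝ) :
    dT f t φ = fderiv ℝ (fun p : ℝ × ℝ => f p.1 p.2) (t, φ) (1, 0) :=
  (hasDT_aux (hf.diffAt ht φ)).deriv

lemma dX_ev (hf : Sm f) {t : ℝ} (ht : 0 < t) (φ : ℝ) :
    (fun p : ℝ × ℝ => dX f p.1 p.2) =ᶠ[𝓝 (t, φ)]
      fun p => fderiv ℝ (fun p : ℝ × ℝ => f p.1 p.2) p (0, 1) := by
  filter_upwards [ev_pos ht] with p hp
  exact hf.dX_eq hp p.2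

lemma dT_ev (hf : Sm f) {t : ℝ} (ht : 0 < t) (φ : ℝ) :
    (fun p : ℝ × ℝ => dT f p.1 p.2) =ᶠ[𝓝 (t, φ)]
      fun p => fderiv ℝ (fun p : ℝ × ℝ => f p.1 p.2) p (1, 0) := by
  filter_upwards [ev_pos ht] with p hp
  exact hf.dT_eq hp p.2

lemma fd (hf : Sm f) {t : ℝ} (ht : 0 < t) (φ : ℝ) :
    ContDiffAt ℝ ∞ (fderiv ℝ (fun p : ℝ × ℝ => f p.1 p.2)) (t, φ) :=
  ((hf t ht).1 φ).fderiv_right (by simp)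

lemma dX (hf : Sm f) : Sm (dX f) := by
  intro t ht
  refine ⟨fun φ => ?_, fun φ => ?_⟩
  · exact ((hf.fd ht φ).clm_apply contDiffAt_const).congr_of_eventuallyEq (hf.dX_ev ht φ)
  · change deriv (fun ψ => f t ψ) (φ + 2 * π) = deriv (fun ψ => f t ψ) φ
    rw [← deriv_comp_add_const]
    congr 1
    funext ψ
    exact (hf t ht).2 ψ

lemma dT (hf : Sm f) : Sm (dT f) := by
  intro t ht
  refine ⟨fun φ => ?_, fun φ => ?_⟩
  · exact ((hf.fd ht φ).clm_apply contDiffAt_const).congr_of_eventuallyEq (hf.dT_ev ht φ)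
  · apply Filter.EventuallyEq.deriv_eq
    filter_upwards [lt_mem_nhds ht] with τ hτ
    exact (hf τ hτ).2 φ

lemma comm (hf : Sm f) {t : ℝ} (ht : 0 < t) (φ : ℝ) :
    _root_.dX (_root_.dT f) t φ = _root_.dT (_root_.dX f) t φ := by
  rw [hf.dT.dX_eq ht, hf.dX.dT_eq ht, (hf.dT_ev ht φ).fderiv_eq, (hf.dX_ev ht φ).fderiv_eq]
  have h := (hf.fd ht φ).differentiableAt (by simp)
  have e1 : ∀ v w : ℝ × ℝ, fderiv ℝ (fun p => fderiv ℝ (fun p : ℝ × ℝ => f p.1 p.2) p v) (t, φ) w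
      = fderiv ℝ (fderiv ℝ (fun p : ℝ × ℝ => f p.1 p.2)) (t, φ) w v := by
    intro v w
    have := (h.hasFDerivAt.clm_apply (hasFDerivAt_const v (t, φ))).fderiv
    rw [this]; simp
  rw [e1, e1]
  exact (((hf t ht).1 φ).isSymmSndFDerivAt (by simp only [minSmoothness_of_isRCLikeNormedField]; exact WithTop.coe_le_coe.2 (le_top : (2:ℕ∞) ≤ ⊤))) _ _

lemma add (hf : Sm f) (hg : Sm g) : Sm (fun t φ => f t φ + g t φ) := fun t ht =>
  ⟨fun φ => ((hf t ht).1 φ).add ((hg t ht).1 φ), fun φ => by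
    simp only [(hf t ht).2 φ, (hg t ht).2 φ]⟩
lemma sub (hf : Sm f) (hg : Sm g) : Sm (fun t φ => f t φ - g t φ) := fun t ht =>
  ⟨fun φ => ((hf t ht).1 φ).sub ((hg t ht).1 φ), fun φ => by
    simp only [(hf t ht).2 φ, (hg t ht).2 φ]⟩
lemma mul (hf : Sm f) (hg : Sm g) : Sm (fun t φ => f t φ * g t φ) := fun t ht =>
  ⟨fun φ => ((hf t ht).1 φ).mul ((hg t ht).1 φ), fun φ => by
    simp only [(hf t ht).2 φ, (hg t ht).2 φ]⟩
lemma const (c : ℝ) : Sm (fun _ _ => c) := fun _ _ =>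
  ⟨fun _ => contDiffAt_const, fun _ => rfl⟩
lemma pow (hf : Sm f) (n : ℕ) : Sm (fun t φ => f t φ ^ n) := fun t ht =>
  ⟨fun φ => ((hf t ht).1 φ).pow n, fun φ => by simp only [(hf t ht).2 φ]⟩
lemma div (hf : Sm f) (hg : Sm g) (h0 : ∀ t, 0 < t → ∀ φ, g t φ ≠ 0) :
    Sm (fun t φ => f t φ / g t φ) := fun t ht =>
  ⟨fun φ => ((hf t ht).1 φ).div ((hg t ht).1 φ) (h0 t ht φ), fun φ => by
    simp only [(hf t ht).2 φ, (hg t ht).2 φ]⟩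
lemma sqrt (hf : Sm f) (h0 : ∀ t, 0 < t → ∀ φ, f t φ ≠ 0) :
    Sm (fun t φ => Real.sqrt (f t φ)) := fun t ht =>
  ⟨fun φ => ((hf t ht).1 φ).sqrt (h0 t ht φ), fun φ => by
    simp only [(hf t ht).2 φ]⟩

lemma cont (hf : Sm f) {t : ℝ} (ht : 0 < t) : Continuous (f t) :=
  continuous_iff_continuousAt.2 fun φ => (hf.hasX ht φ).continuousAt

lemma ii (hf : Sm f) {t : ℝ} (ht : 0 < t) (a b : ℝ) :
    IntervalIntegrable (f t) volume a b := (hf.cont ht).intervalIntegrable a b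

lemma In_dX (hf : Sm f) {t : ℝ} (ht : 0 < t) : In (_root_.dX f) t = 0 := by
  unfold In
  rw [intervalIntegral.integral_eq_sub_of_hasDerivAt (fun φ _ => hf.hasX ht φ) (hf.dX.ii ht _ _)]
  have := (hf t ht).2 0
  simp only [zero_add] at this
  rw [this, sub_self]

lemma ftc (hf : Sm f) {t : ℝ} (ht : 0 < t) (a b : ℝ) :
    ∫ φ in a..b, _root_.dX f t φ = f t b - f t a :=
  intervalIntegral.integral_eq_sub_of_hasDerivAt (fun φ _ => hf.hasX ht φ) (hf.dX.ii ht _ _)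

lemma hasIn (hf : Sm f) {t : ℝ} (ht : 0 < t) : HasDerivAt (In f) (In (_root_.dT f) t) t := by
  have hK : IsCompact (Icc (t/2) (2*t) ×ˢ Icc (0:ℝ) (2*π)) := isCompact_Icc.prod isCompact_Icc
  have hc : ContinuousOn (fun p : ℝ × ℝ => _root_.dT f p.1 p.2)
      (Icc (t/2) (2*t) ×ˢ Icc (0:ℝ) (2*π)) := by
    intro p hp
    have h0 : 0 < p.1 := by have := hp.1.1; linarith
    exact (((hf.dT p.1 h0).1 p.2).continuousAt).continuousWithinAt
  obtain ⟨C, hC⟩ := hK.exists_bound_of_continuousOn hc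
  have hs : Icc (t/2) (2*t) ∈ 𝓝 t := Icc_mem_nhds (by linarith) (by linarith)
  have h2 : (0:ℝ) ≤ 2 * π := by positivity
  refine (intervalIntegral.hasDerivAt_integral_of_dominated_loc_of_deriv_le
    (F := f) (F' := _root_.dT f) (bound := fun _ => C) hs ?_ (hf.ii ht _ _) ?_ ?_ ?_ ?_).2
  · filter_upwards [lt_mem_nhds ht] with τ hτ
    exact (hf.cont hτ).aestronglyMeasurable
  · exact (hf.dT.cont ht).aestronglyMeasurable
  · refine ae_of_all _ fun φ hφ τ hτ => hC (τ, φ) ⟨hτ, ?_⟩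
    rw [uIoc_of_le h2] at hφ
    exact ⟨hφ.1.le, hφ.2⟩
  · exact intervalIntegrable_const
  · refine ae_of_all _ fun φ hφ τ hτ => hf.hasT (by have := hτ.1; linarith) φ

end Sm

/-- integrals agree up to a total derivative -/
lemma In_total {f h b : ℝ → ℝ → ℝ} {t : ℝ} (ht : 0 < t) (hh : Sm h) (hb : Sm b)
    (e : ∀ φ, f t φ = h t φ + dX b t φ) : In f t = In h t := by
  have : In f t = In h t + In (dX b) t := by
    unfold In
    rw [← intervalIntegral.integral_add (hh.ii ht _ _) (hb.dX.ii ht _ _)]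
    exact intervalIntegral.integral_congr fun φ _ => e φ
  rw [this, hb.In_dX ht, add_zero]

lemma twopi_nn : (0:ℝ) ≤ 2 * π := by positivity

lemma In_mono {f h : ℝ → ℝ → ℝ} {t : ℝ} (hf : Continuous (f t)) (hh : Continuous (h t))
    (e : ∀ φ, f t φ ≤ h t φ) : In f t ≤ In h t :=
  intervalIntegral.integral_mono_on twopi_nn (hf.intervalIntegrable _ _)
    (hh.intervalIntegrable _ _) fun φ _ => e φ

lemma dX_congr {f h : ℝ → ℝ → ℝ} {t : ℝ} (ht : 0 < t) (φ : ℝ)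
    (e : ∀ t, 0 < t → ∀ φ, f t φ = h t φ) : dX f t φ = dX h t φ := by
  unfold dX
  congr 1
  funext ψ
  exact e t ht ψ

lemma dT_congr {f h : ℝ → ℝ → ℝ} {t : ℝ} (ht : 0 < t) (φ : ℝ)
    (e : ∀ t, 0 < t → ∀ φ, f t φ = h t φ) : dT f t φ = dT h t φ := by
  apply Filter.EventuallyEq.deriv_eq
  filter_upwards [lt_mem_nhds ht] with τ hτ
  exact e τ hτ φ

section rules
variable {f h : ℝ → ℝ → ℝ} {t : ℝ}
lemma dX_mul (hf : Sm f) (hh : Sm h) (ht : 0 < t) (φ : ℝ) :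
    dX (fun t φ => f t φ * h t φ) t φ = dX f t φ * h t φ + f t φ * dX h t φ :=
  ((hf.hasX ht φ).mul (hh.hasX ht φ)).deriv
lemma dX_add (hf : Sm f) (hh : Sm h) (ht : 0 < t) (φ : ℝ) :
    dX (fun t φ => f t φ + h t φ) t φ = dX f t φ + dX h t φ :=
  ((hf.hasX ht φ).add (hh.hasX ht φ)).deriv
lemma dX_sub (hf : Sm f) (hh : Sm h) (ht : 0 < t) (φ : ℝ) :
    dX (fun t φ => f t φ - h t φ) t φ = dX f t φ - dX h t φ :=
  ((hf.hasX ht φ).sub (hh.hasX ht φ)).deriv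
lemma dT_mul (hf : Sm f) (hh : Sm h) (ht : 0 < t) (φ : ℝ) :
    dT (fun t φ => f t φ * h t φ) t φ = dT f t φ * h t φ + f t φ * dT h t φ :=
  ((hf.hasT ht φ).mul (hh.hasT ht φ)).deriv
lemma dT_add (hf : Sm f) (hh : Sm h) (ht : 0 < t) (φ : ℝ) :
    dT (fun t φ => f t φ + h t φ) t φ = dT f t φ + dT h t φ :=
  ((hf.hasT ht φ).add (hh.hasT ht φ)).deriv
lemma dT_sub (hf : Sm f) (hh : Sm h) (ht : 0 < t) (φ : ℝ) :
    dT (fun t φ => f t φ - h t φ) t φ = dT f t φ - dT h t φ :=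
  ((hf.hasT ht φ).sub (hh.hasT ht φ)).deriv
lemma dX_const (c : ℝ) (t φ : ℝ) : dX (fun _ _ => c) t φ = 0 := by simp [dX]
lemma dT_const (c : ℝ) (t φ : ℝ) : dT (fun _ _ => c) t φ = 0 := by simp [dT]
end rules

/-- All data of the flow, for positive times. -/
structure Fl (x y g p q k a v : ℝ → ℝ → ℝ) : Prop where
  sx : Sm x
  sy : Sm y
  sg : Sm g
  sp : Sm p
  sq : Sm q
  sk : Sm k
  sa : Sm a
  sv : Sm v
  gpos : ∀ t, 0 < t → ∀ φ, 0 < g t φ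
  pq : ∀ t, 0 < t → ∀ φ, p t φ * p t φ + q t φ * q t φ = 1
  xX : ∀ t, 0 < t → ∀ φ, dX x t φ = g t φ * p t φ
  yX : ∀ t, 0 < t → ∀ φ, dX y t φ = g t φ * q t φ
  kg : ∀ t, 0 < t → ∀ φ, k t φ * g t φ = p t φ * dX q t φ - q t φ * dX p t φ
  xT : ∀ t, 0 < t → ∀ φ, dT x t φ = a t φ * p t φ - v t φ * q t φ
  yT : ∀ t, 0 < t → ∀ φ, dT y t φ = a t φ * q t φ + v t φ * p t φ
  vk : ∀ t, 0 < t → ∀ φ, v t φ = k t φ - 2 * π / In g t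

namespace Fl

variable {x y g p q k a v : ℝ → ℝ → ℝ} {t : ℝ} (ht : 0 < t)

lemma ppX (F : Fl x y g p q k a v) (ht : 0 < t) (φ : ℝ) : p t φ * dX p t φ + q t φ * dX q t φ = 0 := by
  have h := dX_congr (h := fun _ _ => 1) ht φ F.pq
  rw [dX_const, dX_add (F.sp.mul F.sp) (F.sq.mul F.sq) ht, dX_mul F.sp F.sp ht,
    dX_mul F.sq F.sq ht] at h
  linear_combination h / 2

lemma ppT (F : Fl x y g p q k a v) (ht : 0 < t) (φ : ℝ) : p t φ * dT p t φ + q t φ * dT q t φ = 0 := by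
  have h := dT_congr (h := fun _ _ => 1) ht φ F.pq
  rw [dT_const, dT_add (F.sp.mul F.sp) (F.sq.mul F.sq) ht, dT_mul F.sp F.sp ht,
    dT_mul F.sq F.sq ht] at h
  linear_combination h / 2

lemma pX (F : Fl x y g p q k a v) : ∀ t, 0 < t → ∀ φ, dX p t φ = - (k t φ * g t φ) * q t φ := by
  intro t ht φ
  linear_combination (-dX p t φ) * F.pq t ht φ + p t φ * F.ppX ht φ + q t φ * F.kg t ht φ

lemma qX (F : Fl x y g p q k a v) : ∀ t, 0 < t → ∀ φ, dX q t φ = (k t φ * g t φ) * p t φ := by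
  intro t ht φ
  linear_combination (-dX q t φ) * F.pq t ht φ + q t φ * F.ppX ht φ - p t φ * F.kg t ht φ

lemma vX (F : Fl x y g p q k a v) (ht : 0 < t) (φ : ℝ) : dX v t φ = dX k t φ := by
  have : (fun ψ => v t ψ) = fun ψ => k t ψ - 2 * π / In g t := funext (F.vk t ht)
  unfold dX
  rw [this, deriv_sub_const]

lemma e1 (F : Fl x y g p q k a v) (ht : 0 < t) (φ : ℝ) : dT g t φ * p t φ + g t φ * dT p t φ =
    dX a t φ * p t φ + a t φ * dX p t φ - (dX v t φ * q t φ + v t φ * dX q t φ) := by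
  have h := F.sx.comm ht φ
  rw [dT_congr ht φ F.xX, dX_congr ht φ F.xT, dX_sub (F.sa.mul F.sp) (F.sv.mul F.sq) ht,
    dX_mul F.sa F.sp ht, dX_mul F.sv F.sq ht, dT_mul F.sg F.sp ht] at h
  exact h.symm

lemma e2 (F : Fl x y g p q k a v) (ht : 0 < t) (φ : ℝ) : dT g t φ * q t φ + g t φ * dT q t φ =
    dX a t φ * q t φ + a t φ * dX q t φ + (dX v t φ * p t φ + v t φ * dX p t φ) := by
  have h := F.sy.comm ht φ
  rw [dT_congr ht φ F.yX, dX_congr ht φ F.yT, dX_add (F.sa.mul F.sq) (F.sv.mul F.sp) ht,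
    dX_mul F.sa F.sq ht, dX_mul F.sv F.sp ht, dT_mul F.sg F.sq ht] at h
  exact h.symm

lemma gT (F : Fl x y g p q k a v) (ht : 0 < t) (φ : ℝ) : dT g t φ = dX a t φ - k t φ * v t φ * g t φ := by
  have h1 := F.e1 ht φ
  have h2 := F.e2 ht φ
  rw [F.pX t ht, F.qX t ht] at h1 h2
  linear_combination p t φ * h1 + q t φ * h2 - g t φ * F.ppT ht φ -
    (dT g t φ - dX a t φ + v t φ * k t φ * g t φ) * F.pq t ht φ

/-- the arc length derivative of curvature -/
lemma sz (F : Fl x y g p q k a v) : Sm (fun t φ => dX k t φ / g t φ) :=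
  F.sk.dX.div F.sg fun t ht φ => (F.gpos t ht φ).ne'

lemma som (F : Fl x y g p q k a v) : Sm (fun t φ => a t φ * k t φ + dX k t φ / g t φ) :=
  (F.sa.mul F.sk).add F.sz

lemma pT (F : Fl x y g p q k a v) : ∀ t, 0 < t → ∀ φ, dT p t φ = 0 - q t φ * (a t φ * k t φ + dX k t φ / g t φ) := by
  intro t ht φ
  have h1 := F.e1 ht φ
  have h2 := F.e2 ht φ
  have hg := (F.gpos t ht φ).ne'
  rw [F.pX t ht, F.qX t ht, F.vX ht] at h1 h2
  have h3 : g t φ * dT p t φ = - (q t φ * (a t φ * k t φ * g t φ + dX k t φ)) := by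
    linear_combination q t φ * q t φ * h1 - p t φ * q t φ * h2 + g t φ * p t φ * F.ppT ht φ -
      (g t φ * dT p t φ + q t φ * (a t φ * k t φ * g t φ + dX k t φ)) * F.pq t ht φ
  field_simp
  linear_combination h3

lemma qT (F : Fl x y g p q k a v) : ∀ t, 0 < t → ∀ φ, dT q t φ = p t φ * (a t φ * k t φ + dX k t φ / g t φ) := by
  intro t ht φ
  have h1 := F.e1 ht φ
  have h2 := F.e2 ht φ
  have hg := (F.gpos t ht φ).ne'
  rw [F.pX t ht, F.qX t ht, F.vX ht] at h1 h2
  have h3 : g t φ * dT q t φ = (p t φ * (a t φ * k t φ * g t φ + dX k t φ)) := by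
    linear_combination p t φ * p t φ * h2 - p t φ * q t φ * h1 + g t φ * q t φ * F.ppT ht φ -
      (g t φ * dT q t φ - p t φ * (a t φ * k t φ * g t φ + dX k t φ)) * F.pq t ht φ
  field_simp
  linear_combination h3

lemma kgT (F : Fl x y g p q k a v) (ht : 0 < t) (φ : ℝ) : dT k t φ * g t φ + k t φ * dT g t φ =
    dX (fun t φ => a t φ * k t φ + dX k t φ / g t φ) t φ := by
  have h1 := F.sp.comm ht φ
  have h2 := F.sq.comm ht φ
  have e : ∀ t, 0 < t → ∀ φ, dX p t φ = 0 - k t φ * g t φ * q t φ := by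
    intro t ht φ; rw [F.pX t ht]; ring
  rw [dT_congr ht φ e, dX_congr ht φ F.pT, dX_sub (Sm.const 0) (F.sq.mul F.som) ht,
    dT_sub (Sm.const 0) ((F.sk.mul F.sg).mul F.sq) ht, dX_const, dT_const,
    dX_mul F.sq F.som ht, dT_mul (F.sk.mul F.sg) F.sq ht, dT_mul F.sk F.sg ht,
    F.qX t ht, F.qT t ht] at h1
  rw [dT_congr ht φ F.qX, dX_congr ht φ F.qT, 
    dX_mul F.sp F.som ht, dT_mul (F.sk.mul F.sg) F.sp ht, dT_mul F.sk F.sg ht,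
    F.pX t ht, F.pT t ht] at h2
  linear_combination q t φ * h1 - p t φ * h2 - (dT k t φ * g t φ + k t φ * dT g t φ -
    dX (fun t φ => a t φ * k t φ + dX k t φ / g t φ) t φ) * F.pq t ht φ

lemma kT (F : Fl x y g p q k a v) (ht : 0 < t) (φ : ℝ) : dT k t φ * g t φ =
    a t φ * dX k t φ + dX (fun t φ => dX k t φ / g t φ) t φ + k t φ ^ 2 * v t φ * g t φ := by
  have h := F.kgT ht φ
  rw [dX_add (F.sa.mul F.sk) F.sz ht, dX_mul F.sa F.sk ht, F.gT ht] at h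
  linear_combination h

/-! ### evolution of integrals -/

lemma Lpos (F : Fl x y g p q k a v) (ht : 0 < t) : 0 < In g t :=
  intervalIntegral.intervalIntegral_pos_of_pos_on (F.sg.ii ht _ _) (fun φ _ => F.gpos t ht φ)
    (by positivity)

lemma L_deriv (F : Fl x y g p q k a v) (ht : 0 < t) : HasDerivAt (In g) (- In (fun t φ => k t φ * v t φ * g t φ) t) t := by
  have h := F.sg.hasIn ht
  have e : In (dT g) t = In (fun t φ => 0 - k t φ * v t φ * g t φ) t := by
    refine In_total ht ((Sm.const 0).sub ((F.sk.mul F.sv).mul F.sg)) F.sa fun φ => ?_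
    rw [F.gT ht]; ring
  rw [e] at h
  convert h using 1
  simp [In]

lemma m_deriv (F : Fl x y g p q k a v) (ht : 0 < t) : HasDerivAt (In (fun t φ => k t φ * g t φ)) 0 t := by
  have h := (F.sk.mul F.sg).hasIn ht
  have e : In (dT (fun t φ => k t φ * g t φ)) t = In (fun _ _ => 0) t := by
    refine In_total ht (Sm.const 0) F.som fun φ => ?_
    rw [dT_mul F.sk F.sg ht, F.kgT ht]; ring
  rw [e] at h
  simpa [In] using h

lemma A_deriv (F : Fl x y g p q k a v) (ht : 0 < t) : HasDerivAt (In (fun t φ => x t φ * dX y t φ - y t φ * dX x t φ))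
    (- (2 * In (fun t φ => v t φ * g t φ) t)) t := by
  have h := ((F.sx.mul F.sy.dX).sub (F.sy.mul F.sx.dX)).hasIn ht
  have e : In (dT (fun t φ => x t φ * dX y t φ - y t φ * dX x t φ)) t
      = In (fun t φ => (-2) * (v t φ * g t φ)) t := by
    refine In_total ht ((Sm.const (-2)).mul (F.sv.mul F.sg))
      ((F.sx.mul F.sy.dT).sub (F.sy.mul F.sx.dT)) fun φ => ?_
    rw [dT_sub (F.sx.mul F.sy.dX) (F.sy.mul F.sx.dX) ht, dT_mul F.sx F.sy.dX ht,
      dT_mul F.sy F.sx.dX ht, dX_sub (F.sx.mul F.sy.dT) (F.sy.mul F.sx.dT) ht,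
      dX_mul F.sx F.sy.dT ht, dX_mul F.sy F.sx.dT ht, F.sx.comm ht, F.sy.comm ht,
      F.xX t ht, F.yX t ht, F.xT t ht, F.yT t ht]
    linear_combination (-2 * v t φ * g t φ) * F.pq t ht φ
  rw [e] at h
  convert h using 1
  unfold In
  rw [intervalIntegral.integral_const_mul]; ring

lemma Q_deriv (F : Fl x y g p q k a v) (ht : 0 < t) : HasDerivAt (In (fun t φ => k t φ ^ 2 * g t φ))
    (In (fun t φ => k t φ ^ 3 * v t φ * g t φ - 2 * ((dX k t φ / g t φ) ^ 2 * g t φ)) t) t := by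
  have h := ((F.sk.mul F.sk).mul F.sg).hasIn ht
  have e : In (dT (fun t φ => k t φ * k t φ * g t φ)) t
      = In (fun t φ => k t φ ^ 3 * v t φ * g t φ - 2 * ((dX k t φ / g t φ) ^ 2 * g t φ)) t := by
    refine In_total ht ((((F.sk.pow 3).mul F.sv).mul F.sg).sub
      ((Sm.const 2).mul ((F.sz.pow 2).mul F.sg)))
      ((F.sa.mul (F.sk.mul F.sk)).add ((Sm.const 2).mul (F.sk.mul F.sz))) fun φ => ?_
    rw [dT_mul (F.sk.mul F.sk) F.sg ht, dT_mul F.sk F.sk ht,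
      dX_add (F.sa.mul (F.sk.mul F.sk)) ((Sm.const 2).mul (F.sk.mul F.sz)) ht,
      dX_mul F.sa (F.sk.mul F.sk) ht, dX_mul F.sk F.sk ht, 
      dX_mul (Sm.const 2) (F.sk.mul F.sz) ht, dX_mul F.sk F.sz ht, dX_const, F.gT ht]
    have hk := F.kT ht φ
    have hg := (F.gpos t ht φ).ne'
    have hz : dX k t φ = (dX k t φ / g t φ) * g t φ := by field_simp
    generalize dX k t φ / g t φ = z at *
    rw [hz] at hk ⊢
    linear_combination (2 * k t φ) * hk 
  rw [e] at h
  convert h using 2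
  funext τ φ; ring

lemma sw (F : Fl x y g p q k a v) : Sm (fun t φ => dX (fun t φ => dX k t φ / g t φ) t φ / g t φ) :=
  F.sz.dX.div F.sg fun t ht φ => (F.gpos t ht φ).ne'

lemma zT (F : Fl x y g p q k a v) (ht : 0 < t) (φ : ℝ) :
    dT (fun t φ => dX k t φ / g t φ) t φ * g t φ + (dX k t φ / g t φ) * dT g t φ =
    dX (fun t φ => a t φ * (dX k t φ / g t φ) +
      dX (fun t φ => dX k t φ / g t φ) t φ / g t φ + k t φ ^ 2 * v t φ) t φ := by
  have e0 : ∀ t, 0 < t → ∀ φ, dX k t φ = (dX k t φ / g t φ) * g t φ := by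
    intro t ht φ
    have hg := (F.gpos t ht φ).ne'
    field_simp
  have h := F.sk.comm ht φ
  have e1 : ∀ t, 0 < t → ∀ φ, dT k t φ = a t φ * (dX k t φ / g t φ) +
      dX (fun t φ => dX k t φ / g t φ) t φ / g t φ + k t φ ^ 2 * v t φ := by
    intro t ht φ
    have hg := (F.gpos t ht φ).ne'
    have h := F.kT ht φ
    field_simp
    linear_combination h
  rw [dX_congr ht φ e1, dT_congr ht φ e0, dT_mul F.sz F.sg ht] at h
  exact h.symm

lemma G_deriv (F : Fl x y g p q k a v) (ht : 0 < t) : HasDerivAt (In (fun t φ => (dX k t φ / g t φ) ^ 2 * g t φ))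
    (In (fun t φ => (dX k t φ / g t φ) ^ 2 * k t φ * v t φ * g t φ
      - 2 * ((dX (fun t φ => dX k t φ / g t φ) t φ / g t φ) ^ 2 * g t φ)
      - 2 * ((dX (fun t φ => dX k t φ / g t φ) t φ / g t φ) * (k t φ ^ 2 * v t φ) * g t φ)) t) t := by
  have hzT := F.zT (t := t) ht
  have sz := F.sz
  have sw := F.sw
  have hwdef : ∀ φ, dX (fun t φ => dX k t φ / g t φ) t φ =
      dX (fun t φ => dX k t φ / g t φ) t φ / g t φ * g t φ := by
    intro φ
    have hg := (F.gpos t ht φ).ne'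
    field_simp
  set z : ℝ → ℝ → ℝ := fun t φ => dX k t φ / g t φ with hz
  have hzz : ∀ t φ, dX k t φ / g t φ = z t φ := fun _ _ => rfl
  simp only [hzz] at *
  set w : ℝ → ℝ → ℝ := fun t φ => dX z t φ / g t φ with hw
  have hww : ∀ t φ, dX z t φ / g t φ = w t φ := fun _ _ => rfl
  simp only [hww] at *
  clear hww hw hzz hz
  clear_value w
  clear_value z
  have h := ((sz.mul sz).mul F.sg).hasIn ht
  have skv : Sm (fun t φ => k t φ ^ 2 * v t φ) := (F.sk.pow 2).mul F.sv
  have e : In (dT (fun t φ => z t φ * z t φ * g t φ)) t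
      = In (fun t φ => z t φ ^ 2 * k t φ * v t φ * g t φ
      - 2 * (w t φ ^ 2 * g t φ)
      - 2 * (w t φ * (k t φ ^ 2 * v t φ) * g t φ)) t := by
    refine In_total ht (((((sz.pow 2).mul F.sk).mul F.sv).mul F.sg).sub
      ((Sm.const 2).mul ((sw.pow 2).mul F.sg)) |>.sub 
      ((Sm.const 2).mul ((sw.mul skv).mul F.sg)))
      ((F.sa.mul (sz.mul sz)).add ((Sm.const 2).mul (sz.mul (sw.add skv)))) fun φ => ?_
    rw [dT_mul (sz.mul sz) F.sg ht, dT_mul sz sz ht,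
      dX_add (F.sa.mul (sz.mul sz)) ((Sm.const 2).mul (sz.mul (sw.add skv))) ht,
      dX_mul F.sa (sz.mul sz) ht, dX_mul sz sz ht, 
      dX_mul (Sm.const 2) (sz.mul (sw.add skv)) ht, dX_mul sz (sw.add skv) ht, dX_const]
    have h1 := hzT φ
    have h2 := hwdef φ
    rw [dX_add ((F.sa.mul sz).add sw) skv ht, dX_add (F.sa.mul sz) sw ht, dX_mul F.sa sz ht] at h1
    rw [dX_add sw skv ht]
    have h3 := F.gT ht φ
    rw [h2] at h1 ⊢
    rw [h3] at h1 ⊢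
    linear_combination (2 * z t φ) * h1
  rw [e] at h
  convert h using 2
  funext τ φ; ring

lemma C1_deriv (F : Fl x y g p q k a v) (ht : 0 < t) : HasDerivAt (In (fun t φ => x t φ * (k t φ * g t φ)))
    (In (fun t φ => (-2) * (k t φ * v t φ * q t φ * g t φ)) t) t := by
  have h := (F.sx.mul (F.sk.mul F.sg)).hasIn ht
  have e : In (dT (fun t φ => x t φ * (k t φ * g t φ))) t
      = In (fun t φ => (-2) * (k t φ * v t φ * q t φ * g t φ)) t := by
    refine In_total ht ((Sm.const (-2)).mul (((F.sk.mul F.sv).mul F.sq).mul F.sg))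
      ((F.sx.mul F.som).sub (F.sp.mul F.sv)) fun φ => ?_
    have hg := (F.gpos t ht φ).ne'
    rw [dT_mul F.sx (F.sk.mul F.sg) ht, dT_mul F.sk F.sg ht, F.kgT ht,
      dX_sub (F.sx.mul F.som) (F.sp.mul F.sv) ht, dX_mul F.sx F.som ht, dX_mul F.sp F.sv ht,
      F.vX ht, F.pX t ht, F.xX t ht, F.xT t ht]
    field_simp
    ring
  rwa [e] at h

lemma C2_deriv (F : Fl x y g p q k a v) (ht : 0 < t) : HasDerivAt (In (fun t φ => y t φ * (k t φ * g t φ)))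
    (In (fun t φ => 2 * (k t φ * v t φ * p t φ * g t φ)) t) t := by
  have h := (F.sy.mul (F.sk.mul F.sg)).hasIn ht
  have e : In (dT (fun t φ => y t φ * (k t φ * g t φ))) t
      = In (fun t φ => 2 * (k t φ * v t φ * p t φ * g t φ)) t := by
    refine In_total ht ((Sm.const 2).mul (((F.sk.mul F.sv).mul F.sp).mul F.sg))
      ((F.sy.mul F.som).sub (F.sq.mul F.sv)) fun φ => ?_
    have hg := (F.gpos t ht φ).ne'
    rw [dT_mul F.sy (F.sk.mul F.sg) ht, dT_mul F.sk F.sg ht, F.kgT ht,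
      dX_sub (F.sy.mul F.som) (F.sq.mul F.sv) ht, dX_mul F.sy F.som ht, dX_mul F.sq F.sv ht,
      F.vX ht, F.qX t ht, F.yX t ht, F.yT t ht]
    field_simp
    ring
  rwa [e] at h

end Fl

/-! ### one-variable lemmas -/

lemma deriv_le_bound {f f' : ℝ → ℝ} {T C s t : ℝ} (hf : ∀ t, T < t → HasDerivAt f (f' t) t)
    (hC : ∀ t, T < t → f' t ≤ C) (hs : T < s) (hst : s ≤ t) : f t ≤ f s + C * (t - s) := by
  rcases hst.eq_or_lt with rfl | h
  · simp
  obtain ⟨ξ, hξ, e⟩ := exists_hasDerivAt_eq_slope f f' h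
    (fun u hu => (hf u (hs.trans_le hu.1)).continuousAt.continuousWithinAt)
    (fun u hu => hf u (hs.trans hu.1))
  have h1 := hC ξ (hs.trans hξ.1)
  rw [e, div_le_iff₀ (by linarith)] at h1
  linarith

lemma mono_lim {P P' : ℝ → ℝ} {T B : ℝ} (hP : ∀ t, T < t → HasDerivAt P (P' t) t)
    (h0 : ∀ t, T < t → 0 ≤ P' t) (hB : ∀ t, T < t → P t ≤ B) :
    ∃ l, Tendsto P atTop (𝓝 l) := by
  have mono : ∀ s t, T < s → s ≤ t → P s ≤ P t := by
    intro s t hs hst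
    have := deriv_le_bound (f := fun t => - P t) (f' := fun t => - P' t) (C := 0)
      (fun t ht => (hP t ht).neg) (fun t ht => by have := h0 t ht; linarith) hs hst
    linarith
  have hm : Monotone (fun t => P (max t (T + 1))) := by
    intro s t hst
    exact mono _ _ (lt_of_lt_of_le (by linarith) (le_max_right _ _)) (max_le_max hst le_rfl)
  have hb : BddAbove (range (fun t => P (max t (T + 1)))) := by
    refine ⟨B, ?_⟩
    rintro _ ⟨t, rfl⟩
    exact hB _ (lt_of_lt_of_le (by linarith) (le_max_right _ _))
  refine ⟨_, (tendsto_atTop_ciSup hm hb).congr' ?_⟩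
  filter_upwards [eventually_ge_atTop (T + 1)] with t ht
  rw [max_eq_left ht]

lemma barb {u u' P P' : ℝ → ℝ} {T B : ℝ} (hu : ∀ t, T < t → HasDerivAt u (u' t) t)
    (hP : ∀ t, T < t → HasDerivAt P (P' t) t) (h1 : ∀ t, T < t → u' t ≤ P' t)
    (h2 : ∀ t, T < t → 0 ≤ u t) (h3 : ∀ t, T < t → u t ≤ P' t) (hB : ∀ t, T < t → P t ≤ B) :
    Tendsto u atTop (𝓝 0) := by
  obtain ⟨l, hl⟩ := mono_lim hP (fun t ht => (h2 t ht).trans (h3 t ht)) hB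
  rw [Metric.tendsto_atTop] at hl ⊢
  intro ε hε
  obtain ⟨N, hN⟩ := hl (ε / 4) (by positivity)
  have hN' : ∀ n ≥ N, |P n - l| < ε / 4 := hN
  refine ⟨max N T + 2, fun t ht => ?_⟩
  have hNt : N ≤ t - 1 := by have := le_max_left N T; linarith
  have hTt : T < t - 1 := by have := le_max_right N T; linarith
  have hT : T < t := by linarith
  obtain ⟨ξ, hξ, e⟩ := exists_hasDerivAt_eq_slope P P' (show t - 1 < t by linarith)
    (fun s hs => (hP s (hTt.trans_le hs.1)).continuousAt.continuousWithinAt)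
    (fun s hs => hP s (hTt.trans hs.1))
  have hTξ := hTt.trans hξ.1
  have h4 := h3 ξ hTξ
  have h5 := deriv_le_bound (f := fun t => u t - P t) (f' := fun t => u' t - P' t) (C := 0)
      (fun t ht => (hu t ht).sub (hP t ht))
      (fun t ht => by have := h1 t ht; linarith) hTξ hξ.2.le
  rw [e] at h4
  simp only [sub_sub_cancel, div_one] at h4
  have a1 := abs_lt.1 (hN' t (by linarith))
  have a2 := abs_lt.1 (hN' (t - 1) hNt)
  have a3 := abs_lt.1 (hN' ξ (by linarith [hξ.1]))
  rw [Real.dist_eq, sub_zero, abs_of_nonneg (h2 t hT)]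
  linarith [a1.1, a1.2, a2.1, a2.2, a3.1, a3.2]

/-! ### integral lemmas -/

lemma In_abs_le {f h : ℝ → ℝ → ℝ} {t : ℝ} (hf : Continuous (f t)) (hh : Continuous (h t))
    (e : ∀ φ, |f t φ| ≤ h t φ) : |In f t| ≤ In h t := by
  rw [abs_le]
  refine ⟨?_, In_mono hf hh fun φ => (abs_le.1 (e φ)).2⟩
  have := In_mono (f := fun t φ => - h t φ) (h := f) (t := t) hh.neg hf
    fun φ => (abs_le.1 (e φ)).1
  simpa [In] using this

lemma In_add {f h : ℝ → ℝ → ℝ} {t : ℝ} (hf : Continuous (f t)) (hh : Continuous (h t)) :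
    In (fun t φ => f t φ + h t φ) t = In f t + In h t :=
  intervalIntegral.integral_add (hf.intervalIntegrable _ _) (hh.intervalIntegrable _ _)
lemma In_sub {f h : ℝ → ℝ → ℝ} {t : ℝ} (hf : Continuous (f t)) (hh : Continuous (h t)) :
    In (fun t φ => f t φ - h t φ) t = In f t - In h t :=
  intervalIntegral.integral_sub (hf.intervalIntegrable _ _) (hh.intervalIntegrable _ _)
lemma In_cmul (c : ℝ) (f : ℝ → ℝ → ℝ) (t : ℝ) :
    In (fun t φ => c * f t φ) t = c * In f t :=
  intervalIntegral.integral_const_mul _ _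
lemma In_congr {f h : ℝ → ℝ → ℝ} {t : ℝ} (e : ∀ φ, f t φ = h t φ) : In f t = In h t :=
  intervalIntegral.integral_congr fun φ _ => e φ

lemma osc {f : ℝ → ℝ → ℝ} (hf : Sm f) {t : ℝ} (ht : 0 < t) {h : ℝ → ℝ} (hh : Continuous h)
    (e : ∀ ψ, |dX f t ψ| ≤ h ψ) (a b : ℝ) :
    |f t b - f t a| ≤ ∫ φ in (0:ℝ)..(2 * π), h φ := by
  have per : Function.Periodic (f t) (2 * π) := (hf t ht).2
  obtain ⟨a', ha', ea⟩ := per.exists_mem_Ico₀ (by positivity) a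
  obtain ⟨b', hb', eb⟩ := per.exists_mem_Ico₀ (by positivity) b
  rw [ea, eb, ← hf.ftc ht]
  have h0 : ∀ ψ, 0 ≤ h ψ := fun ψ => (abs_nonneg _).trans (e ψ)
  have h1 : ‖∫ φ in a'..b', dX f t φ‖ ≤ |∫ φ in a'..b', h φ| :=
    intervalIntegral.norm_integral_le_abs_of_norm_le
      (ae_of_all _ fun ψ => e ψ) (hh.intervalIntegrable _ _)
  refine h1.trans ?_
  have h2 := intervalIntegral.abs_integral_mono_interval (f := h) (μ := volume)
    (a := a') (b := b') (c := 0) (d := 2 * π) ?_ (ae_of_all _ h0) (hh.intervalIntegrable _ _)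
  · refine h2.trans (le_of_eq (abs_of_nonneg ?_))
    exact intervalIntegral.integral_nonneg twopi_nn fun ψ _ => h0 ψ
  · rw [uIoc_of_le twopi_nn]
    intro ψ hψ
    rcases le_total a' b' with h | h
    · rw [uIoc_of_le h] at hψ
      exact ⟨ha'.1.trans_lt hψ.1, hψ.2.trans hb'.2.le⟩
    · rw [uIoc_of_ge h] at hψ
      exact ⟨hb'.1.trans_lt hψ.1, hψ.2.trans ha'.2.le⟩

lemma CS {f g : ℝ → ℝ → ℝ} {t : ℝ} (hf : Continuous (f t)) (hg : Continuous (g t))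
    (g0 : ∀ φ, 0 ≤ g t φ) (L : 0 < In g t) :
    (In (fun t φ => f t φ * g t φ) t) ^ 2 ≤ In g t * In (fun t φ => f t φ ^ 2 * g t φ) t := by
  set D := In (fun t φ => f t φ * g t φ) t with hD
  set c := D / In g t with hc
  have h : 0 ≤ In (fun t φ => (f t φ ^ 2 * g t φ - (2 * c) * (f t φ * g t φ)) + c ^ 2 * g t φ) t := by
    refine intervalIntegral.integral_nonneg twopi_nn fun φ _ => ?_
    nlinarith [mul_nonneg (sq_nonneg (f t φ - c)) (g0 φ)]
  rw [In_add (by fun_prop) (by fun_prop), In_sub (by fun_prop) (by fun_prop), In_cmul, In_cmul,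
    ← hD] at h
  have e : D = c * In g t := by rw [hc]; field_simp
  rw [e] at h ⊢
  nlinarith [mul_nonneg L.le h]

namespace Fl

variable {x y g p q k a v : ℝ → ℝ → ℝ} {t : ℝ}

lemma rot_int (F : Fl x y g p q k a v) (ht : 0 < t) : ∃ m : ℤ, In (fun t φ => k t φ * g t φ) t = m * (2 * π) := by
  have hc : Continuous (fun φ => k t φ * g t φ) := (F.sk.mul F.sg).cont ht
  set θ : ℝ → ℝ := fun φ => ∫ ψ in (0:ℝ)..φ, k t ψ * g t ψ with hθ
  have dθ : ∀ φ, HasDerivAt θ (k t φ * g t φ) φ := fun φ =>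
    intervalIntegral.integral_hasDerivAt_right (hc.intervalIntegrable _ _)
      (hc.stronglyMeasurableAtFilter _ _) hc.continuousAt
  have θ0 : θ 0 = 0 := by simp [hθ]
  have hp : ∀ φ, HasDerivAt (fun φ => p t φ) (- (k t φ * g t φ) * q t φ) φ := fun φ => by
    rw [← F.pX t ht]; exact F.sp.hasX ht φ
  have hq : ∀ φ, HasDerivAt (fun φ => q t φ) ((k t φ * g t φ) * p t φ) φ := fun φ => by
    rw [← F.qX t ht]; exact F.sq.hasX ht φ
  have d1 : ∀ φ, HasDerivAt (fun φ => p t φ * Real.cos (θ φ) + q t φ * Real.sin (θ φ)) 0 φ := by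
    intro φ
    refine (((hp φ).mul (dθ φ).cos).add ((hq φ).mul (dθ φ).sin)).congr_deriv ?_
    ring
  have d2 : ∀ φ, HasDerivAt (fun φ => q t φ * Real.cos (θ φ) - p t φ * Real.sin (θ φ)) 0 φ := by
    intro φ
    refine (((hq φ).mul (dθ φ).cos).sub ((hp φ).mul (dθ φ).sin)).congr_deriv ?_
    ring
  have c1 := is_const_of_deriv_eq_zero (fun φ => (d1 φ).differentiableAt)
    (fun φ => (d1 φ).deriv) (2 * π) 0
  have c2 := is_const_of_deriv_eq_zero (fun φ => (d2 φ).differentiableAt)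
    (fun φ => (d2 φ).deriv) (2 * π) 0
  have pp : p t (2 * π) = p t 0 := by have := (F.sp t ht).2 0; rwa [zero_add] at this
  have qq : q t (2 * π) = q t 0 := by have := (F.sq t ht).2 0; rwa [zero_add] at this
  simp only [θ0, pp, qq, Real.cos_zero, Real.sin_zero] at c1 c2
  have hcos : Real.cos (θ (2 * π)) = 1 := by
    linear_combination p t 0 * c1 + q t 0 * c2 +
      (1 - Real.cos (θ (2 * π))) * F.pq t ht 0
  obtain ⟨m, hm⟩ := (Real.cos_eq_one_iff _).1 hcos
  exact ⟨m, hm.symm⟩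

lemma rot (F : Fl x y g p q k a v) : ∃ m : ℤ, ∀ t, 0 < t → In (fun t φ => k t φ * g t φ) t = m * (2 * π) := by
  obtain ⟨m, hm⟩ := F.rot_int one_pos
  refine ⟨m, fun t ht => ?_⟩
  rw [← hm]
  refine isOpen_Ioi.is_const_of_deriv_eq_zero (s := Ioi (0:ℝ)) isPreconnected_Ioi
    (fun s hs => (F.m_deriv hs).differentiableAt.differentiableWithinAt)
    (fun s hs => (F.m_deriv hs).deriv) ht (mem_Ioi.2 one_pos)

lemma In_kv (F : Fl x y g p q k a v) (ht : 0 < t) : In (fun t φ => k t φ * v t φ * g t φ) t =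
    In (fun t φ => k t φ ^ 2 * g t φ) t - 2 * π / In g t * In (fun t φ => k t φ * g t φ) t := by
  have hk := F.sk.cont ht
  have hg := F.sg.cont ht
  rw [← In_cmul, ← In_sub (by fun_prop) (by fun_prop)]
  refine In_congr fun φ => ?_
  rw [F.vk t ht]; ring

lemma In_v (F : Fl x y g p q k a v) (ht : 0 < t) : In (fun t φ => v t φ * g t φ) t =
    In (fun t φ => k t φ * g t φ) t - 2 * π := by
  have hk := F.sk.cont ht
  have hg := F.sg.cont ht
  have hL := (F.Lpos ht).ne'
  have : 2 * π = 2 * π / In g t * In g t := by field_simp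
  rw [this, ← In_cmul, ← In_sub (by fun_prop) (by fun_prop)]
  refine In_congr fun φ => ?_
  rw [F.vk t ht]; ring

lemma L2_deriv (F : Fl x y g p q k a v) (ht : 0 < t) : HasDerivAt (fun t => In g t ^ 2)
    (4 * π * In (fun t φ => k t φ * g t φ) t -
      2 * (In g t * In (fun t φ => k t φ ^ 2 * g t φ) t)) t := by
  refine ((F.L_deriv ht).pow 2).congr_deriv ?_
  have hL := (F.Lpos ht).ne'
  rw [F.In_kv ht]
  field_simp
  ring

lemma area_le (F : Fl x y g p q k a v) (ht : 0 < t) :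
    |In (fun t φ => x t φ * dX y t φ - y t φ * dX x t φ) t| ≤ 2 * In g t ^ 2 := by
  have hg := F.sg.cont ht
  have hx := F.sx.cont ht
  have hy := F.sy.cont ht
  have hp := F.sp.cont ht
  have hq := F.sq.cont ht
  have sh : Sm (fun s φ => (x s φ - x t 0) * (g s φ * q s φ) - (y s φ - y t 0) * (g s φ * p s φ)) :=
    ((F.sx.sub (Sm.const _)).mul (F.sg.mul F.sq)).sub
      ((F.sy.sub (Sm.const _)).mul (F.sg.mul F.sp))
  have e : In (fun t φ => x t φ * dX y t φ - y t φ * dX x t φ) t =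
      In (fun s φ => (x s φ - x t 0) * (g s φ * q s φ) - (y s φ - y t 0) * (g s φ * p s φ)) t := by
    refine In_total ht sh
      (((Sm.const (x t 0)).mul F.sy).sub ((Sm.const (y t 0)).mul F.sx)) fun φ => ?_
    rw [dX_sub ((Sm.const (x t 0)).mul F.sy) ((Sm.const (y t 0)).mul F.sx) ht,
      dX_mul (Sm.const _) F.sy ht, dX_mul (Sm.const _) F.sx ht, dX_const, dX_const,
      F.xX t ht, F.yX t ht]
    ring
  have p1 : ∀ φ, |p t φ| ≤ 1 := fun φ => abs_le_one_iff_mul_self_le_one.2 (by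
    nlinarith [F.pq t ht φ, mul_self_nonneg (q t φ)])
  have q1 : ∀ φ, |q t φ| ≤ 1 := fun φ => abs_le_one_iff_mul_self_le_one.2 (by
    nlinarith [F.pq t ht φ, mul_self_nonneg (p t φ)])
  have ox : ∀ φ, |x t φ - x t 0| ≤ In g t := osc F.sx ht hg (fun ψ => by
    rw [F.xX t ht, abs_mul, abs_of_pos (F.gpos t ht ψ)]
    nlinarith [p1 ψ, F.gpos t ht ψ]) 0
  have oy : ∀ φ, |y t φ - y t 0| ≤ In g t := osc F.sy ht hg (fun ψ => by
    rw [F.yX t ht, abs_mul, abs_of_pos (F.gpos t ht ψ)]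
    nlinarith [q1 ψ, F.gpos t ht ψ]) 0
  rw [e]
  have : 2 * In g t ^ 2 = In (fun s φ => (2 * In g t) * g s φ) t := by rw [In_cmul]; ring
  rw [this]
  refine In_abs_le (sh.cont ht) (by fun_prop) fun φ => ?_
  have g0 := F.gpos t ht φ
  have L0 := F.Lpos ht
  have b1 : |(x t φ - x t 0) * (g t φ * q t φ)| ≤ In g t * (g t φ * 1) := by
    rw [abs_mul, abs_mul, abs_of_pos g0]
    gcongr
    · exact ox φ
    · exact q1 φ
  have b2 : |(y t φ - y t 0) * (g t φ * p t φ)| ≤ In g t * (g t φ * 1) := by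
    rw [abs_mul, abs_mul, abs_of_pos g0]
    gcongr
    · exact oy φ
    · exact p1 φ
  refine (abs_sub _ _).trans ?_
  linarith

/-- the rotation index is one -/
lemma rot_one (F : Fl x y g p q k a v) : ∀ t, 0 < t → In (fun t φ => k t φ * g t φ) t = 2 * π := by
  obtain ⟨m, hm⟩ := F.rot
  have hcs : ∀ t, 0 < t → (m * (2 * π)) ^ 2 ≤ In g t * In (fun t φ => k t φ ^ 2 * g t φ) t := by
    intro t ht
    rw [← hm t ht]
    exact CS (F.sk.cont ht) (F.sg.cont ht) (fun φ => (F.gpos t ht φ).le) (F.Lpos ht)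
  by_cases h1 : m = 1
  · intro t ht; rw [hm t ht, h1]; simp
  exfalso
  by_cases h0 : m = 0
  · -- area grows linearly, length bounded
    subst h0
    have hL : ∀ t, 1 ≤ t → In g t ^ 2 ≤ In g 1 ^ 2 := by
      intro t ht
      have := deriv_le_bound (T := 0) (C := 0) (fun t ht => F.L2_deriv ht) (fun t ht => by
        have := hcs t ht
        rw [hm t ht]
        push_cast at this ⊢
        nlinarith) one_pos ht
      linarith
    have hA : ∀ t, 1 ≤ t → - In (fun t φ => x t φ * dX y t φ - y t φ * dX x t φ) t ≤
        - In (fun t φ => x t φ * dX y t φ - y t φ * dX x t φ) 1 + (-1) * (t - 1) := by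
      intro t ht
      refine deriv_le_bound (T := 0) (C := -1) (fun t ht => (F.A_deriv ht).neg) (fun t ht => by
        rw [F.In_v ht, hm t ht]
        push_cast
        nlinarith [Real.pi_gt_three]) one_pos ht
    have b0 := abs_le.1 (F.area_le one_pos)
    have hge : 1 ≤ 2 + 4 * In g 1 ^ 2 := by nlinarith [sq_nonneg (In g 1)]
    have b1 := abs_le.1 (F.area_le (t := 2 + 4 * In g 1 ^ 2) (by linarith))
    have b2 := hL _ hge
    have b3 := hA _ hge
    linarith [b0.1, b0.2, b1.1, b1.2]
  · have hmm : (2:ℝ) ≤ m * (m - 1) := by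
      have : 2 ≤ m * (m - 1) := by
        rcases lt_or_gt_of_ne h0 with h | h
        · nlinarith
        · have : 2 ≤ m := by omega
          nlinarith
      exact_mod_cast this
    have hdec := fun t ht => deriv_le_bound (s := 1) (t := t) (T := 0) (C := -1)
      (fun t ht => F.L2_deriv ht) (fun t ht => by
        have := hcs t ht
        rw [hm t ht]
        have h9 : 9 ≤ π ^ 2 := by nlinarith [Real.pi_gt_three]
        nlinarith) one_pos ht
    have := hdec (2 + In g 1 ^ 2) (by nlinarith [sq_nonneg (In g 1)])
    nlinarith [sq_nonneg (In g (2 + In g 1 ^ 2))]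

end Fl

namespace Fl

variable {x y g p q k a v : ℝ → ℝ → ℝ} {t : ℝ}

lemma p1 (F : Fl x y g p q k a v) (ht : 0 < t) (φ : ℝ) : |p t φ| ≤ 1 := abs_le_one_iff_mul_self_le_one.2 (by
    nlinarith [F.pq t ht φ, mul_self_nonneg (q t φ)])
lemma q1 (F : Fl x y g p q k a v) (ht : 0 < t) (φ : ℝ) : |q t φ| ≤ 1 := abs_le_one_iff_mul_self_le_one.2 (by
    nlinarith [F.pq t ht φ, mul_self_nonneg (p t φ)])

lemma v0 (F : Fl x y g p q k a v) (ht : 0 < t) : In (fun t φ => v t φ * g t φ) t = 0 := by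
  rw [F.In_v ht, F.rot_one t ht, sub_self]

lemma kv_eq (F : Fl x y g p q k a v) (ht : 0 < t) : In (fun t φ => k t φ * v t φ * g t φ) t =
    In (fun t φ => v t φ ^ 2 * g t φ) t := by
  have hv := F.sv.cont ht
  have hg := F.sg.cont ht
  have : In (fun t φ => k t φ * v t φ * g t φ) t =
      In (fun s φ => v s φ ^ 2 * g s φ + (2 * π / In g t) * (v s φ * g s φ)) t := by
    refine In_congr fun φ => ?_
    have := F.vk t ht φ
    rw [show k t φ = v t φ + 2 * π / In g t by linarith]; ring
  rw [this, In_add (by fun_prop) (by fun_prop), In_cmul, F.v0 ht]; ring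

lemma E_eq (F : Fl x y g p q k a v) (ht : 0 < t) : In (fun t φ => v t φ ^ 2 * g t φ) t =
    In (fun t φ => k t φ ^ 2 * g t φ) t - 4 * π ^ 2 / In g t := by
  rw [← F.kv_eq ht, F.In_kv ht, F.rot_one t ht]; ring

lemma L_deriv' (F : Fl x y g p q k a v) (ht : 0 < t) : HasDerivAt (In g) (- In (fun t φ => v t φ ^ 2 * g t φ) t) t := by
  rw [← F.kv_eq ht]; exact F.L_deriv ht

lemma E_nn (F : Fl x y g p q k a v) (ht : 0 < t) : 0 ≤ In (fun t φ => v t φ ^ 2 * g t φ) t :=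
  intervalIntegral.integral_nonneg twopi_nn fun φ _ =>
    mul_nonneg (sq_nonneg _) (F.gpos t ht φ).le

lemma G_nn (F : Fl x y g p q k a v) (ht : 0 < t) : 0 ≤ In (fun t φ => (dX k t φ / g t φ) ^ 2 * g t φ) t :=
  intervalIntegral.integral_nonneg twopi_nn fun φ _ =>
    mul_nonneg (sq_nonneg _) (F.gpos t ht φ).le

lemma D_nn (F : Fl x y g p q k a v) (ht : 0 < t) : 0 ≤ In (fun t φ => |v t φ| * g t φ) t :=
  intervalIntegral.integral_nonneg twopi_nn fun φ _ =>
    mul_nonneg (abs_nonneg _) (F.gpos t ht φ).le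

lemma D_sq (F : Fl x y g p q k a v) (ht : 0 < t) : In (fun t φ => |v t φ| * g t φ) t ^ 2 ≤
    In g t * In (fun t φ => v t φ ^ 2 * g t φ) t := by
  have := CS (f := fun t φ => |v t φ|) (g := g) (t := t) (F.sv.cont ht).abs (F.sg.cont ht)
    (fun φ => (F.gpos t ht φ).le) (F.Lpos ht)
  simpa only [sq_abs] using this

/-- interpolation -/
lemma sup_v (F : Fl x y g p q k a v) (ht : 0 < t) {lam : ℝ} (hl : 0 < lam) (φ : ℝ) : v t φ ^ 2 ≤
    lam * In (fun t φ => v t φ ^ 2 * g t φ) t +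
      lam⁻¹ * In (fun t φ => (dX k t φ / g t φ) ^ 2 * g t φ) t := by
  have hv := F.sv.cont ht
  have hg := F.sg.cont ht
  have hz : Continuous (fun φ => dX k t φ / g t φ) := F.sz.cont ht
  obtain ⟨b, hb⟩ : ∃ b, v t b = 0 := by
    apply mem_range_of_exists_le_of_exists_ge hv
    · by_contra! h
      have : 0 < In (fun t φ => v t φ * g t φ) t :=
        intervalIntegral.intervalIntegral_pos_of_pos_on ((F.sv.mul F.sg).ii ht _ _)
          (fun φ _ => mul_pos (h φ) (F.gpos t ht φ)) (by positivity)
      rw [F.v0 ht] at this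
      exact this.false
    · by_contra! h
      have : 0 < In (fun t φ => (-1) * (v t φ * g t φ)) t :=
        intervalIntegral.intervalIntegral_pos_of_pos_on
          (((Sm.const (-1)).mul (F.sv.mul F.sg)).ii ht _ _)
          (fun φ _ => by have := mul_pos (neg_pos.2 (h φ)) (F.gpos t ht φ); linarith)
            (by positivity)
      rw [In_cmul, F.v0 ht] at this
      simp at this
  have h := osc (F.sv.mul F.sv) ht
    (h := fun φ => lam * (v t φ ^ 2 * g t φ) + lam⁻¹ * ((dX k t φ / g t φ) ^ 2 * g t φ))
    (by fun_prop) (fun ψ => ?_) b φ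
  · rw [hb] at h
    have h2 : In (fun t φ => lam * (v t φ ^ 2 * g t φ) +
        lam⁻¹ * ((dX k t φ / g t φ) ^ 2 * g t φ)) t = _ :=
      In_add (f := fun t φ => lam * (v t φ ^ 2 * g t φ))
        (h := fun t φ => lam⁻¹ * ((dX k t φ / g t φ) ^ 2 * g t φ)) (by fun_prop) (by fun_prop)
    rw [In_cmul, In_cmul] at h2
    rw [← h2]
    have := (abs_le.1 h).2
    calc v t φ ^ 2 = v t φ * v t φ - 0 * 0 := by ring
      _ ≤ _ := this
  · rw [dX_mul F.sv F.sv ht, F.vX ht]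
    have g0 := F.gpos t ht ψ
    have e : dX k t ψ = dX k t ψ / g t ψ * g t ψ := by field_simp
    set z := dX k t ψ / g t ψ
    have hl' : 0 < lam⁻¹ := inv_pos.2 hl
    have hll : lam * lam⁻¹ = 1 := mul_inv_cancel₀ hl.ne'
    have i1 := mul_nonneg (mul_nonneg hl.le (sq_nonneg (v t ψ - lam⁻¹ * z))) g0.le
    have i2 := mul_nonneg (mul_nonneg hl.le (sq_nonneg (v t ψ + lam⁻¹ * z))) g0.le
    have r1 : lam * (v t ψ - lam⁻¹ * z) ^ 2 * g t ψ =
      lam * (v t ψ ^ 2 * g t ψ) + lam⁻¹ * (z ^ 2 * g t ψ) - 2 * (v t ψ * z * g t ψ) := by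
      linear_combination (lam⁻¹ * z ^ 2 * g t ψ - 2 * v t ψ * z * g t ψ) * hll
    have r2 : lam * (v t ψ + lam⁻¹ * z) ^ 2 * g t ψ =
      lam * (v t ψ ^ 2 * g t ψ) + lam⁻¹ * (z ^ 2 * g t ψ) + 2 * (v t ψ * z * g t ψ) := by
      linear_combination (lam⁻¹ * z ^ 2 * g t ψ + 2 * v t ψ * z * g t ψ) * hll
    rw [r1] at i1
    rw [r2] at i2
    rw [e, abs_le]
    constructor <;> nlinarith

lemma E_deriv (F : Fl x y g p q k a v) {K : ℝ} (ht : 0 < t) (hK : 2 * π / In g t ≤ K) :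
    ∃ e', HasDerivAt (In (fun t φ => v t φ ^ 2 * g t φ)) e' t ∧
      e' ≤ (16 + 5 * K ^ 2) * (In (fun t φ => v t φ ^ 2 * g t φ) t *
        (1 + In (fun t φ => v t φ ^ 2 * g t φ) t ^ 2)) -
        In (fun t φ => (dX k t φ / g t φ) ^ 2 * g t φ) t := by
  have hv := F.sv.cont ht
  have hg := F.sg.cont ht
  have hk := F.sk.cont ht
  have hz : Continuous (fun φ => dX k t φ / g t φ) := F.sz.cont ht
  have L0 := F.Lpos ht
  set e := In (fun t φ => v t φ ^ 2 * g t φ) t with he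
  set G := In (fun t φ => (dX k t φ / g t φ) ^ 2 * g t φ) t with hG
  have e0 : 0 ≤ e := F.E_nn ht
  have G0 : 0 ≤ G := F.G_nn ht
  set κ := 2 * π / In g t with hκ
  have κ0 : 0 < κ := by positivity
  have hd : HasDerivAt (fun s => In (fun t φ => k t φ ^ 2 * g t φ) s - 4 * π ^ 2 * (In g s)⁻¹) _ t :=
    (F.Q_deriv ht).sub (((F.L_deriv' ht).inv L0.ne').const_mul (4 * π ^ 2))
  refine ⟨_, hd.congr_of_eventuallyEq ?_, ?_⟩
  · filter_upwards [lt_mem_nhds ht] with s hs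
    rw [F.E_eq hs]; ring
  rw [← he]
  have h4 : 4 * π ^ 2 * (-(-e) / In g t ^ 2) = κ ^ 2 * e := by rw [hκ]; field_simp; ring
  rw [h4, In_sub (by fun_prop) (by fun_prop), In_cmul, ← hG]
  -- bound of the quartic term
  have hs := F.sup_v ht (lam := 4 * (e + 1)) (by positivity)
  rw [← he, ← hG] at hs
  set B := 4 * (e + 1) * e + (4 * (e + 1))⁻¹ * G with hB
  have h5 : In (fun t φ => k t φ ^ 3 * v t φ * g t φ) t ≤
      In (fun s φ => (2 * B + 21 / 4 * κ ^ 2) * (v s φ ^ 2 * g s φ) + κ ^ 3 * (v s φ * g s φ)) t := by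
    refine In_mono (by fun_prop) (by fun_prop) fun φ => ?_
    have g0 := F.gpos t ht φ
    have hk : k t φ = v t φ + κ := by have := F.vk t ht φ; linarith
    have := hs φ
    have i1 : k t φ ^ 3 * v t φ ≤ (2 * B + 21 / 4 * κ ^ 2) * v t φ ^ 2 + κ ^ 3 * v t φ := by
      rw [hk]
      nlinarith [mul_nonneg (sub_nonneg.2 this) (sq_nonneg (v t φ)),
        sq_nonneg (v t φ * (v t φ - 3 / 2 * κ))]
    nlinarith [mul_le_mul_of_nonneg_right i1 g0.le]
  rw [In_add (by fun_prop) (by fun_prop), In_cmul, In_cmul, F.v0 ht, ← he] at h5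
  have h6 : 2 * B * e ≤ 8 * (e + 1) * e ^ 2 + G / 2 := by
    have : e * (4 * (e + 1))⁻¹ ≤ 1 / 4 := by
      rw [mul_inv_le_iff₀ (by positivity)]; linarith
    rw [hB]
    nlinarith [mul_le_mul_of_nonneg_right this G0]
  have h7 : κ ^ 2 * e ≤ K ^ 2 * e := by gcongr
  have h8 : 0 ≤ e ^ 3 := by positivity
  have h9 : 0 ≤ e * (e - 1) ^ 2 := by positivity
  have h10 : 0 ≤ K ^ 2 * e ^ 3 := by positivity
  nlinarith

lemma G_deriv' (F : Fl x y g p q k a v) {K : ℝ} (ht : 0 < t) (hK : 2 * π / In g t ≤ K)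
    (hE : In (fun t φ => v t φ ^ 2 * g t φ) t ≤ 1) :
    ∃ e', HasDerivAt (In (fun t φ => (dX k t φ / g t φ) ^ 2 * g t φ)) e' t ∧
      e' ≤ (2 + K ^ 2 + 2 * (1 + K ^ 2) ^ 2) *
        (1 + In (fun t φ => (dX k t φ / g t φ) ^ 2 * g t φ) t) *
        (In (fun t φ => v t φ ^ 2 * g t φ) t +
        In (fun t φ => (dX k t φ / g t φ) ^ 2 * g t φ) t) := by
  have hv := F.sv.cont ht
  have hg := F.sg.cont ht
  have hk := F.sk.cont ht
  have hz : Continuous (fun φ => dX k t φ / g t φ) := F.sz.cont ht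
  have hw : Continuous (fun φ => dX (fun t φ => dX k t φ / g t φ) t φ / g t φ) := F.sw.cont ht
  have L0 := F.Lpos ht
  refine ⟨_, F.G_deriv ht, ?_⟩
  set e := In (fun t φ => v t φ ^ 2 * g t φ) t with he
  set G := In (fun t φ => (dX k t φ / g t φ) ^ 2 * g t φ) t with hG
  have e0 : 0 ≤ e := F.E_nn ht
  have G0 : 0 ≤ G := F.G_nn ht
  set κ := 2 * π / In g t with hκ
  have κ0 : 0 < κ := by positivity
  have hs := F.sup_v ht (lam := 1) (by positivity)
  rw [← he, ← hG] at hs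
  set S := e + G with hS
  have S0 : 0 ≤ S := by positivity
  have h5 : In (fun t φ => (dX k t φ / g t φ) ^ 2 * k t φ * v t φ * g t φ
      - 2 * ((dX (fun t φ => dX k t φ / g t φ) t φ / g t φ) ^ 2 * g t φ)
      - 2 * ((dX (fun t φ => dX k t φ / g t φ) t φ / g t φ) * (k t φ ^ 2 * v t φ) * g t φ)) t ≤
      In (fun s φ => (2 * S + K ^ 2) * ((dX k s φ / g s φ) ^ 2 * g s φ)
        + (2 * (S + K ^ 2) ^ 2) * (v s φ ^ 2 * g s φ)) t := by
    refine In_mono (by fun_prop) (by fun_prop) fun φ => ?_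
    have g0 := F.gpos t ht φ
    have hk : k t φ = v t φ + κ := by have := F.vk t ht φ; linarith
    have hvS : v t φ ^ 2 ≤ S := by have := hs φ; simp only [one_mul, inv_one] at this; exact this
    have hκK : κ ^ 2 ≤ K ^ 2 := by gcongr
    generalize dX k t φ / g t φ = z at *
    generalize dX (fun t φ => dX k t φ / g t φ) t φ / g t φ = w at *
    have i1 : k t φ * v t φ ≤ 2 * S + K ^ 2 := by
      rw [hk]; nlinarith [sq_nonneg (v t φ - κ)]
    have i2 : k t φ ^ 2 ≤ 2 * (S + K ^ 2) := by
      rw [hk]; nlinarith [sq_nonneg (v t φ - κ)]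
    have i3 : (k t φ ^ 2) ^ 2 ≤ (2 * (S + K ^ 2)) ^ 2 := by gcongr
    have i4 := mul_le_mul_of_nonneg_right i3 (sq_nonneg (v t φ))
    have i5 := mul_le_mul_of_nonneg_right i1 (sq_nonneg z)
    have i6 : z ^ 2 * k t φ * v t φ - 2 * w ^ 2 - 2 * (w * (k t φ ^ 2 * v t φ)) ≤
        (2 * S + K ^ 2) * z ^ 2 + 2 * (S + K ^ 2) ^ 2 * v t φ ^ 2 := by
      nlinarith [sq_nonneg (w + k t φ ^ 2 * v t φ / 2)]
    nlinarith [mul_le_mul_of_nonneg_right i6 g0.le]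
  rw [In_add (by fun_prop) (by fun_prop), In_cmul, In_cmul, ← he, ← hG] at h5
  refine h5.trans ?_
  have K0 : 0 ≤ K ^ 2 := sq_nonneg _
  have hS1 : S ≤ 1 + G := by linarith
  have j1 : (2 * S + K ^ 2) * G ≤ (2 + K ^ 2) * (1 + G) * (e + G) := by
    have a1 : 2 * S + K ^ 2 ≤ (2 + K ^ 2) * (1 + G) := by nlinarith [mul_nonneg K0 G0]
    have a2 : G ≤ e + G := by linarith
    exact mul_le_mul a1 a2 G0 (by positivity)
  have j2 : 2 * (S + K ^ 2) ^ 2 * e ≤ 2 * (1 + K ^ 2) ^ 2 * (1 + G) * (e + G) := by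
    have a1 : S + K ^ 2 ≤ (1 + K ^ 2) * (1 + G) := by nlinarith [mul_nonneg K0 G0]
    have a2 : (S + K ^ 2) ^ 2 ≤ ((1 + K ^ 2) * (1 + G)) ^ 2 := by gcongr
    have a3 : (1 + G) * e ≤ e + G := by nlinarith
    calc 2 * (S + K ^ 2) ^ 2 * e ≤ 2 * ((1 + K ^ 2) * (1 + G)) ^ 2 * e := by gcongr
      _ = 2 * (1 + K ^ 2) ^ 2 * (1 + G) * ((1 + G) * e) := by ring
      _ ≤ _ := by gcongr
  linarith

/-- closeness of the centres of curvature to a point -/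
lemma b1_osc (F : Fl x y g p q k a v) (ht : 0 < t) (u w : ℝ) :
    |(x t u - In g t / (2 * π) * q t u) - (x t w - In g t / (2 * π) * q t w)| ≤
      In g t / (2 * π) * In (fun t φ => |v t φ| * g t φ) t := by
  have hv := F.sv.cont ht
  have hg := F.sg.cont ht
  have L0 := F.Lpos ht
  have sb : Sm (fun s φ => x s φ - In g t / (2 * π) * q s φ) :=
    F.sx.sub ((Sm.const _).mul F.sq)
  rw [← In_cmul]
  refine osc sb ht (h := fun φ => In g t / (2 * π) * (|v t φ| * g t φ)) (by fun_prop)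
    (fun ψ => ?_) w u
  rw [dX_sub F.sx ((Sm.const _).mul F.sq) ht, dX_mul (Sm.const _) F.sq ht, dX_const,
    F.xX t ht, F.qX t ht]
  have e : 0 * q t ψ + In g t / (2 * π) * (k t ψ * g t ψ * p t ψ) = 
      g t ψ * p t ψ + In g t / (2 * π) * (v t ψ * (g t ψ * p t ψ)) := by
    rw [F.vk t ht]; field_simp; ring
  have e' : g t ψ * p t ψ - (0 * q t ψ + In g t / (2 * π) * (k t ψ * g t ψ * p t ψ)) =
      - (In g t / (2 * π) * (v t ψ * (g t ψ * p t ψ))) := by rw [e]; ring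
  have g0 := F.gpos t ht ψ
  rw [e', abs_neg, abs_mul, abs_mul, abs_mul, abs_of_pos g0, abs_of_pos (by positivity)]
  gcongr
  nlinarith [F.p1 ht ψ]

lemma b2_osc (F : Fl x y g p q k a v) (ht : 0 < t) (u w : ℝ) :
    |(y t u + In g t / (2 * π) * p t u) - (y t w + In g t / (2 * π) * p t w)| ≤
      In g t / (2 * π) * In (fun t φ => |v t φ| * g t φ) t := by
  have hv := F.sv.cont ht
  have hg := F.sg.cont ht
  have L0 := F.Lpos ht
  have sb : Sm (fun s φ => y s φ + In g t / (2 * π) * p s φ) :=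
    F.sy.add ((Sm.const _).mul F.sp)
  rw [← In_cmul]
  refine osc sb ht (h := fun φ => In g t / (2 * π) * (|v t φ| * g t φ)) (by fun_prop)
    (fun ψ => ?_) w u
  rw [dX_add F.sy ((Sm.const _).mul F.sp) ht, dX_mul (Sm.const _) F.sp ht, dX_const,
    F.yX t ht, F.pX t ht]
  have e' : g t ψ * q t ψ + (0 * p t ψ + In g t / (2 * π) * (-(k t ψ * g t ψ) * q t ψ)) =
      - (In g t / (2 * π) * (v t ψ * (g t ψ * q t ψ))) := by
    rw [F.vk t ht]; field_simp; ring
  have g0 := F.gpos t ht ψ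
  rw [e', abs_neg, abs_mul, abs_mul, abs_mul, abs_of_pos g0, abs_of_pos (by positivity)]
  gcongr
  nlinarith [F.q1 ht ψ]

lemma area_close (F : Fl x y g p q k a v) (ht : 0 < t) :
    |In (fun t φ => x t φ * dX y t φ - y t φ * dX x t φ) t - In g t ^ 2 / (2 * π)| ≤
      In g t ^ 2 / π * In (fun t φ => |v t φ| * g t φ) t := by
  have hg := F.sg.cont ht
  have L0 := F.Lpos ht
  set r := In g t / (2 * π) with hr
  set D := In (fun t φ => |v t φ| * g t φ) t with hD
  have hb1 := fun u => F.b1_osc ht u 0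
  have hb2 := fun u => F.b2_osc ht u 0
  rw [← hr, ← hD] at hb1 hb2
  set c1 := x t 0 - r * q t 0
  set c2 := y t 0 + r * p t 0
  have s1 : Sm (fun s φ => (x s φ - r * q s φ - c1) * (g s φ * q s φ)
      - (y s φ + r * p s φ - c2) * (g s φ * p s φ)) :=
    (((F.sx.sub ((Sm.const _).mul F.sq)).sub (Sm.const _)).mul (F.sg.mul F.sq)).sub
      (((F.sy.add ((Sm.const _).mul F.sp)).sub (Sm.const _)).mul (F.sg.mul F.sp))
  have e : In (fun t φ => x t φ * dX y t φ - y t φ * dX x t φ) t = 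
      In (fun s φ => ((x s φ - r * q s φ - c1) * (g s φ * q s φ)
      - (y s φ + r * p s φ - c2) * (g s φ * p s φ)) + r * g s φ) t := by
    refine In_total ht (s1.add ((Sm.const r).mul F.sg))
      (((Sm.const c1).mul F.sy).sub ((Sm.const c2).mul F.sx)) fun φ => ?_
    rw [dX_sub ((Sm.const c1).mul F.sy) ((Sm.const c2).mul F.sx) ht,
      dX_mul (Sm.const _) F.sy ht, dX_mul (Sm.const _) F.sx ht, dX_const, dX_const,
      F.xX t ht, F.yX t ht]
    linear_combination (r * g t φ) * F.pq t ht φ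
  rw [e, In_add (s1.cont ht) (by fun_prop), In_cmul]
  have e2 : r * In g t = In g t ^ 2 / (2 * π) := by rw [hr]; ring
  rw [e2, add_sub_cancel_right]
  have e3 : In g t ^ 2 / π * D = In (fun s φ => (2 * (r * D)) * g s φ) t := by
    rw [In_cmul, hr]; field_simp
  rw [e3]
  refine In_abs_le (s1.cont ht) (by fun_prop) fun φ => ?_
  have g0 := F.gpos t ht φ
  have D0 : 0 ≤ D := F.D_nn ht
  have r0 : 0 ≤ r := by positivity
  have b1 : |(x t φ - r * q t φ - c1) * (g t φ * q t φ)| ≤ (r * D) * (g t φ * 1) := by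
    rw [abs_mul, abs_mul, abs_of_pos g0]
    gcongr
    · exact hb1 φ
    · exact F.q1 ht φ
  have b2 : |(y t φ + r * p t φ - c2) * (g t φ * p t φ)| ≤ (r * D) * (g t φ * 1) := by
    rw [abs_mul, abs_mul, abs_of_pos g0]
    gcongr
    · exact hb2 φ
    · exact F.p1 ht φ
  refine (abs_sub _ _).trans ?_
  linarith

lemma abs_k (F : Fl x y g p q k a v) (ht : 0 < t) : In (fun t φ => |k t φ| * g t φ) t ≤
    In (fun t φ => |v t φ| * g t φ) t + 2 * π := by
  have hv := F.sv.cont ht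
  have hg := F.sg.cont ht
  have hk := F.sk.cont ht
  have L0 := F.Lpos ht
  have : 2 * π = 2 * π / In g t * In g t := by field_simp
  rw [this, ← In_cmul, ← In_add (by fun_prop) (by fun_prop)]
  refine In_mono (by fun_prop) (by fun_prop) fun φ => ?_
  have g0 := F.gpos t ht φ
  have e : k t φ = v t φ + 2 * π / In g t := by rw [F.vk t ht]; ring
  have : |k t φ| ≤ |v t φ| + 2 * π / In g t := by
    rw [e]
    refine (abs_add_le _ _).trans ?_
    rw [abs_of_pos (show 0 < 2 * π / In g t by positivity)]
  nlinarith

lemma center1 (F : Fl x y g p q k a v) (ht : 0 < t) (φ : ℝ) :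
    |2 * π * (x t φ - In g t / (2 * π) * q t φ) - In (fun t φ => x t φ * (k t φ * g t φ)) t| ≤
      In g t / (2 * π) * In (fun t φ => |v t φ| * g t φ) t *
        (In (fun t φ => |v t φ| * g t φ) t + 2 * π) := by
  have hg := F.sg.cont ht
  have hk := F.sk.cont ht
  have L0 := F.Lpos ht
  have hb1 := F.b1_osc ht φ
  have D0 := F.D_nn ht
  have hak := F.abs_k ht
  set r := In g t / (2 * π) with hr
  set D := In (fun t φ => |v t φ| * g t φ) t with hD
  have r0 : 0 ≤ r := by positivity
  set c := x t φ - r * q t φ with hc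
  have s1 : Sm (fun s ψ => (c - (x s ψ - r * q s ψ)) * (k s ψ * g s ψ)) :=
    ((Sm.const c).sub (F.sx.sub ((Sm.const r).mul F.sq))).mul (F.sk.mul F.sg)
  have e : 2 * π * c - In (fun t φ => x t φ * (k t φ * g t φ)) t =
      In (fun s ψ => (c - (x s ψ - r * q s ψ)) * (k s ψ * g s ψ)) t := by
    rw [← F.rot_one t ht, mul_comm, ← In_cmul,
      ← In_sub (((Sm.const c).mul (F.sk.mul F.sg)).cont ht) ((F.sx.mul (F.sk.mul F.sg)).cont ht)]
    refine In_total ht s1 ((Sm.const r).mul F.sp) fun ψ => ?_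
    rw [dX_mul (Sm.const _) F.sp ht, dX_const, F.pX t ht]
    ring
  rw [e]
  have : In (fun s ψ => (r * D) * (|k s ψ| * g s ψ)) t ≤ r * D * (D + 2 * π) := by
    rw [In_cmul]; gcongr
  refine (In_abs_le (s1.cont ht) (by fun_prop) fun ψ => ?_).trans this
  rw [abs_mul, abs_mul, abs_of_pos (F.gpos t ht ψ)]
  have := F.gpos t ht ψ
  gcongr
  exact hb1 ψ

lemma center2 (F : Fl x y g p q k a v) (ht : 0 < t) (φ : ℝ) :
    |2 * π * (y t φ + In g t / (2 * π) * p t φ) - In (fun t φ => y t φ * (k t φ * g t φ)) t| ≤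
      In g t / (2 * π) * In (fun t φ => |v t φ| * g t φ) t *
        (In (fun t φ => |v t φ| * g t φ) t + 2 * π) := by
  have hg := F.sg.cont ht
  have hk := F.sk.cont ht
  have L0 := F.Lpos ht
  have hb1 := F.b2_osc ht φ
  have D0 := F.D_nn ht
  have hak := F.abs_k ht
  set r := In g t / (2 * π) with hr
  set D := In (fun t φ => |v t φ| * g t φ) t with hD
  have r0 : 0 ≤ r := by positivity
  set c := y t φ + r * p t φ with hc
  have s1 : Sm (fun s ψ => (c - (y s ψ + r * p s ψ)) * (k s ψ * g s ψ)) :=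
    ((Sm.const c).sub (F.sy.add ((Sm.const r).mul F.sp))).mul (F.sk.mul F.sg)
  have e : 2 * π * c - In (fun t φ => y t φ * (k t φ * g t φ)) t =
      In (fun s ψ => (c - (y s ψ + r * p s ψ)) * (k s ψ * g s ψ)) t := by
    rw [← F.rot_one t ht, mul_comm, ← In_cmul,
      ← In_sub (((Sm.const c).mul (F.sk.mul F.sg)).cont ht) ((F.sy.mul (F.sk.mul F.sg)).cont ht)]
    refine In_total ht s1 ((Sm.const r).mul F.sq) fun ψ => ?_
    rw [dX_mul (Sm.const _) F.sq ht, dX_const, F.qX t ht]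
    ring
  rw [e]
  have : In (fun s ψ => (r * D) * (|k s ψ| * g s ψ)) t ≤ r * D * (D + 2 * π) := by
    rw [In_cmul]; gcongr
  refine (In_abs_le (s1.cont ht) (by fun_prop) fun ψ => ?_).trans this
  rw [abs_mul, abs_mul, abs_of_pos (F.gpos t ht ψ)]
  have := F.gpos t ht ψ
  gcongr
  exact hb1 ψ

lemma C1_bound (F : Fl x y g p q k a v) (ht : 0 < t) : |In (fun t φ => (-2) * (k t φ * v t φ * q t φ * g t φ)) t| ≤
    2 * In (fun t φ => v t φ ^ 2 * g t φ) t := by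
  have hv := F.sv.cont ht
  have hg := F.sg.cont ht
  have s1 : Sm (fun t φ => (-2) * (v t φ ^ 2 * q t φ * g t φ)) :=
    (Sm.const (-2)).mul (((F.sv.pow 2).mul F.sq).mul F.sg)
  set κ := 2 * π / In g t with hκ
  have e : In (fun t φ => (-2) * (k t φ * v t φ * q t φ * g t φ)) t =
      In (fun t φ => (-2) * (v t φ ^ 2 * q t φ * g t φ)) t := by
    refine In_total ht s1 (((Sm.const (2 * κ)).mul F.sp).add
      ((Sm.const (2 * κ ^ 2)).mul F.sy)) fun φ => ?_
    rw [dX_add ((Sm.const (2 * κ)).mul F.sp) ((Sm.const (2 * κ ^ 2)).mul F.sy) ht,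
      dX_mul (Sm.const _) F.sp ht, dX_mul (Sm.const _) F.sy ht, dX_const, dX_const,
      F.pX t ht, F.yX t ht, F.vk t ht, ← hκ]
    ring
  rw [e, ← In_cmul]
  refine In_abs_le (s1.cont ht) (by fun_prop) fun φ => ?_
  have g0 := F.gpos t ht φ
  rw [abs_mul, abs_mul, abs_mul, abs_of_pos g0, abs_of_nonneg (sq_nonneg (v t φ))]
  have : v t φ ^ 2 * |q t φ| * g t φ ≤ v t φ ^ 2 * 1 * g t φ := by
    gcongr; exact F.q1 ht φ
  norm_num
  linarith

lemma C2_bound (F : Fl x y g p q k a v) (ht : 0 < t) : |In (fun t φ => 2 * (k t φ * v t φ * p t φ * g t φ)) t| ≤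
    2 * In (fun t φ => v t φ ^ 2 * g t φ) t := by
  have hv := F.sv.cont ht
  have hg := F.sg.cont ht
  have s1 : Sm (fun t φ => 2 * (v t φ ^ 2 * p t φ * g t φ)) :=
    (Sm.const 2).mul (((F.sv.pow 2).mul F.sp).mul F.sg)
  set κ := 2 * π / In g t with hκ
  have e : In (fun t φ => 2 * (k t φ * v t φ * p t φ * g t φ)) t =
      In (fun t φ => 2 * (v t φ ^ 2 * p t φ * g t φ)) t := by
    refine In_total ht s1 (((Sm.const (2 * κ)).mul F.sq).sub
      ((Sm.const (2 * κ ^ 2)).mul F.sx)) fun φ => ?_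
    rw [dX_sub ((Sm.const (2 * κ)).mul F.sq) ((Sm.const (2 * κ ^ 2)).mul F.sx) ht,
      dX_mul (Sm.const _) F.sq ht, dX_mul (Sm.const _) F.sx ht, dX_const, dX_const,
      F.qX t ht, F.xX t ht, F.vk t ht, ← hκ]
    ring
  rw [e, ← In_cmul]
  refine In_abs_le (s1.cont ht) (by fun_prop) fun φ => ?_
  have g0 := F.gpos t ht φ
  rw [abs_mul, abs_mul, abs_mul, abs_of_pos g0, abs_of_nonneg (sq_nonneg (v t φ))]
  have : v t φ ^ 2 * |p t φ| * g t φ ≤ v t φ ^ 2 * 1 * g t φ := by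
    gcongr; exact F.p1 ht φ
  norm_num
  linarith

end Fl

lemma arctan_le_self' {u : ℝ} (hu : 0 ≤ u) : Real.arctan u ≤ u := by
  have h := Real.le_tan (Real.arctan_nonneg.2 hu) (Real.arctan_lt_pi_div_two u)
  rwa [Real.tan_arctan] at h

lemma tri_aux {X1 X2 p q r : ℝ} (hpq : p * p + q * q = 1) (hp : |p| ≤ 1) (hq : |q| ≤ 1)
    (r0 : 0 < r) :
    |Real.sqrt ((X1 + r * q) ^ 2 + (X2 - r * p) ^ 2) - r| ≤ |X1| + |X2| := by
  have b1 : |X1 * q| ≤ |X1| := by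
    rw [abs_mul]; exact mul_le_of_le_one_right (abs_nonneg _) hq
  have b2 : |X2 * p| ≤ |X2| := by
    rw [abs_mul]; exact mul_le_of_le_one_right (abs_nonneg _) hp
  have b3 := abs_le.1 b1
  have b4 := abs_le.1 b2
  have hexp : (X1 + r * q) ^ 2 + (X2 - r * p) ^ 2 =
      X1 ^ 2 + X2 ^ 2 + 2 * r * (X1 * q - X2 * p) + r ^ 2 := by
    linear_combination r ^ 2 * hpq
  have hSq : X1 ^ 2 + X2 ^ 2 ≤ (|X1| + |X2|) ^ 2 := by
    rw [add_sq, sq_abs, sq_abs]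
    have : 0 ≤ 2 * |X1| * |X2| := by positivity
    linarith
  have S0 : 0 ≤ |X1| + |X2| := by positivity
  generalize |X1| = Y1 at *
  generalize |X2| = Y2 at *
  rw [abs_le]
  constructor
  · have hN0 := Real.sqrt_nonneg ((X1 + r * q) ^ 2 + (X2 - r * p) ^ 2)
    have h : (r + (X1 * q - X2 * p)) ^ 2 ≤ (X1 + r * q) ^ 2 + (X2 - r * p) ^ 2 := by
      rw [hexp]
      have e : X1 ^ 2 + X2 ^ 2 - (X1 * q - X2 * p) ^ 2 = (X1 * p + X2 * q) ^ 2 := by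
        linear_combination (-(X1 ^ 2 + X2 ^ 2)) * hpq
      have := sq_nonneg (X1 * p + X2 * q)
      linarith [add_sq r (X1 * q - X2 * p)]
    have := Real.le_sqrt_of_sq_le h
    linarith [b3.1, b4.2]
  · have : Real.sqrt ((X1 + r * q) ^ 2 + (X2 - r * p) ^ 2) ≤ r + (Y1 + Y2) := by
      refine Real.sqrt_le_iff.2 ⟨by linarith, ?_⟩
      rw [hexp]
      have h1 : X1 * q - X2 * p ≤ Y1 + Y2 := by linarith [b3.2, b4.1]
      have := mul_le_mul_of_nonneg_left h1 (by linarith : 0 ≤ 2 * r)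
      linarith [add_sq r (Y1 + Y2)]
    linarith

namespace Fl

variable {x y g p q k a v : ℝ → ℝ → ℝ} {t : ℝ}

lemma A_const (F : Fl x y g p q k a v) : ∀ t, 0 < t → In (fun t φ => x t φ * dX y t φ - y t φ * dX x t φ) t =
    In (fun t φ => x t φ * dX y t φ - y t φ * dX x t φ) 1 := by
  intro t ht
  have hd : ∀ s, 0 < s → HasDerivAt (In (fun t φ => x t φ * dX y t φ - y t φ * dX x t φ)) 0 s := by
    intro s hs
    have := F.A_deriv hs
    rwa [F.v0 hs, mul_zero, neg_zero] at this
  exact isOpen_Ioi.is_const_of_deriv_eq_zero (s := Ioi (0:ℝ)) isPreconnected_Ioi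
    (fun s hs => (hd s hs).differentiableAt.differentiableWithinAt)
    (fun s hs => (hd s hs).deriv) ht (mem_Ioi.2 one_pos)

lemma L2_deriv' (F : Fl x y g p q k a v) (ht : 0 < t) : HasDerivAt (fun t => In g t ^ 2)
    (- (2 * (In g t * In (fun t φ => v t φ ^ 2 * g t φ) t))) t := by
  refine ((F.L_deriv' ht).pow 2).congr_deriv ?_
  simp; ring

lemma A_pos (F : Fl x y g p q k a v) {A : ℝ}
    (hA : ∀ t, 0 < t → In (fun t φ => x t φ * dX y t φ - y t φ * dX x t φ) t = A) : 0 < A := by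
  by_contra! hneg
  have hdec := fun t ht => deriv_le_bound (s := 1) (t := t) (T := 0) (C := -1/2)
      (fun t ht => F.L2_deriv' ht) (fun t ht => by
        have h1 := F.area_close ht
        have h2 := F.D_sq ht
        have h3 := F.D_nn ht
        have L0 := F.Lpos ht
        rw [hA t ht] at h1
        have h4 := (abs_le.1 h1).1
        set D := In (fun t φ => |v t φ| * g t φ) t
        have h5 : In g t ^ 2 / (2 * π) ≤ In g t ^ 2 / π * D := by linarith
        have h6 : In g t ^ 2 / (2 * π) = In g t ^ 2 / π * (1 / 2) := by field_simp
        rw [h6] at h5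
        have h7 : 1 / 2 ≤ D := le_of_mul_le_mul_left h5 (by positivity)
        nlinarith) one_pos ht
  have := hdec (1 + 2 * (In g 1 ^ 2 + 1)) (by nlinarith [sq_nonneg (In g 1)])
  nlinarith [sq_nonneg (In g (1 + 2 * (In g 1 ^ 2 + 1)))]

lemma L_le (F : Fl x y g p q k a v) {t : ℝ} (ht : 1 ≤ t) : In g t ≤ In g 1 := by
  have := deriv_le_bound (T := 0) (C := 0) (fun t ht => F.L_deriv' ht)
    (fun t ht => by have := F.E_nn ht; linarith) one_pos ht
  linarith

lemma exK (F : Fl x y g p q k a v) {A : ℝ}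
    (hA : ∀ t, 0 < t → In (fun t φ => x t φ * dX y t φ - y t φ * dX x t φ) t = A) :
    ∃ K, ∀ t, 0 < t → 2 * π / In g t ≤ K := by
  have A0 := F.A_pos hA
  refine ⟨2 * π / Real.sqrt (A / 2), fun t ht => ?_⟩
  have L0 := F.Lpos ht
  have h := F.area_le ht
  rw [hA t ht, abs_of_pos A0] at h
  have : Real.sqrt (A / 2) ≤ In g t := Real.sqrt_le_iff.2 ⟨L0.le, by linarith⟩
  have : 0 < Real.sqrt (A / 2) := Real.sqrt_pos.2 (by linarith)
  gcongr

lemma E_lim (F : Fl x y g p q k a v) {K : ℝ} (hK : ∀ t, 0 < t → 2 * π / In g t ≤ K) :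
    Tendsto (In (fun t φ => v t φ ^ 2 * g t φ)) atTop (𝓝 0) := by
  have hd := fun t ht => F.E_deriv (t := t) (K := K) ht (hK t ht)
  choose! e' he' hle using hd
  have E0 := fun t (ht : 0 < t) => F.E_nn ht
  have G0 := fun t (ht : 0 < t) => F.G_nn ht
  set E := In (fun t φ => v t φ ^ 2 * g t φ) with hE
  have hlim : Tendsto (fun t => Real.arctan (E t)) atTop (𝓝 0) := by
    refine barb (T := 0) (B := 0) (P := fun t => - (16 + 5 * K ^ 2 + 1) * In g t)
      (P' := fun t => - (16 + 5 * K ^ 2 + 1) * - E t)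
      (u' := fun t => 1 / (1 + E t ^ 2) * e' t)
      (fun t ht => (he' t ht).arctan) (fun t ht => (F.L_deriv' ht).const_mul _) ?_ ?_ ?_ ?_
    · intro t ht
      have h1 := hle t ht
      have h2 := G0 t ht
      have h3 := E0 t ht
      rw [one_div, inv_mul_le_iff₀ (by positivity)]
      have : 0 ≤ E t * (1 + E t ^ 2) := by positivity
      nlinarith
    · intro t ht
      exact Real.arctan_nonneg.2 (E0 t ht)
    · intro t ht
      have h3 := E0 t ht
      have := arctan_le_self' h3
      nlinarith [mul_nonneg (sq_nonneg K) h3]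
    · intro t ht
      have := F.Lpos ht
      have : 0 ≤ (16 + 5 * K ^ 2 + 1) * In g t := by positivity
      linarith
  have ht : Tendsto Real.tan (𝓝 0) (𝓝 0) := by
    have : ContinuousAt Real.tan 0 := Real.continuousAt_tan.2 (by simp)
    simpa [ContinuousAt] using this
  refine (ht.comp hlim).congr fun t => ?_
  simp [Real.tan_arctan]

lemma G_lim (F : Fl x y g p q k a v) {K : ℝ} (hK : ∀ t, 0 < t → 2 * π / In g t ≤ K) :
    Tendsto (In (fun t φ => (dX k t φ / g t φ) ^ 2 * g t φ)) atTop (𝓝 0) := by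
  obtain ⟨T, hT⟩ := eventually_atTop.1 ((F.E_lim hK).eventually (gt_mem_nhds one_pos))
  have hT' : ∀ t, max T 0 < t → 0 < t ∧ In (fun t φ => v t φ ^ 2 * g t φ) t ≤ 1 := fun t ht =>
    ⟨(le_max_right _ _).trans_lt ht, (hT t ((le_max_left _ _).trans ht.le)).le⟩
  have hd := fun t ht => F.E_deriv (t := t) (K := K) ht (hK t ht)
  choose! e' he' hle using hd
  have hd2 := fun t (ht : max T 0 < t) => F.G_deriv' (t := t) (K := K) (hT' t ht).1
    (hK t (hT' t ht).1) (hT' t ht).2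
  choose! G' hG' hGle using hd2
  have E0 := fun t (ht : 0 < t) => F.E_nn ht
  have G0 := fun t (ht : 0 < t) => F.G_nn ht
  set E := In (fun t φ => v t φ ^ 2 * g t φ) with hE
  set G := In (fun t φ => (dX k t φ / g t φ) ^ 2 * g t φ) with hG
  set c := 2 + K ^ 2 + 2 * (1 + K ^ 2) ^ 2 with hc
  set d := 16 + 5 * K ^ 2 with hd
  have c1 : 1 ≤ c := by rw [hc]; nlinarith [sq_nonneg K, sq_nonneg (1 + K ^ 2)]
  have d0 : 0 ≤ d := by rw [hd]; positivity
  have key : ∀ t, max T 0 < t → c * (E t + G t) ≤ (-c) * e' t + (-(c * (1 + 2 * d))) * (- E t) := by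
    intro t ht
    obtain ⟨t0, hE1⟩ := hT' t ht
    have h1 := hle t t0
    have h3 := E0 t t0
    have h4 : E t * (1 + E t ^ 2) ≤ E t * 2 := by
      gcongr; nlinarith
    have h5 : e' t ≤ d * (E t * 2) - G t := by
      have := mul_le_mul_of_nonneg_left h4 d0
      linarith
    nlinarith [mul_le_mul_of_nonneg_left h5 (show 0 ≤ c by linarith)]
  have hlim : Tendsto (fun t => Real.log (1 + G t)) atTop (𝓝 0) := by
    refine barb (T := max T 0) (B := 0)
      (P := fun t => (-c) * E t + (-(c * (1 + 2 * d))) * In g t)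
      (P' := fun t => (-c) * e' t + (-(c * (1 + 2 * d))) * (- E t))
      (u' := fun t => G' t / (1 + G t))
      (fun t ht => ?_) (fun t ht => ((he' t (hT' t ht).1).const_mul _).add
        ((F.L_deriv' (hT' t ht).1).const_mul _)) ?_ ?_ ?_ ?_
    · have h0 := G0 t (hT' t ht).1
      exact ((hG' t ht).const_add 1).log (by positivity)
    · intro t ht
      have h0 := G0 t (hT' t ht).1
      refine le_trans ?_ (key t ht)
      rw [div_le_iff₀ (by positivity)]
      linarith [hGle t ht]
    · intro t ht
      have h0 := G0 t (hT' t ht).1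
      exact Real.log_nonneg (by linarith)
    · intro t ht
      have h0 := G0 t (hT' t ht).1
      have h1 := E0 t (hT' t ht).1
      have := Real.log_le_sub_one_of_pos (show 0 < 1 + G t by positivity)
      have := key t ht
      nlinarith
    · intro t ht
      have h1 := E0 t (hT' t ht).1
      have h2 := (F.Lpos (hT' t ht).1).le
      have : 0 ≤ c * E t := by positivity
      have : 0 ≤ c * (1 + 2 * d) * In g t := by positivity
      linarith
  have ht : Tendsto (fun u => Real.exp u - 1) (𝓝 0) (𝓝 0) := by
    have : ContinuousAt (fun u => Real.exp u - 1) 0 := by fun_prop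
    simpa [ContinuousAt] using this
  refine (ht.comp hlim).congr' ?_
  filter_upwards [eventually_gt_atTop 0] with t t0
  have h0 := G0 t t0
  simp only [Function.comp]
  rw [Real.exp_log (by positivity)]; ring

lemma D_lim (F : Fl x y g p q k a v) {K : ℝ} (hK : ∀ t, 0 < t → 2 * π / In g t ≤ K) :
    Tendsto (In (fun t φ => |v t φ| * g t φ)) atTop (𝓝 0) := by
  have h1 : Tendsto (fun t => Real.sqrt (In g 1 * In (fun t φ => v t φ ^ 2 * g t φ) t))
      atTop (𝓝 0) := by
    have := ((F.E_lim hK).const_mul (In g 1)).sqrt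
    simpa using this
  refine squeeze_zero' ?_ ?_ h1
  · filter_upwards [eventually_gt_atTop 0] with t t0
    exact F.D_nn t0
  · filter_upwards [eventually_ge_atTop 1] with t t1
    have t0 : 0 < t := by linarith
    refine Real.le_sqrt_of_sq_le ((F.D_sq t0).trans ?_)
    have := F.E_nn t0
    gcongr
    exact F.L_le t1

lemma L_lim (F : Fl x y g p q k a v) {A : ℝ}
    (hA : ∀ t, 0 < t → In (fun t φ => x t φ * dX y t φ - y t φ * dX x t φ) t = A) :
    Tendsto (In g) atTop (𝓝 (Real.sqrt (2 * π * A))) := by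
  obtain ⟨K, hK⟩ := F.exK hA
  have h1 : Tendsto (fun t => A - In g t ^ 2 / (2 * π)) atTop (𝓝 0) := by
    have h2 := (F.D_lim hK).const_mul (In g 1 ^ 2 / π)
    rw [mul_zero] at h2
    refine squeeze_zero_norm' ?_ h2
    filter_upwards [eventually_ge_atTop 1] with t t1
    have t0 : 0 < t := by linarith
    have h := F.area_close t0
    rw [hA t t0] at h
    refine h.trans ?_
    have := F.D_nn t0
    have := (F.Lpos t0).le
    gcongr
    exact F.L_le t1
  have h3 : Tendsto (fun t => Real.sqrt (2 * π * (A - (A - In g t ^ 2 / (2 * π))))) atTop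
      (𝓝 (Real.sqrt (2 * π * (A - 0)))) :=
    ((tendsto_const_nhds.sub h1).const_mul _).sqrt
  rw [sub_zero] at h3
  refine h3.congr' ?_
  filter_upwards [eventually_gt_atTop 0] with t t0
  have : 2 * π * (A - (A - In g t ^ 2 / (2 * π))) = In g t ^ 2 := by field_simp; ring
  rw [this, Real.sqrt_sq (F.Lpos t0).le]

lemma C_lim (F : Fl x y g p q k a v) {l : ℝ} (hl : Tendsto (In g) atTop (𝓝 l)) {f f' : ℝ → ℝ}
    (hf : ∀ t, 0 < t → HasDerivAt f (f' t) t)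
    (hb : ∀ t, 0 < t → |f' t| ≤ 2 * In (fun t φ => v t φ ^ 2 * g t φ) t) :
    ∃ c, Tendsto f atTop (𝓝 c) := by
  obtain ⟨c, hc⟩ := mono_lim (T := 1) (B := f 1 + 2 * In g 1) (P := fun t => f t - 2 * In g t)
    (fun t ht => (hf t (by linarith)).sub ((F.L_deriv' (t := t) (by linarith)).const_mul 2))
    (fun t ht => by
      have := abs_le.1 (hb t (by linarith))
      linarith [this.1])
    (fun t ht => by
      have := deriv_le_bound (T := 0) (C := 0) (f := fun t => f t + 2 * In g t)
        (fun t ht => (hf t ht).add ((F.L_deriv' (t := t) ht).const_mul 2))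
        (fun t ht => by
          have := abs_le.1 (hb t ht)
          linarith [this.2]) one_pos ht.le
      have h2 := F.Lpos (t := t) (by linarith)
      linarith)
  refine ⟨c + 2 * l, (hc.add (hl.const_mul 2)).congr fun t => ?_⟩
  ring

/-- curvature deviation tends to zero uniformly -/
lemma v_unif (F : Fl x y g p q k a v) {K : ℝ} (hK : ∀ t, 0 < t → 2 * π / In g t ≤ K) {ε : ℝ} (hε : 0 < ε) :
    ∀ᶠ t in atTop, ∀ φ, |v t φ| < ε := by
  have h := (F.E_lim hK).add (F.G_lim hK)
  rw [add_zero] at h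
  filter_upwards [h.eventually (gt_mem_nhds (show 0 < ε ^ 2 by positivity)),
    eventually_gt_atTop 0] with t h1 t0 φ
  have h2 := F.sup_v t0 one_pos φ
  simp only [one_mul, inv_one] at h2
  exact abs_lt_of_sq_lt_sq (h2.trans_lt h1) hε.le

set_option maxHeartbeats 1000000 in
/-- main conclusion in coordinates -/
lemma concl (F : Fl x y g p q k a v) {A : ℝ}
    (hA : ∀ t, 0 < t → In (fun t φ => x t φ * dX y t φ - y t φ * dX x t φ) t = A) :
    0 < A ∧ (∀ ε > 0, ∀ᶠ t in atTop, ∀ φ, |k t φ - 2 * π / Real.sqrt (2 * π * A)| < ε) ∧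
    ∃ c₁ c₂ : ℝ, ∀ ε > 0, ∀ᶠ t in atTop, ∀ φ,
      |Real.sqrt ((x t φ - c₁) ^ 2 + (y t φ - c₂) ^ 2) - Real.sqrt (2 * π * A) / (2 * π)| < ε := by
  have A0 := F.A_pos hA
  have hL := F.L_lim hA
  obtain ⟨K, hK⟩ := F.exK hA
  have hl0 : 0 < Real.sqrt (2 * π * A) := Real.sqrt_pos.2 (by positivity)
  have hD := F.D_lim hK
  refine ⟨A0, ?_, ?_⟩
  · intro ε hε
    have h1 : Tendsto (fun t => 2 * π / In g t) atTop (𝓝 (2 * π / Real.sqrt (2 * π * A))) :=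
      tendsto_const_nhds.div hL hl0.ne'
    have h2 := (Metric.tendsto_nhds.1 h1) (ε / 2) (by positivity)
    filter_upwards [h2, F.v_unif hK (half_pos hε), eventually_gt_atTop 0] with t h3 h4 t0 φ
    have h5 := h4 φ
    rw [F.vk t t0] at h5
    rw [Real.dist_eq] at h3
    have := abs_sub_le (k t φ) (2 * π / In g t) (2 * π / Real.sqrt (2 * π * A))
    linarith
  · obtain ⟨c₁, hc₁⟩ := F.C_lim hL (fun t ht => F.C1_deriv ht) (fun t ht => F.C1_bound ht)
    obtain ⟨c₂, hc₂⟩ := F.C_lim hL (fun t ht => F.C2_deriv ht) (fun t ht => F.C2_bound ht)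
    refine ⟨c₁ / (2 * π), c₂ / (2 * π), fun ε hε => ?_⟩
    have hr := hL.div_const (2 * π)
    have hR : Tendsto (fun t => In g t / (2 * π) * In (fun t φ => |v t φ| * g t φ) t *
        (In (fun t φ => |v t φ| * g t φ) t + 2 * π)) atTop (𝓝 0) := by
      have := (hr.mul hD).mul (hD.add_const (2 * π))
      simpa using this
    have k1 := Metric.tendsto_nhds.1 hc₁ (ε / 8) (by positivity)
    have k2 := Metric.tendsto_nhds.1 hc₂ (ε / 8) (by positivity)
    have k3 := Metric.tendsto_nhds.1 hr (ε / 4) (by positivity)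
    have k4 := hR.eventually (gt_mem_nhds (show 0 < ε / 8 by positivity))
    filter_upwards [k1, k2, k3, k4, eventually_gt_atTop 0] with t k1 k2 k3 k4 t0 φ
    rw [Real.dist_eq] at k1 k2 k3
    have m1 := F.center1 t0 φ
    have m2 := F.center2 t0 φ
    set r := In g t / (2 * π) with hrdef
    have L0 := F.Lpos t0
    have r0 : 0 < r := by positivity
    set C1 := In (fun t φ => x t φ * (k t φ * g t φ)) t
    set C2 := In (fun t φ => y t φ * (k t φ * g t φ)) t
    have n1 : |2 * π * (x t φ - r * q t φ) - c₁| < ε / 4 := by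
      have := abs_sub_le (2 * π * (x t φ - r * q t φ)) C1 c₁
      linarith
    have n2 : |2 * π * (y t φ + r * p t φ) - c₂| < ε / 4 := by
      have := abs_sub_le (2 * π * (y t φ + r * p t φ)) C2 c₂
      linarith
    set X1 := x t φ - r * q t φ - c₁ / (2 * π) with hX1
    set X2 := y t φ + r * p t φ - c₂ / (2 * π) with hX2
    have o1 : |X1| < ε / 4 := by
      have e : 2 * π * (x t φ - r * q t φ) - c₁ = 2 * π * X1 := by rw [hX1]; field_simp
      rw [e, abs_mul, abs_of_pos (by positivity)] at n1
      nlinarith [Real.pi_gt_three, abs_nonneg X1]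
    have o2 : |X2| < ε / 4 := by
      have e : 2 * π * (y t φ + r * p t φ) - c₂ = 2 * π * X2 := by rw [hX2]; field_simp
      rw [e, abs_mul, abs_of_pos (by positivity)] at n2
      nlinarith [Real.pi_gt_three, abs_nonneg X2]
    have e1 : x t φ - c₁ / (2 * π) = X1 + r * q t φ := by rw [hX1]; ring
    have e2 : y t φ - c₂ / (2 * π) = X2 - r * p t φ := by rw [hX2]; ring
    rw [e1, e2]
    have tri := abs_le.1 (tri_aux (X1 := X1) (X2 := X2) (F.pq t t0 φ) (F.p1 t0 φ) (F.q1 t0 φ) r0)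
    have k3' := abs_lt.1 k3
    rw [abs_lt]
    constructor <;> linarith [k3'.1, k3'.2]

end Fl

/-- area of the initial curve as a limit -/
lemma area_zero {X : ℝ → ℝ → ℝ × ℝ} {A : ℝ}
    (hs : ContDiffOn ℝ (⊤ : ℕ∞) (fun p : ℝ × ℝ => X p.1 p.2) (Ici (0:ℝ) ×ˢ univ))
    (hA : ∀ t, 0 < t → ∫ φ in (0:ℝ)..(2 * π), vdet (X t φ) (deriv (X t) φ) = A) :
    ∫ φ in (0:ℝ)..(2 * π), vdet (X 0 φ) (deriv (X 0) φ) = A := by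
  have hu : UniqueDiffOn ℝ (Ici (0:ℝ) ×ˢ (univ : Set ℝ)) :=
    (uniqueDiffOn_Ici 0).prod uniqueDiffOn_univ
  have hc := hs.continuousOn_fderivWithin hu (by simp)
  have hd : ∀ t, 0 ≤ t → ∀ φ, deriv (X t) φ =
      fderivWithin ℝ (fun p : ℝ × ℝ => X p.1 p.2) (Ici (0:ℝ) ×ˢ univ) (t, φ) (0, 1) := by
    intro t ht φ
    have h1 : HasDerivWithinAt (fun ψ : ℝ => (t, ψ)) ((0:ℝ), (1:ℝ)) univ φ :=
      ((hasDerivAt_const φ t).prodMk (hasDerivAt_id φ)).hasDerivWithinAt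
    have h2 := (hs.differentiableOn (by simp) (t, φ) ⟨ht, mem_univ _⟩).hasFDerivWithinAt
    have h3 := h2.comp_hasDerivWithinAt φ h1 (fun ψ _ => ⟨ht, mem_univ _⟩)
    exact (hasDerivWithinAt_univ.1 h3).deriv
  have hm : Continuous (fun p : ℝ × ℝ => (max p.1 0, p.2)) := by fun_prop
  have hmem : ∀ p : ℝ × ℝ, (max p.1 0, p.2) ∈ Ici (0:ℝ) ×ˢ (univ : Set ℝ) :=
    fun p => ⟨mem_Ici.2 (le_max_right p.1 0), mem_univ _⟩
  have c1 : Continuous (fun p : ℝ × ℝ => X (max p.1 0) p.2) :=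
    hs.continuousOn.comp_continuous hm hmem
  have c2 : Continuous (fun p : ℝ × ℝ => deriv (X (max p.1 0)) p.2) := by
    have h := (hc.comp_continuous hm hmem).clm_apply (continuous_const (y := ((0:ℝ), (1:ℝ))))
    refine h.congr fun p => ?_
    exact (hd _ (le_max_right _ _) _).symm
  have c3 : Continuous (fun p : ℝ × ℝ => vdet (X (max p.1 0) p.2) (deriv (X (max p.1 0)) p.2)) := by
    unfold vdet
    exact (c1.fst.mul c2.snd).sub (c1.snd.mul c2.fst)
  have c4 : Continuous (fun t : ℝ => ∫ φ in (0:ℝ)..(2 * π),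
      vdet (X (max t 0) φ) (deriv (X (max t 0)) φ)) :=
    intervalIntegral.continuous_parametric_intervalIntegral_of_continuous' c3 _ _
  have l1 := (c4.tendsto 0).mono_left (nhdsWithin_le_nhds (s := Ioi 0))
  have l2 : Tendsto (fun t : ℝ => ∫ φ in (0:ℝ)..(2 * π),
      vdet (X (max t 0) φ) (deriv (X (max t 0)) φ)) (𝓝[>] 0) (𝓝 A) := by
    refine tendsto_const_nhds.congr' ?_
    filter_upwards [self_mem_nhdsWithin] with t ht
    rw [max_eq_left (le_of_lt ht), hA t ht]
  have := tendsto_nhds_unique l1 l2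
  simpa using this

lemma link {X : ℝ → ℝ → ℝ × ℝ} {X₀ : ℝ → ℝ × ℝ}
    (hsol : IsGAPFSolutionOn X X₀ (Set.Ici 0)) :
    ∃ g p q k a v : ℝ → ℝ → ℝ,
      Fl (fun t φ => (X t φ).1) (fun t φ => (X t φ).2) g p q k a v ∧
      (∀ t, 0 < t → ∀ φ, curv (X t) φ = k t φ) ∧
      (∀ t, 0 < t → ∀ φ, deriv (X t) φ =
        (dX (fun t φ => (X t φ).1) t φ, dX (fun t φ => (X t φ).2) t φ)) := by
  have hX : ∀ t, 0 < t → ∀ φ, ContDiffAt ℝ ∞ (fun p : ℝ × ℝ => X p.1 p.2) (t, φ) := by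
    intro t ht φ
    exact hsol.smooth.contDiffAt (prod_mem_nhds (Ici_mem_nhds ht) univ_mem)
  have sx : Sm (fun t φ => (X t φ).1) := fun t ht =>
    ⟨fun φ => (hX t ht φ).fst, fun φ => by
      simp only [(hsol.curve t ht.le).periodic φ]⟩
  have sy : Sm (fun t φ => (X t φ).2) := fun t ht =>
    ⟨fun φ => (hX t ht φ).snd, fun φ => by
      simp only [(hsol.curve t ht.le).periodic φ]⟩
  generalize hx : (fun t φ => (X t φ).1) = x at *
  generalize hy : (fun t φ => (X t φ).2) = y at *
  have ex : ∀ t φ, X t φ = (x t φ, y t φ) := by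
    intro t φ; rw [← hx, ← hy]
  have d1 : ∀ t, 0 < t → ∀ φ, deriv (X t) φ = (dX x t φ, dX y t φ) := by
    intro t ht φ
    have h := (sx.hasX ht φ).prodMk (sy.hasX ht φ)
    have : X t = fun ψ => (x t ψ, y t ψ) := funext (ex t)
    rw [this]; exact h.deriv
  have d2 : ∀ t, 0 < t → ∀ φ, deriv (deriv (X t)) φ = (dX (dX x) t φ, dX (dX y) t φ) := by
    intro t ht φ
    have h := (sx.dX.hasX ht φ).prodMk (sy.dX.hasX ht φ)
    have : deriv (X t) = fun ψ => (dX x t ψ, dX y t ψ) := funext (d1 t ht)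
    rw [this]; exact h.deriv
  have s0 : Sm (fun t φ => dX x t φ ^ 2 + dX y t φ ^ 2) := (sx.dX.pow 2).add (sy.dX.pow 2)
  have p0 : ∀ t, 0 < t → ∀ φ, 0 < dX x t φ ^ 2 + dX y t φ ^ 2 := by
    intro t ht φ
    have h := (hsol.curve t ht.le).regular φ
    rw [d1 t ht φ] at h
    by_contra hn
    apply h
    have e1 : dX x t φ = 0 := by nlinarith [sq_nonneg (dX x t φ), sq_nonneg (dX y t φ)]
    have e2 : dX y t φ = 0 := by nlinarith [sq_nonneg (dX x t φ), sq_nonneg (dX y t φ)]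
    rw [e1, e2]; rfl
  have sg := s0.sqrt (fun t ht φ => (p0 t ht φ).ne')
  have gpos : ∀ t, 0 < t → ∀ φ, 0 < Real.sqrt (dX x t φ ^ 2 + dX y t φ ^ 2) :=
    fun t ht φ => Real.sqrt_pos.2 (p0 t ht φ)
  have hg2 : ∀ t, 0 < t → ∀ φ, Real.sqrt (dX x t φ ^ 2 + dX y t φ ^ 2) ^ 2 =
      dX x t φ ^ 2 + dX y t φ ^ 2 := fun t ht φ => Real.sq_sqrt (p0 t ht φ).le
  have hgv : ∀ t, 0 < t → ∀ φ, vnorm (deriv (X t) φ) =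
      Real.sqrt (dX x t φ ^ 2 + dX y t φ ^ 2) := by
    intro t ht φ; rw [d1 t ht φ]; rfl
  obtain ⟨g, hg⟩ : ∃ g : ℝ → ℝ → ℝ,
    g = (fun t φ => Real.sqrt (dX x t φ ^ 2 + dX y t φ ^ 2)) := ⟨_, rfl⟩
  have hg' : ∀ t φ, Real.sqrt (dX x t φ ^ 2 + dX y t φ ^ 2) = g t φ := by
    intro t φ; rw [hg]
  simp only [hg'] at sg gpos hg2 hgv
  clear hg hg'
  have g0 : ∀ t, 0 < t → ∀ φ, g t φ ≠ 0 := fun t ht φ => (gpos t ht φ).ne'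
  have sp := sx.dX.div sg g0
  have sq := sy.dX.div sg g0
  obtain ⟨p, hp⟩ : ∃ p : ℝ → ℝ → ℝ, p = (fun t φ => dX x t φ / g t φ) := ⟨_, rfl⟩
  obtain ⟨q, hq⟩ : ∃ q : ℝ → ℝ → ℝ, q = (fun t φ => dX y t φ / g t φ) := ⟨_, rfl⟩
  rw [← hp] at sp
  rw [← hq] at sq
  have xX : ∀ t, 0 < t → ∀ φ, dX x t φ = g t φ * p t φ := by
    intro t ht φ; rw [hp]; have := g0 t ht φ; field_simp
  have yX : ∀ t, 0 < t → ∀ φ, dX y t φ = g t φ * q t φ := by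
    intro t ht φ; rw [hq]; have := g0 t ht φ; field_simp
  have pq : ∀ t, 0 < t → ∀ φ, p t φ * p t φ + q t φ * q t φ = 1 := by
    intro t ht φ
    have h := hg2 t ht φ
    rw [xX t ht φ, yX t ht φ] at h
    have h0 := pow_ne_zero 2 (g0 t ht φ)
    apply mul_left_cancel₀ h0
    linear_combination -h
  have uT : ∀ t, 0 < t → ∀ φ, unitTangent (X t) φ = (p t φ, q t φ) := by
    intro t ht φ
    unfold unitTangent
    have := g0 t ht φ
    rw [hgv t ht φ, d1 t ht φ, hp, hq]
    ext
    · simp [div_eq_inv_mul]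
    · simp [div_eq_inv_mul]
  have sk : Sm (fun t φ => (dX x t φ * dX (dX y) t φ - dX y t φ * dX (dX x) t φ) / g t φ ^ 3) :=
    ((sx.dX.mul sy.dX.dX).sub (sy.dX.mul sx.dX.dX)).div (sg.pow 3)
      (fun t ht φ => pow_ne_zero 3 (g0 t ht φ))
  obtain ⟨k, hk⟩ : ∃ k : ℝ → ℝ → ℝ, k = (fun t φ =>
    (dX x t φ * dX (dX y) t φ - dX y t φ * dX (dX x) t φ) / g t φ ^ 3) := ⟨_, rfl⟩
  rw [← hk] at sk
  have ck : ∀ t, 0 < t → ∀ φ, curv (X t) φ = k t φ := by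
    intro t ht φ
    unfold curv vdet
    rw [hgv t ht φ, d1 t ht φ, d2 t ht φ, hk]
  have kg : ∀ t, 0 < t → ∀ φ, k t φ * g t φ = p t φ * dX q t φ - q t φ * dX p t φ := by
    intro t ht φ
    have e1 : dX (dX x) t φ = dX g t φ * p t φ + g t φ * dX p t φ := by
      rw [← dX_mul sg sp ht φ]
      exact dX_congr ht φ xX
    have e2 : dX (dX y) t φ = dX g t φ * q t φ + g t φ * dX q t φ := by
      rw [← dX_mul sg sq ht φ]
      exact dX_congr ht φ yX
    have := g0 t ht φ
    simp only [hk]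
    rw [e1, e2, xX t ht φ, yX t ht φ]
    field_simp
    ring
  have hL : ∀ t, 0 < t → clen (X t) = In g t := by
    intro t ht
    unfold clen In
    exact intervalIntegral.integral_congr (fun φ _ => hgv t ht φ)
  obtain ⟨α, hα⟩ := hsol.flow
  have hT : ∀ t, 0 < t → ∀ φ,
      dT x t φ = α t φ * p t φ - (k t φ - 2 * π / In g t) * q t φ ∧
      dT y t φ = α t φ * q t φ + (k t φ - 2 * π / In g t) * p t φ := by
    intro t ht φ
    have h := (hα t ht.le φ).hasDerivAt (Ici_mem_nhds ht)
    unfold innerNormal at h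
    rw [uT t ht φ, ck t ht φ, hL t ht] at h
    have e : (fun τ => X τ φ) = fun τ => (x τ φ, y τ φ) := funext fun τ => ex τ φ
    rw [e] at h
    have h2 := h.unique ((sx.hasT ht φ).prodMk (sy.hasT ht φ))
    rw [Prod.ext_iff] at h2
    simp only [Prod.fst_add, Prod.snd_add, Prod.smul_fst, Prod.smul_snd, smul_eq_mul] at h2
    constructor
    · linarith [h2.1]
    · linarith [h2.2]
  refine ⟨g, p, q, k, fun t φ => dT x t φ * p t φ + dT y t φ * q t φ,
    fun t φ => dT y t φ * p t φ - dT x t φ * q t φ, ?_, ck, d1⟩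
  refine ⟨sx, sy, sg, sp, sq, sk, (sx.dT.mul sp).add (sy.dT.mul sq),
    (sy.dT.mul sp).sub (sx.dT.mul sq), gpos, pq, xX, yX, kg, ?_, ?_, ?_⟩
  · intro t ht φ
    linear_combination (-(dT x t φ)) * pq t ht φ
  · intro t ht φ
    linear_combination (-(dT y t φ)) * pq t ht φ
  · intro t ht φ
    obtain ⟨h1, h2⟩ := hT t ht φ
    simp only [h1, h2]
    linear_combination (k t φ - 2 * π / In g t) * pq t ht φ

theorem gapf_global_implies_convergence
    (X : ℝ → ℝ → ℝ × ℝ) (X₀ : ℝ → ℝ × ℝ)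
    (hX₀ : IsSmoothClosedCurve X₀) (hemb : IsEmbeddedCurve X₀)
    (hsol : IsGAPFSolutionOn X X₀ (Set.Ici 0)) :
    (∃ T₀ : ℝ, ∀ t > T₀, ∀ φ, 0 < curv (X t) φ) ∧
    (∃ c : ℝ × ℝ, ∀ ε > 0, ∃ T : ℝ, ∀ t > T, ∀ φ,
      |vnorm (X t φ - c) - Real.sqrt (carea X₀ / π)| < ε) ∧
    (∀ ε > 0, ∃ T : ℝ, ∀ t > T, ∀ φ,
      |curv (X t) φ - Real.sqrt (π / carea X₀)| < ε) := by
  obtain ⟨g, p, q, k, a, v, F, ck, d1⟩ := link hsol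
  obtain ⟨A, hAdef⟩ : ∃ A : ℝ, A = In (fun t φ => (fun t φ => (X t φ).1) t φ *
    dX (fun t φ => (X t φ).2) t φ - (fun t φ => (X t φ).2) t φ * dX (fun t φ => (X t φ).1) t φ) 1 :=
    ⟨_, rfl⟩
  have hA := F.A_const
  rw [← hAdef] at hA
  obtain ⟨A0, hk, c₁, c₂, hc⟩ := F.concl hA
  have hA2 : carea X₀ = A / 2 := by
    have h0 := area_zero (A := A) hsol.smooth (fun t ht => by
      rw [← hA t ht]
      unfold In
      refine intervalIntegral.integral_congr fun φ _ => ?_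
      simp only [vdet]
      rw [d1 t ht φ])
    have e : X 0 = X₀ := funext hsol.1
    rw [e] at h0
    unfold carea
    rw [h0]; ring
  have hr : Real.sqrt (carea X₀ / π) = Real.sqrt (2 * π * A) / (2 * π) := by
    rw [hA2]
    have : A / 2 / π = (2 * π * A) / (2 * π) ^ 2 := by field_simp
    rw [this, Real.sqrt_div (by positivity), Real.sqrt_sq (by positivity)]
  have hr2 : Real.sqrt (π / carea X₀) = 2 * π / Real.sqrt (2 * π * A) := by
    rw [← inv_div, Real.sqrt_inv, hr, inv_div]
  rw [hr, hr2]
  have hkk : ∀ ε > 0, ∃ T : ℝ, ∀ t > T, ∀ φ,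
      |curv (X t) φ - 2 * π / Real.sqrt (2 * π * A)| < ε := by
    intro ε hε
    obtain ⟨T, hT⟩ := eventually_atTop.1 ((hk ε hε).and (eventually_gt_atTop 0))
    refine ⟨T, fun t ht φ => ?_⟩
    rw [ck t (hT t ht.le).2 φ]
    exact (hT t ht.le).1 φ
  refine ⟨?_, ⟨(c₁, c₂), ?_⟩, hkk⟩
  · have h0 : 0 < 2 * π / Real.sqrt (2 * π * A) := by positivity
    obtain ⟨T, hT⟩ := hkk _ h0
    refine ⟨T, fun t ht φ => ?_⟩
    have := (abs_lt.1 (hT t ht φ)).1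
    linarith
  · intro ε hε
    obtain ⟨T, hT⟩ := eventually_atTop.1 (hc ε hε)
    exact ⟨T, fun t ht φ => hT t ht.le φ⟩
end
end

section
/- Let X(·,t), t ∈ [0, +∞), be a smooth solution of Gage's area-preserving flow with smooth embedded closed initial curve, with curvature κ(·,t) and length L(t). Then the L² norm over the evolving curve of the difference κ − 2π/L converges to zero as t → ∞: lim_{t→∞} ∫₀^{L(t)} (κ − 2π/L)² ds = 0, where the integral is with respect to arc length. -/
open Real Set MeasureTheory Filter

noncomputable section

/-- The arc-length integral `∫₀^L (κ − 2π/L)² ds` over the evolving curve, written in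
the parameter `φ` (with `ds = |∂X/∂φ| dφ`). -/
def gapfDissipation (X : ℝ → ℝ → ℝ × ℝ) (t : ℝ) : ℝ :=
  ∫ φ in (0:ℝ)..(2 * π),
    (curv (X t) φ - 2 * π / clen (X t)) ^ 2 * vnorm (deriv (X t) φ)


/-! ## Calculus on the half plane of positive times -/

def gU : Set (ℝ × ℝ) := {p | 0 < p.1}

def gDp (u : ℝ × ℝ → ℝ) (p : ℝ × ℝ) : ℝ := fderiv ℝ u p (0, 1)

def gDt (u : ℝ × ℝ → ℝ) (p : ℝ × ℝ) : ℝ := fderiv ℝ u p (1, 0)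

structure SP (u : ℝ × ℝ → ℝ) : Prop where
  cd : ContDiffOn ℝ (⊤ : ℕ∞) u gU
  per : ∀ t, 0 < t → ∀ φ, u (t, φ + 2 * π) = u (t, φ)

lemma gU_open : IsOpen gU := isOpen_lt continuous_const continuous_fst

lemma SP.diffAt {u : ℝ × ℝ → ℝ} (hu : SP u) {p : ℝ × ℝ} (hp : p ∈ gU) :
    DifferentiableAt ℝ u p :=
  (hu.cd.contDiffAt (gU_open.mem_nhds hp)).differentiableAt (by simp)

lemma SP.hasDerivAt_p {u : ℝ × ℝ → ℝ} (hu : SP u) {t : ℝ} (ht : 0 < t) (φ : ℝ) :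
    HasDerivAt (fun φ => u (t, φ)) (gDp u (t, φ)) φ := by
  have h := (hu.diffAt (p := (t, φ)) ht).hasFDerivAt
  exact h.comp_hasDerivAt φ ((hasDerivAt_const φ t).prodMk (hasDerivAt_id φ))

lemma SP.hasDerivAt_t {u : ℝ × ℝ → ℝ} (hu : SP u) {t : ℝ} (ht : 0 < t) (φ : ℝ) :
    HasDerivAt (fun t => u (t, φ)) (gDt u (t, φ)) t := by
  have h := (hu.diffAt (p := (t, φ)) ht).hasFDerivAt
  exact h.comp_hasDerivAt t ((hasDerivAt_id t).prodMk (hasDerivAt_const t φ))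

lemma fderiv_per {u : ℝ × ℝ → ℝ} (hu : SP u) {t : ℝ} (ht : 0 < t) (φ : ℝ) :
    fderiv ℝ u (t, φ + 2 * π) = fderiv ℝ u (t, φ) := by
  have h1 : (fun p : ℝ × ℝ => u (p + (0, 2 * π))) =ᶠ[nhds (t, φ)] u := by
    filter_upwards [gU_open.mem_nhds (show ((t, φ) : ℝ × ℝ) ∈ gU from ht)] with p hp
    have := hu.per p.1 hp p.2
    simpa [Prod.add_def] using this
  have h2 := h1.fderiv_eq (𝕜 := ℝ)
  rw [fderiv_comp_add_right] at h2
  simpa using h2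

lemma SP.fderiv_apply {u : ℝ × ℝ → ℝ} (hu : SP u) (w : ℝ × ℝ) :
    SP (fun p => fderiv ℝ u p w) where
  cd := (hu.cd.fderiv_of_isOpen gU_open (m := ((⊤ : ℕ∞) : WithTop ℕ∞)) (by simp)).clm_apply
    contDiffOn_const
  per t ht φ := by simp only [fderiv_per hu ht φ]

lemma SP.dp {u : ℝ × ℝ → ℝ} (hu : SP u) : SP (gDp u) := hu.fderiv_apply _
lemma SP.dt {u : ℝ × ℝ → ℝ} (hu : SP u) : SP (gDt u) := hu.fderiv_apply _

lemma SP.add {u w : ℝ × ℝ → ℝ} (hu : SP u) (hw : SP w) : SP (fun p => u p + w p) :=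
  ⟨hu.cd.add hw.cd, fun t ht φ => by simp only [hu.per t ht, hw.per t ht]⟩
lemma SP.sub {u w : ℝ × ℝ → ℝ} (hu : SP u) (hw : SP w) : SP (fun p => u p - w p) :=
  ⟨hu.cd.sub hw.cd, fun t ht φ => by simp only [hu.per t ht, hw.per t ht]⟩
lemma SP.mul {u w : ℝ × ℝ → ℝ} (hu : SP u) (hw : SP w) : SP (fun p => u p * w p) :=
  ⟨hu.cd.mul hw.cd, fun t ht φ => by simp only [hu.per t ht, hw.per t ht]⟩
lemma SP.neg {u : ℝ × ℝ → ℝ} (hu : SP u) : SP (fun p => - u p) :=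
  ⟨hu.cd.neg, fun t ht φ => by simp only [hu.per t ht]⟩
lemma SP.div {u w : ℝ × ℝ → ℝ} (hu : SP u) (hw : SP w) (h0 : ∀ p ∈ gU, w p ≠ 0) :
    SP (fun p => u p / w p) :=
  ⟨hu.cd.div hw.cd h0, fun t ht φ => by simp only [hu.per t ht, hw.per t ht]⟩
lemma SP.sqrt {u : ℝ × ℝ → ℝ} (hu : SP u) (h0 : ∀ p ∈ gU, u p ≠ 0) :
    SP (fun p => Real.sqrt (u p)) :=
  ⟨hu.cd.sqrt h0, fun t ht φ => by simp only [hu.per t ht]⟩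
lemma SP.pow {u : ℝ × ℝ → ℝ} (hu : SP u) (n : ℕ) : SP (fun p => u p ^ n) :=
  ⟨hu.cd.pow n, fun t ht φ => by simp only [hu.per t ht]⟩
lemma SP.const (c : ℝ) : SP (fun _ => c) :=
  ⟨contDiffOn_const, fun _ _ _ => rfl⟩

lemma gD_comm {u : ℝ × ℝ → ℝ} (hu : SP u) {p : ℝ × ℝ} (hp : p ∈ gU) :
    gDt (gDp u) p = gDp (gDt u) p := by
  have hc : ContDiffAt ℝ (⊤ : ℕ∞) u p := hu.cd.contDiffAt (gU_open.mem_nhds hp)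
  have hsymm : IsSymmSndFDerivAt ℝ u p := hc.isSymmSndFDerivAt (by
    simp only [minSmoothness_of_isRCLikeNormedField]
    norm_cast)
  have hd : DifferentiableAt ℝ (fderiv ℝ u) p :=
    ((hu.cd.fderiv_of_isOpen gU_open (m := ((⊤ : ℕ∞) : WithTop ℕ∞)) (by simp)).contDiffAt
      (gU_open.mem_nhds hp)).differentiableAt (by simp)
  have key : ∀ w w' : ℝ × ℝ, fderiv ℝ (fun q => fderiv ℝ u q w) p w' =
      fderiv ℝ (fderiv ℝ u) p w' w := by
    intro w w'
    rw [fderiv_clm_apply hd (differentiableAt_const w)]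
    simp
  change fderiv ℝ (fun q => fderiv ℝ u q (0, 1)) p (1, 0) =
    fderiv ℝ (fun q => fderiv ℝ u q (1, 0)) p (0, 1)
  rw [key, key]
  exact hsymm _ _

lemma gfd_congr {u w : ℝ × ℝ → ℝ} (h : ∀ p ∈ gU, u p = w p) {p : ℝ × ℝ} (hp : p ∈ gU) :
    fderiv ℝ u p = fderiv ℝ w p := by
  apply Filter.EventuallyEq.fderiv_eq
  filter_upwards [gU_open.mem_nhds hp] with q hq using h q hq

lemma gDp_congr {u w : ℝ × ℝ → ℝ} (h : ∀ p ∈ gU, u p = w p) {p : ℝ × ℝ} (hp : p ∈ gU) :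
    gDp u p = gDp w p := by simp only [gDp, gfd_congr h hp]
lemma gDt_congr {u w : ℝ × ℝ → ℝ} (h : ∀ p ∈ gU, u p = w p) {p : ℝ × ℝ} (hp : p ∈ gU) :
    gDt u p = gDt w p := by simp only [gDt, gfd_congr h hp]

section rules
variable {u w : ℝ × ℝ → ℝ} {p : ℝ × ℝ}

lemma gDp_mul (hu : SP u) (hw : SP w) (hp : p ∈ gU) :
    gDp (fun q => u q * w q) p = gDp u p * w p + u p * gDp w p := by
  simp only [gDp]
  rw [fderiv_fun_mul (hu.diffAt hp) (hw.diffAt hp)]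
  simp; ring
lemma gDt_mul (hu : SP u) (hw : SP w) (hp : p ∈ gU) :
    gDt (fun q => u q * w q) p = gDt u p * w p + u p * gDt w p := by
  simp only [gDt]
  rw [fderiv_fun_mul (hu.diffAt hp) (hw.diffAt hp)]
  simp; ring
lemma gDp_add (hu : SP u) (hw : SP w) (hp : p ∈ gU) :
    gDp (fun q => u q + w q) p = gDp u p + gDp w p := by
  simp only [gDp]
  rw [fderiv_fun_add (hu.diffAt hp) (hw.diffAt hp)]
  simp
lemma gDt_add (hu : SP u) (hw : SP w) (hp : p ∈ gU) :
    gDt (fun q => u q + w q) p = gDt u p + gDt w p := by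
  simp only [gDt]
  rw [fderiv_fun_add (hu.diffAt hp) (hw.diffAt hp)]
  simp
lemma gDp_sub (hu : SP u) (hw : SP w) (hp : p ∈ gU) :
    gDp (fun q => u q - w q) p = gDp u p - gDp w p := by
  simp only [gDp]
  rw [fderiv_fun_sub (hu.diffAt hp) (hw.diffAt hp)]
  simp
lemma gDt_sub (hu : SP u) (hw : SP w) (hp : p ∈ gU) :
    gDt (fun q => u q - w q) p = gDt u p - gDt w p := by
  simp only [gDt]
  rw [fderiv_fun_sub (hu.diffAt hp) (hw.diffAt hp)]
  simp
lemma gDp_neg : gDp (fun q => - u q) p = - gDp u p := by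
  simp only [gDp]
  rw [fderiv_fun_neg]
  simp
lemma gDt_neg : gDt (fun q => - u q) p = - gDt u p := by
  simp only [gDt]
  rw [fderiv_fun_neg]
  simp
lemma gDp_const (c : ℝ) : gDp (fun _ => c) p = 0 := by simp [gDp]
lemma gDt_const (c : ℝ) : gDt (fun _ => c) p = 0 := by simp [gDt]
end rules

lemma SP.cont {u : ℝ × ℝ → ℝ} (hu : SP u) {t : ℝ} (ht : 0 < t) :
    Continuous (fun φ => u (t, φ)) :=
  continuous_iff_continuousAt.2 fun φ => (hu.hasDerivAt_p ht φ).continuousAt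

lemma SP.ii {u : ℝ × ℝ → ℝ} (hu : SP u) {t : ℝ} (ht : 0 < t) (c d : ℝ) :
    IntervalIntegrable (fun φ => u (t, φ)) volume c d := (hu.cont ht).intervalIntegrable c d

/-- the integral over one period -/
def gI (u : ℝ × ℝ → ℝ) (t : ℝ) : ℝ := ∫ φ in (0:ℝ)..(2 * π), u (t, φ)

lemma gI_dp {u : ℝ × ℝ → ℝ} (hu : SP u) {t : ℝ} (ht : 0 < t) : gI (gDp u) t = 0 := by
  unfold gI
  rw [intervalIntegral.integral_eq_sub_of_hasDerivAt (f := fun φ => u (t, φ))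
    (fun φ _ => hu.hasDerivAt_p ht φ) (hu.dp.ii ht _ _)]
  have := hu.per t ht 0
  rw [zero_add] at this
  simp [this]

lemma gI_congr {u w : ℝ × ℝ → ℝ} {t : ℝ} (h : ∀ φ, u (t, φ) = w (t, φ)) : gI u t = gI w t := by
  unfold gI; simp only [h]

lemma gI_add {u w : ℝ × ℝ → ℝ} (hu : SP u) (hw : SP w) {t : ℝ} (ht : 0 < t) :
    gI (fun p => u p + w p) t = gI u t + gI w t :=
  intervalIntegral.integral_add (hu.ii ht _ _) (hw.ii ht _ _)
lemma gI_sub {u w : ℝ × ℝ → ℝ} (hu : SP u) (hw : SP w) {t : ℝ} (ht : 0 < t) :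
    gI (fun p => u p - w p) t = gI u t - gI w t :=
  intervalIntegral.integral_sub (hu.ii ht _ _) (hw.ii ht _ _)
lemma gI_smul {u : ℝ × ℝ → ℝ} (c : ℝ) (t : ℝ) :
    gI (fun p => c * u p) t = c * gI u t :=
  intervalIntegral.integral_const_mul _ _
lemma gI_neg {u : ℝ × ℝ → ℝ} (t : ℝ) :
    gI (fun p => - u p) t = - gI u t :=
  intervalIntegral.integral_neg
lemma gI_nonneg {u : ℝ × ℝ → ℝ} {t : ℝ} (h : ∀ φ, 0 ≤ u (t, φ)) : 0 ≤ gI u t :=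
  intervalIntegral.integral_nonneg (by positivity) fun φ _ => h φ
lemma gI_mono {u w : ℝ × ℝ → ℝ} (hu : SP u) (hw : SP w) {t : ℝ} (ht : 0 < t)
    (h : ∀ φ ∈ Icc 0 (2 * π), u (t, φ) ≤ w (t, φ)) : gI u t ≤ gI w t :=
  intervalIntegral.integral_mono_on (by positivity) (hu.ii ht _ _) (hw.ii ht _ _) h

lemma gI_hasDerivAt {u : ℝ × ℝ → ℝ} (hu : SP u) {t : ℝ} (ht : 0 < t) :
    HasDerivAt (gI u) (gI (gDt u) t) t := by
  have hK : IsCompact (Icc (t / 2) (2 * t) ×ˢ Icc (0:ℝ) (2 * π)) := isCompact_Icc.prod isCompact_Icc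
  have hsub : Icc (t / 2) (2 * t) ×ˢ Icc (0:ℝ) (2 * π) ⊆ gU := by
    rintro p ⟨hp, -⟩
    have := hp.1
    show 0 < p.1
    linarith
  obtain ⟨C, hC⟩ := hK.exists_bound_of_continuousOn (hu.dt.cd.continuousOn.mono hsub)
  have hs : Ioo (t / 2) (2 * t) ∈ nhds t := Ioo_mem_nhds (by linarith) (by linarith)
  refine (intervalIntegral.hasDerivAt_integral_of_dominated_loc_of_deriv_le
    (F := fun t φ => u (t, φ)) (F' := fun t φ => gDt u (t, φ)) (bound := fun _ => C) hs ?_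
    (hu.ii ht _ _) ?_ ?_ ?_ ?_).2
  · filter_upwards [hs] with τ hτ
    exact (hu.cont (by have := hτ.1; linarith)).aestronglyMeasurable
  · exact (hu.dt.cont ht).aestronglyMeasurable
  · refine Eventually.of_forall fun φ hφ τ hτ => hC (τ, φ) ⟨⟨hτ.1.le, hτ.2.le⟩, ?_⟩
    rw [uIoc_of_le (by positivity)] at hφ
    exact ⟨hφ.1.le, hφ.2⟩
  · exact intervalIntegrable_const
  · refine Eventually.of_forall fun φ _ τ hτ => hu.hasDerivAt_t (by have := hτ.1; linarith) φ

/-! ## The flow in moving-frame form -/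

structure GData (x y v a b k f α : ℝ × ℝ → ℝ) : Prop where
  sx : SP x
  sy : SP y
  sv : SP v
  sa : SP a
  sb : SP b
  sk : SP k
  sf : SP f
  sα : SP α
  vpos : ∀ p ∈ gU, 0 < v p
  ab : ∀ p ∈ gU, a p * a p + b p * b p = 1
  xp : ∀ p ∈ gU, gDp x p = v p * a p
  yp : ∀ p ∈ gU, gDp y p = v p * b p
  ap : ∀ p ∈ gU, gDp a p = -(v p * k p * b p)
  bp : ∀ p ∈ gU, gDp b p = v p * k p * a p
  xt : ∀ p ∈ gU, gDt x p = α p * a p - f p * b p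
  yt : ∀ p ∈ gU, gDt y p = α p * b p + f p * a p
  fk : ∀ p ∈ gU, f p = k p - 2 * π / gI v p.1

namespace GData
variable {x y v a b k f α : ℝ × ℝ → ℝ}

lemma fp (G : GData x y v a b k f α) {p : ℝ × ℝ} (hp : p ∈ gU) : gDp f p = gDp k p := by
  have h1 := G.sf.hasDerivAt_p hp p.2
  have h2 : HasDerivAt (fun φ => f (p.1, φ)) (gDp k (p.1, p.2)) p.2 := by
    have : (fun φ => f (p.1, φ)) = fun φ => k (p.1, φ) - 2 * π / gI v p.1 := by
      funext φ; exact G.fk (p.1, φ) hp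
    rw [this]
    exact (G.sk.hasDerivAt_p hp p.2).sub_const _
  exact h1.unique h2

lemma vt_rel (G : GData x y v a b k f α) {p : ℝ × ℝ} (hp : p ∈ gU) :
    gDt v p = gDp α p - f p * v p * k p ∧
    v p * gDt a p = -((α p * v p * k p + gDp f p) * b p) ∧
    v p * gDt b p = (α p * v p * k p + gDp f p) * a p := by
  have e1 : gDt v p * a p + v p * gDt a p =
      gDp α p * a p + α p * gDp a p - (gDp f p * b p + f p * gDp b p) := by
    rw [← gDt_mul G.sv G.sa hp, ← gDp_mul G.sα G.sa hp, ← gDp_mul G.sf G.sb hp,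
      ← gDp_sub (G.sα.mul G.sa) (G.sf.mul G.sb) hp, ← gDp_congr G.xt hp, ← gDt_congr G.xp hp]
    exact gD_comm G.sx hp
  have e2 : gDt v p * b p + v p * gDt b p =
      gDp α p * b p + α p * gDp b p + (gDp f p * a p + f p * gDp a p) := by
    rw [← gDt_mul G.sv G.sb hp, ← gDp_mul G.sα G.sb hp, ← gDp_mul G.sf G.sa hp,
      ← gDp_add (G.sα.mul G.sb) (G.sf.mul G.sa) hp, ← gDp_congr G.yt hp, ← gDt_congr G.yp hp]
    exact gD_comm G.sy hp
  have e3 : gDt a p * a p + a p * gDt a p + (gDt b p * b p + b p * gDt b p) = 0 := by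
    rw [← gDt_mul G.sa G.sa hp, ← gDt_mul G.sb G.sb hp,
      ← gDt_add (G.sa.mul G.sa) (G.sb.mul G.sb) hp, gDt_congr G.ab hp, gDt_const]
  have e0 := G.ab p hp
  rw [G.ap p hp, G.bp p hp] at e1 e2
  have hv : gDt v p = gDp α p - f p * v p * k p := by
    linear_combination a p * e1 + b p * e2 - v p / 2 * e3 - (gDt v p - gDp α p + f p * v p * k p) * e0
  refine ⟨hv, ?_, ?_⟩
  · linear_combination e1 - a p * hv
  · linear_combination e2 - b p * hv

/-- rate of rotation of the frame -/
def om (v k f α : ℝ × ℝ → ℝ) : ℝ × ℝ → ℝ := fun p => α p * k p + gDp f p / v p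

lemma som (G : GData x y v a b k f α) : SP (om v k f α) :=
  (G.sα.mul G.sk).add (G.sf.dp.div G.sv fun p hp => (G.vpos p hp).ne')

lemma at_eq (G : GData x y v a b k f α) {p : ℝ × ℝ} (hp : p ∈ gU) :
    gDt a p = -(om v k f α p * b p) ∧ gDt b p = om v k f α p * a p := by
  obtain ⟨-, h1, h2⟩ := G.vt_rel hp
  have hv := (G.vpos p hp).ne'
  unfold om
  constructor
  · field_simp
    linear_combination h1
  · field_simp
    linear_combination h2

lemma vk_t (G : GData x y v a b k f α) {p : ℝ × ℝ} (hp : p ∈ gU) :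
    gDt (fun q => v q * k q) p = gDp (om v k f α) p := by
  have svk := G.sv.mul G.sk
  have e1 : -(gDt (fun q => v q * k q) p * b p + v p * k p * gDt b p) =
      -(gDp (om v k f α) p * b p + om v k f α p * gDp b p) := by
    rw [← gDt_mul svk G.sb hp, ← gDp_mul G.som G.sb hp, ← gDt_neg, ← gDp_neg,
      ← gDt_congr G.ap hp, ← gDp_congr (fun q hq => (G.at_eq hq).1) hp]
    exact gD_comm G.sa hp
  have e2 : gDt (fun q => v q * k q) p * a p + v p * k p * gDt a p =
      gDp (om v k f α) p * a p + om v k f α p * gDp a p := by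
    rw [← gDt_mul svk G.sa hp, ← gDp_mul G.som G.sa hp,
      ← gDt_congr G.bp hp, ← gDp_congr (fun q hq => (G.at_eq hq).2) hp]
    exact gD_comm G.sb hp
  rw [G.bp p hp, (G.at_eq hp).2] at e1
  rw [G.ap p hp, (G.at_eq hp).1] at e2
  linear_combination a p * e2 - b p * e1 -
    (gDt (fun q => v q * k q) p - gDp (om v k f α) p) * G.ab p hp

lemma Lpos (G : GData x y v a b k f α) {t : ℝ} (ht : 0 < t) : 0 < gI v t :=
  intervalIntegral.intervalIntegral_pos_of_pos (G.sv.ii ht _ _) (fun φ => G.vpos (t, φ) ht)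
    (by positivity)

/-- total curvature is constant -/
lemma c_deriv (G : GData x y v a b k f α) {t : ℝ} (ht : 0 < t) :
    HasDerivAt (gI fun p => v p * k p) 0 t := by
  have h := gI_hasDerivAt (G.sv.mul G.sk) ht
  rw [gI_congr (fun φ => G.vk_t (p := (t, φ)) ht), gI_dp G.som ht] at h
  exact h

lemma int_fv (G : GData x y v a b k f α) {t : ℝ} (ht : 0 < t) :
    gI (fun p => f p * v p) t = gI (fun p => v p * k p) t - 2 * π := by
  have h := G.Lpos ht
  have e : gI (fun p => f p * v p) t = gI (fun p => v p * k p - (2 * π / gI v t) * v p) t :=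
    gI_congr fun φ => by
      have := G.fk (t, φ) ht
      simp only [this]; ring
  rw [e, gI_sub (G.sv.mul G.sk) ((SP.const _).mul G.sv) ht, gI_smul]
  field_simp

lemma L_deriv (G : GData x y v a b k f α) {t : ℝ} (ht : 0 < t) :
    HasDerivAt (gI v) (-gI (fun p => f p * v p * k p) t) t := by
  have h := gI_hasDerivAt G.sv ht
  rw [gI_congr (w := fun p => gDp α p - f p * v p * k p)
      (fun φ => (G.vt_rel (p := (t, φ)) ht).1),
    gI_sub G.sα.dp ((G.sf.mul G.sv).mul G.sk) ht, gI_dp G.sα ht, zero_sub] at h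
  exact h

lemma L_deriv1 (G : GData x y v a b k f α) {t : ℝ} (ht : 0 < t) :
    gI (fun p => f p * v p * k p) t = gI (fun p => f p ^ 2 * v p) t +
      (2 * π / gI v t) * (gI (fun p => v p * k p) t - 2 * π) := by
  rw [← G.int_fv ht, ← gI_smul, ← gI_add ((G.sf.pow 2).mul G.sv)
    ((SP.const _).mul (G.sf.mul G.sv)) ht]
  refine gI_congr fun φ => ?_
  have := G.fk (t, φ) ht
  simp only at this
  simp only [show k (t, φ) = f (t, φ) + 2 * π / gI v t by linarith]
  ring

lemma L_deriv2 (G : GData x y v a b k f α) {t : ℝ} (ht : 0 < t) :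
    gI (fun p => f p * v p * k p) t = gI (fun p => k p ^ 2 * v p) t -
      (2 * π / gI v t) * (gI (fun p => v p * k p) t) := by
  rw [← gI_smul, ← gI_sub ((G.sk.pow 2).mul G.sv)
    ((SP.const _).mul (G.sv.mul G.sk)) ht]
  refine gI_congr fun φ => ?_
  have := G.fk (t, φ) ht
  simp only at this
  simp only [this]
  ring

/-- twice the area -/
lemma A_deriv (G : GData x y v a b k f α) {t : ℝ} (ht : 0 < t) :
    HasDerivAt (gI fun p => x p * gDp y p - y p * gDp x p)
      (-2 * (gI (fun p => v p * k p) t - 2 * π)) t := by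
  have s1 := G.sx.mul G.sy.dp
  have s2 := G.sy.mul G.sx.dp
  have h := gI_hasDerivAt (s1.sub s2) ht
  have sB := (G.sx.mul G.sy.dt).sub (G.sy.mul G.sx.dt)
  have e : gI (gDt fun p => x p * gDp y p - y p * gDp x p) t =
      gI (fun p => gDp (fun q => x q * gDt y q - y q * gDt x q) p + (-2) * (f p * v p)) t := by
    refine gI_congr fun φ => ?_
    have hp : (t, φ) ∈ gU := ht
    rw [gDt_sub s1 s2 hp, gDt_mul G.sx G.sy.dp hp, gDt_mul G.sy G.sx.dp hp]
    rw [gDp_sub (G.sx.mul G.sy.dt) (G.sy.mul G.sx.dt) hp, gDp_mul G.sx G.sy.dt hp,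
      gDp_mul G.sy G.sx.dt hp, gD_comm G.sx hp, gD_comm G.sy hp, G.xp _ hp, G.yp _ hp,
      G.xt _ hp, G.yt _ hp]
    linear_combination (-2 * f (t, φ) * v (t, φ)) * G.ab _ hp
  rw [e, gI_add sB.dp ((SP.const _).mul (G.sf.mul G.sv)) ht, gI_dp sB ht, gI_smul, G.int_fv ht,
    zero_add] at h
  exact h

lemma x_bd (G : GData x y v a b k f α) {t : ℝ} (ht : 0 < t) {φ : ℝ} (hφ : φ ∈ Icc 0 (2 * π)) :
    |x (t, φ) - x (t, 0)| ≤ gI v t ∧ |y (t, φ) - y (t, 0)| ≤ gI v t := by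
  have key : ∀ z c : ℝ × ℝ → ℝ, SP z → (∀ p ∈ gU, gDp z p = v p * c p) →
      (∀ p ∈ gU, |c p| ≤ 1) → |z (t, φ) - z (t, 0)| ≤ gI v t := by
    intro z c hz h1 h2
    rw [← intervalIntegral.integral_eq_sub_of_hasDerivAt (f := fun φ => z (t, φ))
      (fun φ _ => hz.hasDerivAt_p ht φ) (hz.dp.ii ht _ _)]
    refine (intervalIntegral.abs_integral_le_integral_abs hφ.1).trans ?_
    calc ∫ s in (0:ℝ)..φ, |gDp z (t, s)| ≤ ∫ s in (0:ℝ)..φ, v (t, s) := by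
          refine intervalIntegral.integral_mono_on hφ.1 (hz.dp.ii ht _ _).abs (G.sv.ii ht _ _) ?_
          intro s _
          have hv := G.vpos (t, s) ht
          rw [h1 (t, s) ht, abs_mul, abs_of_pos hv]
          exact mul_le_of_le_one_right hv.le (h2 _ ht)
      _ ≤ gI v t := by
          refine intervalIntegral.integral_mono_interval le_rfl hφ.1 hφ.2 ?_ (G.sv.ii ht _ _)
          exact Eventually.of_forall fun s => (G.vpos (t, s) ht).le
  refine ⟨key x a G.sx G.xp ?_, key y b G.sy G.yp ?_⟩
  · intro p hp
    have := G.ab p hp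
    exact abs_le_one_iff_mul_self_le_one.2 (by nlinarith [mul_self_nonneg (b p)])
  · intro p hp
    have := G.ab p hp
    exact abs_le_one_iff_mul_self_le_one.2 (by nlinarith [mul_self_nonneg (a p)])

/-- support function relative to the base point -/
lemma supp_bd (G : GData x y v a b k f α) {t : ℝ} (ht : 0 < t) {φ : ℝ}
    (hφ : φ ∈ Icc 0 (2 * π)) :
    |(x (t, φ) - x (t, 0)) * b (t, φ) - (y (t, φ) - y (t, 0)) * a (t, φ)| ≤ 2 * gI v t := by
  obtain ⟨h1, h2⟩ := G.x_bd ht hφ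
  have hab := G.ab (t, φ) ht
  have ha : |a (t, φ)| ≤ 1 :=
    abs_le_one_iff_mul_self_le_one.2 (by nlinarith [mul_self_nonneg (b (t, φ))])
  have hb : |b (t, φ)| ≤ 1 :=
    abs_le_one_iff_mul_self_le_one.2 (by nlinarith [mul_self_nonneg (a (t, φ))])
  refine (abs_sub _ _).trans ?_
  rw [abs_mul, abs_mul]
  have := mul_le_mul h1 hb (abs_nonneg _) (G.Lpos ht).le
  have := mul_le_mul h2 ha (abs_nonneg _) (G.Lpos ht).le
  linarith

lemma A_supp (G : GData x y v a b k f α) {t : ℝ} (ht : 0 < t) :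
    gI (fun p => x p * gDp y p - y p * gDp x p) t =
    gI (fun p => ((x p - x (t, 0)) * b p - (y p - y (t, 0)) * a p) * v p) t := by
  have sx := G.sx
  have sy := G.sy
  have e : gI (fun p => x p * gDp y p - y p * gDp x p) t =
      gI (fun p => ((x p - x (t, 0)) * b p - (y p - y (t, 0)) * a p) * v p +
        gDp (fun q => x (t, 0) * y q - y (t, 0) * x q) p) t := by
    refine gI_congr fun φ => ?_
    have hp : (t, φ) ∈ gU := ht
    rw [gDp_sub ((SP.const _).mul sy) ((SP.const _).mul sx) hp, gDp_mul (SP.const _) sy hp,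
      gDp_mul (SP.const _) sx hp, gDp_const, gDp_const, G.xp _ hp, G.yp _ hp]
    ring
  rw [e, gI_add ((((sx.sub (SP.const _)).mul G.sb).sub ((sy.sub (SP.const _)).mul G.sa)).mul G.sv)
    (((SP.const _).mul sy).sub ((SP.const _).mul sx)).dp ht,
    gI_dp (((SP.const _).mul sy).sub ((SP.const _).mul sx)) ht, add_zero]

lemma A_bd (G : GData x y v a b k f α) {t : ℝ} (ht : 0 < t) :
    |gI (fun p => x p * gDp y p - y p * gDp x p) t| ≤ 2 * gI v t ^ 2 := by
  rw [G.A_supp ht]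
  have sS := ((((G.sx.sub (SP.const (x (t, 0)))).mul G.sb).sub
    ((G.sy.sub (SP.const (y (t, 0)))).mul G.sa)).mul G.sv)
  have h1 : gI (fun p => ((x p - x (t, 0)) * b p - (y p - y (t, 0)) * a p) * v p) t ≤
      gI (fun p => 2 * gI v t * v p) t := by
    refine gI_mono sS ((SP.const _).mul G.sv) ht fun φ hφ => ?_
    exact mul_le_mul_of_nonneg_right (abs_le.1 (G.supp_bd ht hφ)).2 (G.vpos (t, φ) ht).le
  have h2 : gI (fun p => -(2 * gI v t) * v p) t ≤
      gI (fun p => ((x p - x (t, 0)) * b p - (y p - y (t, 0)) * a p) * v p) t := by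
    refine gI_mono ((SP.const _).mul G.sv) sS ht fun φ hφ => ?_
    exact mul_le_mul_of_nonneg_right (abs_le.1 (G.supp_bd ht hφ)).1 (G.vpos (t, φ) ht).le
  rw [gI_smul] at h1 h2
  rw [abs_le]
  constructor <;> nlinarith

lemma LD_lower (G : GData x y v a b k f α) {t : ℝ} (ht : 0 < t)
    (hA : gI (fun p => x p * gDp y p - y p * gDp x p) t ≤ 0) :
    1 / 4 ≤ gI v t * gI (fun p => f p ^ 2 * v p) t := by
  rw [G.A_supp ht] at hA
  have hL := G.Lpos ht
  set L := gI v t with hLdef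
  set S : ℝ × ℝ → ℝ := fun p => (x p - x (t, 0)) * b p - (y p - y (t, 0)) * a p with hS
  have s1 := G.sx.sub (SP.const (x (t, 0)))
  have s2 := G.sy.sub (SP.const (y (t, 0)))
  have sS : SP S := (s1.mul G.sb).sub (s2.mul G.sa)
  have e : gI (gDp fun p => (x p - x (t, 0)) * a p + (y p - y (t, 0)) * b p) t =
      gI (fun p => (v p - (2 * π / L) * (S p * v p)) - f p * v p * S p) t := by
    refine gI_congr fun φ => ?_
    have hp : (t, φ) ∈ gU := ht
    rw [gDp_add (s1.mul G.sa) (s2.mul G.sb) hp, gDp_mul s1 G.sa hp, gDp_mul s2 G.sb hp,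
      gDp_sub G.sx (SP.const _) hp, gDp_sub G.sy (SP.const _) hp, gDp_const, gDp_const,
      G.xp _ hp, G.yp _ hp, G.ap _ hp, G.bp _ hp]
    have hf := G.fk _ hp
    have hk : k (t, φ) = f (t, φ) + 2 * π / L := by
      simp only [← hLdef] at hf; linarith
    simp only [hS]
    rw [hk]
    linear_combination v (t, φ) * G.ab _ hp
  rw [gI_dp ((s1.mul G.sa).add (s2.mul G.sb)) ht,
    gI_sub (G.sv.sub ((SP.const _).mul (sS.mul G.sv))) ((G.sf.mul G.sv).mul sS) ht,
    gI_sub G.sv ((SP.const _).mul (sS.mul G.sv)) ht, gI_smul, ← hLdef] at e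
  have hb : gI (fun p => f p * v p * S p) t ≤
      gI (fun p => 2 * L ^ 2 * (f p ^ 2 * v p) + 1 / 2 * v p) t := by
    refine gI_mono ((G.sf.mul G.sv).mul sS) (((SP.const _).mul ((G.sf.pow 2).mul G.sv)).add
      ((SP.const _).mul G.sv)) ht fun φ hφ => ?_
    have h1 := G.supp_bd ht hφ
    have hv := G.vpos (t, φ) ht
    have h2 : f (t, φ) * S (t, φ) ≤ 2 * L ^ 2 * f (t, φ) ^ 2 + 1 / 2 := by
      have : f (t, φ) * S (t, φ) ≤ |f (t, φ)| * (2 * L) := by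
        refine (le_abs_self _).trans ?_
        rw [abs_mul]
        exact mul_le_mul_of_nonneg_left h1 (abs_nonneg _)
      nlinarith [sq_nonneg (2 * L * |f (t, φ)| - 1), sq_abs (f (t, φ))]
    nlinarith
  rw [gI_add ((SP.const _).mul ((G.sf.pow 2).mul G.sv)) ((SP.const _).mul G.sv) ht, gI_smul,
    gI_smul, ← hLdef] at hb
  have h3 : (2 * π / L) * gI (fun p => S p * v p) t ≤ 0 :=
    mul_nonpos_of_nonneg_of_nonpos (by positivity) hA
  have h4 : L * (1 / 4) ≤ L * (L * gI (fun p => f p ^ 2 * v p) t) := by nlinarith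
  exact le_of_mul_le_mul_left h4 hL

/-- the rotation index is an integer -/
lemma c_int (G : GData x y v a b k f α) {t : ℝ} (ht : 0 < t) :
    ∃ m : ℤ, gI (fun p => v p * k p) t = m * (2 * π) := by
  have svk := G.sv.mul G.sk
  have hθ : ∀ φ, HasDerivAt (fun φ => ∫ s in (0:ℝ)..φ, v (t, s) * k (t, s))
      (v (t, φ) * k (t, φ)) φ := fun φ => (svk.cont ht).integral_hasStrictDerivAt 0 φ |>.hasDerivAt
  set θ : ℝ → ℝ := fun φ => ∫ s in (0:ℝ)..φ, v (t, s) * k (t, s) with hθd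
  have ha : ∀ φ, HasDerivAt (fun φ => a (t, φ)) (-(v (t, φ) * k (t, φ) * b (t, φ))) φ := by
    intro φ
    have := G.sa.hasDerivAt_p ht φ
    rwa [G.ap (t, φ) ht] at this
  have hb : ∀ φ, HasDerivAt (fun φ => b (t, φ)) (v (t, φ) * k (t, φ) * a (t, φ)) φ := by
    intro φ
    have := G.sb.hasDerivAt_p ht φ
    rwa [G.bp (t, φ) ht] at this
  have d1 : ∀ φ, HasDerivAt
      (fun φ => a (t, φ) * Real.cos (θ φ) + b (t, φ) * Real.sin (θ φ)) 0 φ := by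
    intro φ
    refine (((ha φ).mul (hθ φ).cos).add ((hb φ).mul (hθ φ).sin)).congr_deriv ?_
    ring
  have d2 : ∀ φ, HasDerivAt
      (fun φ => b (t, φ) * Real.cos (θ φ) - a (t, φ) * Real.sin (θ φ)) 0 φ := by
    intro φ
    refine (((hb φ).mul (hθ φ).cos).sub ((ha φ).mul (hθ φ).sin)).congr_deriv ?_
    ring
  have e1 := is_const_of_deriv_eq_zero (fun φ => (d1 φ).differentiableAt)
    (fun φ => (d1 φ).deriv) (2 * π) 0
  have e2 := is_const_of_deriv_eq_zero (fun φ => (d2 φ).differentiableAt)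
    (fun φ => (d2 φ).deriv) (2 * π) 0
  have h0 : θ 0 = 0 := by simp [hθd]
  have pa := G.sa.per t ht 0
  have pb := G.sb.per t ht 0
  rw [zero_add] at pa pb
  simp only [h0, pa, pb, Real.cos_zero, Real.sin_zero] at e1 e2
  have hab := G.ab (t, 0) ht
  have hc : Real.cos (θ (2 * π)) = 1 := by
    linear_combination a (t, 0) * e1 + b (t, 0) * e2 + (1 - Real.cos (θ (2 * π))) * hab
  obtain ⟨m, hm⟩ := (Real.cos_eq_one_iff _).1 hc
  exact ⟨m, hm.symm⟩

lemma c_const (G : GData x y v a b k f α) {t s : ℝ} (ht : 0 < t) (hs : 0 < s) :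
    gI (fun p => v p * k p) t = gI (fun p => v p * k p) s := by
  refine (convex_Ioi (0:ℝ)).is_const_of_fderivWithin_eq_zero (𝕜 := ℝ)
    (fun r hr => (G.c_deriv hr).differentiableAt.differentiableWithinAt) ?_ ht hs
  intro r hr
  have h := (G.c_deriv hr).hasDerivWithinAt (s := Ioi 0)
  have h2 := h.hasFDerivWithinAt.fderivWithin (isOpen_Ioi.uniqueDiffWithinAt hr)
  rw [h2]
  ext; simp

lemma D_nonneg (G : GData x y v a b k f α) {t : ℝ} (ht : 0 < t) :
    0 ≤ gI (fun p => f p ^ 2 * v p) t :=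
  gI_nonneg fun φ => mul_nonneg (sq_nonneg _) (G.vpos (t, φ) ht).le

lemma f_sup (G : GData x y v a b k f α) {t : ℝ} (ht : 0 < t)
    (hc : gI (fun p => v p * k p) t = 2 * π) {l : ℝ} (hl : 0 < l) {φ : ℝ}
    (hφ : φ ∈ Icc 0 (2 * π)) :
    f (t, φ) ^ 2 ≤ l * gI (fun p => f p ^ 2 * v p) t +
      l⁻¹ * gI (fun p => gDp f p ^ 2 / v p) t := by
  have hpi : (0:ℝ) < 2 * π := by positivity
  have hfv : gI (fun p => f p * v p) t = 0 := by rw [G.int_fv ht, hc, sub_self]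
  have hcont := (G.sf.mul G.sv).cont ht
  have hz : ∃ z ∈ Icc 0 (2 * π), f (t, z) = 0 := by
    by_contra hne
    push Not at hne
    have hne' : ∀ z ∈ Icc 0 (2 * π), f (t, z) * v (t, z) ≠ 0 := fun z hz =>
      mul_ne_zero (hne z hz) (G.vpos (t, z) ht).ne'
    have h0 := hne' 0 ⟨le_rfl, hpi.le⟩
    rcases lt_or_gt_of_ne h0 with h | h
    · have hneg : ∀ z ∈ Icc 0 (2 * π), f (t, z) * v (t, z) < 0 := by
        intro z hz
        by_contra hcon
        push Not at hcon
        obtain ⟨w, hw, hw0⟩ := intermediate_value_Icc hz.1 hcont.continuousOn ⟨h.le, hcon⟩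
        exact hne' w ⟨hw.1, hw.2.trans hz.2⟩ hw0
      have : 0 < ∫ z in (0:ℝ)..(2 * π), -(f (t, z) * v (t, z)) :=
        intervalIntegral.intervalIntegral_pos_of_pos_on (hcont.neg.intervalIntegrable _ _)
          (fun z hz => neg_pos.2 (hneg z ⟨hz.1.le, hz.2.le⟩)) hpi
      rw [intervalIntegral.integral_neg] at this
      unfold gI at hfv
      simp only [hfv] at this
      linarith
    · have hpos : ∀ z ∈ Icc 0 (2 * π), 0 < f (t, z) * v (t, z) := by
        intro z hz
        by_contra hcon
        push Not at hcon
        obtain ⟨w, hw, hw0⟩ := intermediate_value_Icc' hz.1 hcont.continuousOn ⟨hcon, h.le⟩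
        exact hne' w ⟨hw.1, hw.2.trans hz.2⟩ hw0
      have : 0 < ∫ z in (0:ℝ)..(2 * π), (f (t, z) * v (t, z)) :=
        intervalIntegral.intervalIntegral_pos_of_pos_on (hcont.intervalIntegrable _ _)
          (fun z hz => (hpos z ⟨hz.1.le, hz.2.le⟩)) hpi
      unfold gI at hfv
      simp only [hfv] at this
      linarith
  obtain ⟨z, hz, hz0⟩ := hz
  have sE : SP (fun p => gDp f p ^ 2 / v p) :=
    (G.sf.dp.pow 2).div G.sv fun p hp => (G.vpos p hp).ne'
  have sR := ((SP.const l).mul ((G.sf.pow 2).mul G.sv)).add ((SP.const l⁻¹).mul sE)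
  have hR : l * gI (fun p => f p ^ 2 * v p) t + l⁻¹ * gI (fun p => gDp f p ^ 2 / v p) t =
      gI (fun p => l * (f p ^ 2 * v p) + l⁻¹ * (gDp f p ^ 2 / v p)) t := by
    rw [gI_add ((SP.const l).mul ((G.sf.pow 2).mul G.sv)) ((SP.const l⁻¹).mul sE) ht, gI_smul,
      gI_smul]
  rw [hR]
  have hd : ∀ s, HasDerivAt (fun s => f (t, s) ^ 2) (2 * f (t, s) * gDp f (t, s)) s := by
    intro s
    refine ((G.sf.hasDerivAt_p ht s).pow 2).congr_deriv ?_
    simp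
  have sD := ((SP.const 2).mul G.sf).mul G.sf.dp
  have hpt : ∀ s, |2 * f (t, s) * gDp f (t, s)| ≤
      l * (f (t, s) ^ 2 * v (t, s)) + l⁻¹ * (gDp f (t, s) ^ 2 / v (t, s)) := by
    intro s
    have hv := G.vpos (t, s) ht
    set A := f (t, s)
    set B := gDp f (t, s)
    set V := v (t, s)
    have e1 : l * (A ^ 2 * V) + l⁻¹ * (B ^ 2 / V) - 2 * A * B = (l * A * V - B) ^ 2 / (l * V) := by
      field_simp; ring
    have e2 : l * (A ^ 2 * V) + l⁻¹ * (B ^ 2 / V) + 2 * A * B = (l * A * V + B) ^ 2 / (l * V) := by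
      field_simp; ring
    have p1 : 0 ≤ (l * A * V - B) ^ 2 / (l * V) := by positivity
    have p2 : 0 ≤ (l * A * V + B) ^ 2 / (l * V) := by positivity
    rw [abs_le]; constructor <;> linarith
  have hint : f (t, φ) ^ 2 = ∫ s in z..φ, 2 * f (t, s) * gDp f (t, s) := by
    rw [intervalIntegral.integral_eq_sub_of_hasDerivAt (fun s _ => hd s) (sD.ii ht _ _)]
    simp [hz0]
  rw [hint]
  have hsub : Set.uIoc z φ ⊆ Set.uIoc 0 (2 * π) := by
    rw [Set.uIoc_of_le hpi.le]
    intro s hs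
    rw [Set.mem_uIoc] at hs
    rcases hs with hs | hs
    · exact ⟨hz.1.trans_lt hs.1, hs.2.trans hφ.2⟩
    · exact ⟨hφ.1.trans_lt hs.1, hs.2.trans hz.2⟩
  calc ∫ s in z..φ, 2 * f (t, s) * gDp f (t, s)
      ≤ ‖∫ s in z..φ, 2 * f (t, s) * gDp f (t, s)‖ := le_abs_self _
    _ ≤ ∫ s in Set.uIoc z φ, ‖2 * f (t, s) * gDp f (t, s)‖ :=
        intervalIntegral.norm_integral_le_integral_norm_uIoc
    _ ≤ ∫ s in Set.uIoc 0 (2 * π), ‖2 * f (t, s) * gDp f (t, s)‖ := by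
        refine setIntegral_mono_set ?_ (Eventually.of_forall fun s => norm_nonneg _)
          hsub.eventuallyLE
        exact (intervalIntegrable_iff.1 (sD.ii ht 0 (2 * π))).norm
    _ = ∫ s in (0:ℝ)..(2 * π), ‖2 * f (t, s) * gDp f (t, s)‖ := by
        rw [intervalIntegral.integral_of_le hpi.le, Set.uIoc_of_le hpi.le]
    _ ≤ _ := intervalIntegral.integral_mono_on hpi.le (sD.ii ht _ _).norm (sR.ii ht _ _)
        fun s _ => hpt s

/-- evolution inequality for the dissipation -/
lemma D_deriv (G : GData x y v a b k f α) {t : ℝ} (ht : 0 < t)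
    (hc : gI (fun p => v p * k p) t = 2 * π) :
    ∃ d, HasDerivAt (gI fun p => f p ^ 2 * v p) d t ∧
      d ≤ (3 + 17 / 4 * (2 * π / gI v t) ^ 2) * gI (fun p => f p ^ 2 * v p) t *
        (1 + gI (fun p => f p ^ 2 * v p) t ^ 2) := by
  have sq : SP (fun p => f p ^ 2 * v p) := (G.sf.pow 2).mul G.sv
  refine ⟨_, gI_hasDerivAt sq ht, ?_⟩
  have hL := G.Lpos ht
  set h := 2 * π / gI v t with hh
  have hfv : gI (fun p => f p * v p) t = 0 := by rw [G.int_fv ht, hc, sub_self]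
  have sE : SP (fun p => gDp f p ^ 2 / v p) :=
    (G.sf.dp.pow 2).div G.sv fun p hp => (G.vpos p hp).ne'
  obtain ⟨g, hg⟩ : ∃ g, ∀ φ, gDt f (t, φ) = gDt k (t, φ) - g := by
    obtain ⟨g, hq⟩ : ∃ g, HasDerivAt (fun τ => 2 * π / gI v τ) g t :=
      ⟨_, (hasDerivAt_const t (2 * π)).div (G.L_deriv ht) hL.ne'⟩
    refine ⟨g, fun φ => ?_⟩
    have h1 := G.sf.hasDerivAt_t ht φ
    have h2 : HasDerivAt (fun τ => k (τ, φ) - 2 * π / gI v τ) (gDt k (t, φ) - g) t :=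
      (G.sk.hasDerivAt_t ht φ).sub hq
    have h3 : (fun τ => f (τ, φ)) =ᶠ[nhds t] fun τ => k (τ, φ) - 2 * π / gI v τ := by
      filter_upwards [lt_mem_nhds ht] with τ hτ
      exact G.fk (τ, φ) hτ
    exact h1.unique (h2.congr_of_eventuallyEq h3)
  have som := G.som
  have sB : SP (fun p => 2 * (f p * om v k f α p) - (f p * f p) * α p - 2 * h * (f p * α p)) :=
    (((SP.const 2).mul (G.sf.mul som)).sub ((G.sf.mul G.sf).mul G.sα)).sub
      ((SP.const (2 * h)).mul (G.sf.mul G.sα))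
  have sP : SP (fun p => (f p ^ 4 + 3 * h * f p ^ 3 + 2 * h ^ 2 * f p ^ 2) * v p) :=
    (((G.sf.pow 4).add ((SP.const (3 * h)).mul (G.sf.pow 3))).add
      ((SP.const (2 * h ^ 2)).mul (G.sf.pow 2))).mul G.sv
  have e : gI (gDt fun p => f p ^ 2 * v p) t =
      gI (fun p => gDp (fun p => 2 * (f p * om v k f α p) - (f p * f p) * α p
          - 2 * h * (f p * α p)) p
        + (-2) * (gDp f p ^ 2 / v p) + (-2 * g) * (f p * v p)
        + (f p ^ 4 + 3 * h * f p ^ 3 + 2 * h ^ 2 * f p ^ 2) * v p) t := by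
    refine gI_congr fun φ => ?_
    have hp : (t, φ) ∈ gU := ht
    have c1 : gDt (fun p => f p ^ 2 * v p) (t, φ) = gDt (fun p => f p * f p * v p) (t, φ) := by
      congr 1; funext p; ring
    rw [c1, gDt_mul (G.sf.mul G.sf) G.sv hp, gDt_mul G.sf G.sf hp, hg φ]
    rw [gDp_sub (((SP.const 2).mul (G.sf.mul som)).sub ((G.sf.mul G.sf).mul G.sα))
      ((SP.const (2 * h)).mul (G.sf.mul G.sα)) hp,
      gDp_sub ((SP.const 2).mul (G.sf.mul som)) ((G.sf.mul G.sf).mul G.sα) hp,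
      gDp_mul (SP.const 2) (G.sf.mul som) hp, gDp_mul G.sf som hp,
      gDp_mul (G.sf.mul G.sf) G.sα hp, gDp_mul G.sf G.sf hp,
      gDp_mul (SP.const (2 * h)) (G.sf.mul G.sα) hp, gDp_mul G.sf G.sα hp, gDp_const, gDp_const]
    have r1 := G.vk_t hp
    rw [gDt_mul G.sv G.sk hp] at r1
    have r2 := (G.vt_rel hp).1
    have hf := G.fk _ hp
    have hk : k (t, φ) = f (t, φ) + h := by
      simp only [← hh] at hf; linarith
    have hv := (G.vpos _ hp).ne'
    have r3 : om v k f α (t, φ) = α (t, φ) * k (t, φ) + gDp f (t, φ) / v (t, φ) := rfl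
    rw [hk] at r1 r2 r3
    rw [r3, ← r1, r2]
    field_simp
    ring
  have sfv2 : SP (fun p => (-2 * g) * (f p * v p)) := (SP.const _).mul (G.sf.mul G.sv)
  have sE2 : SP (fun p => (-2) * (gDp f p ^ 2 / v p)) := (SP.const _).mul sE
  rw [e, gI_add ((sB.dp.add sE2).add sfv2) sP ht, gI_add (sB.dp.add sE2) sfv2 ht,
    gI_add sB.dp sE2 ht, gI_dp sB ht, gI_smul, gI_smul, hfv]
  set D := gI (fun p => f p ^ 2 * v p) t with hD
  set E := gI (fun p => gDp f p ^ 2 / v p) t with hE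
  have hD0 : 0 ≤ D := G.D_nonneg ht
  have hE0 : 0 ≤ E := gI_nonneg fun φ => div_nonneg (sq_nonneg _) (G.vpos (t, φ) ht).le
  set M := (D + 1) * D + (D + 1)⁻¹ * E with hM
  have hP : gI (fun p => (f p ^ 4 + 3 * h * f p ^ 3 + 2 * h ^ 2 * f p ^ 2) * v p) t ≤
      gI (fun p => (2 * M + 17 / 4 * h ^ 2) * (f p ^ 2 * v p)) t := by
    refine gI_mono sP ((SP.const _).mul sq) ht fun φ hφ => ?_
    have hs := G.f_sup ht hc (l := D + 1) (by linarith) hφ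
    rw [← hD, ← hE, ← hM] at hs
    have hv := G.vpos (t, φ) ht
    rw [← mul_assoc]
    refine mul_le_mul_of_nonneg_right ?_ hv.le
    nlinarith [sq_nonneg (f (t, φ) * (f (t, φ) - 3 / 2 * h)),
      mul_le_mul_of_nonneg_left hs (sq_nonneg (f (t, φ)))]
  rw [gI_smul, ← hD] at hP
  have hM2 : D * M ≤ D ^ 2 * (D + 1) + E := by
    have : D * ((D + 1)⁻¹ * E) ≤ E := by
      rw [← mul_assoc]
      refine mul_le_of_le_one_left hE0 ?_
      rw [← div_eq_mul_inv, div_le_one (by linarith)]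
      linarith
    rw [hM]; nlinarith
  have h5 : 0 ≤ h ^ 2 * D * D ^ 2 := by positivity
  nlinarith [mul_nonneg hD0 (sq_nonneg (D - 1))]

end GData

/-! ## Long time behaviour -/

lemma growth_bd {F : ℝ → ℝ} {C : ℝ} (h : ∀ t, 1 ≤ t → ∃ d, HasDerivAt F d t ∧ d ≤ C) {s t : ℝ}
    (hs : 1 ≤ s) (hst : s ≤ t) : F t ≤ F s + C * (t - s) := by
  have := (convex_Ici (1:ℝ)).image_sub_le_mul_sub_of_deriv_le (f := F) (C := C)
    (fun r hr => by
      obtain ⟨d, hd, -⟩ := h r hr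
      exact hd.continuousAt.continuousWithinAt)
    (fun r hr => by
      obtain ⟨d, hd, -⟩ := h r (interior_subset hr)
      exact hd.differentiableAt.differentiableWithinAt)
    (fun r hr => by
      obtain ⟨d, hd, hdC⟩ := h r (interior_subset hr)
      rw [hd.deriv]; exact hdC) s hs t (hs.trans hst) hst
  linarith

lemma conv_of_decr {F : ℝ → ℝ} (h : ∀ t, 1 ≤ t → ∃ d, HasDerivAt F d t ∧ d ≤ 0)
    (h0 : ∀ t, 1 ≤ t → 0 ≤ F t) : ∃ l, Tendsto F atTop (nhds l) := by
  have hanti : Antitone fun t => F (max 1 t) := by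
    intro s t hst
    have := growth_bd h (le_max_left 1 s) (max_le_max_left 1 hst)
    simpa using this
  have hb : BddBelow (range fun t => F (max 1 t)) :=
    ⟨0, by rintro _ ⟨t, rfl⟩; exact h0 _ (le_max_left _ _)⟩
  refine ⟨_, (tendsto_atTop_ciInf hanti hb).congr' ?_⟩
  filter_upwards [eventually_ge_atTop 1] with t ht
  rw [max_eq_right ht]

lemma GData.main {x y v a b k f α : ℝ × ℝ → ℝ} (G : GData x y v a b k f α) :
    Tendsto (gI fun p => f p ^ 2 * v p) atTop (nhds 0) := by
  have pos : ∀ {t : ℝ}, 1 ≤ t → 0 < t := fun h => by linarith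
  obtain ⟨m, hm⟩ := G.c_int one_pos
  have hct : ∀ t, 1 ≤ t → gI (fun p => v p * k p) t = m * (2 * π) := fun t ht => by
    rw [G.c_const (pos ht) one_pos, hm]
  have hpi := Real.pi_pos
  have hpi3 := Real.pi_gt_three
  have hL' : ∀ t, 1 ≤ t → ∃ d, HasDerivAt (gI v) d t ∧ d ≤ 0 := by
    intro t ht
    refine ⟨_, G.L_deriv (pos ht), ?_⟩
    have hL := G.Lpos (pos ht)
    rw [neg_nonpos]
    rcases le_or_gt m 0 with hm0 | hm0
    · rw [G.L_deriv2 (pos ht), hct t ht]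
      have h1 : 0 ≤ gI (fun p => k p ^ 2 * v p) t :=
        gI_nonneg fun φ => mul_nonneg (sq_nonneg _) (G.vpos (t, φ) (pos ht)).le
      have h2 : (m : ℝ) ≤ 0 := by exact_mod_cast hm0
      have h3 : 2 * π / gI v t * (m * (2 * π)) ≤ 0 :=
        mul_nonpos_of_nonneg_of_nonpos (by positivity)
          (mul_nonpos_of_nonpos_of_nonneg h2 (by positivity))
      linarith
    · rw [G.L_deriv1 (pos ht), hct t ht]
      have h1 := G.D_nonneg (pos ht)
      have h2 : (1 : ℝ) ≤ m := by exact_mod_cast hm0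
      have h3 : 0 ≤ 2 * π / gI v t * (m * (2 * π) - 2 * π) :=
        mul_nonneg (by positivity) (by nlinarith)
      linarith
  have hLle : ∀ t, 1 ≤ t → gI v t ≤ gI v 1 := fun t ht => by
    simpa using growth_bd hL' le_rfl ht
  set A : ℝ → ℝ := gI fun p => x p * gDp y p - y p * gDp x p with hA
  have hA' : ∀ t, 1 ≤ t → HasDerivAt A (-2 * (m * (2 * π) - 2 * π)) t := fun t ht => by
    have := G.A_deriv (pos ht)
    rwa [hct t ht] at this
  have hAb : ∀ t, 1 ≤ t → |A t| ≤ 2 * gI v 1 ^ 2 := fun t ht =>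
    (G.A_bd (pos ht)).trans (by
      have := hLle t ht
      have := G.Lpos (pos ht)
      gcongr)
  have hm1 : m = 1 := by
    set B := 2 * gI v 1 ^ 2
    have hB : 0 ≤ B := by positivity
    rcases lt_trichotomy m 1 with h | h | h
    · exfalso
      have h2 : (m : ℝ) ≤ 0 := by exact_mod_cast (by lia : m ≤ 0)
      have := growth_bd (F := fun t => - A t) (C := -1) (fun t ht => ⟨_, (hA' t ht).neg, by
        nlinarith⟩) le_rfl (show (1:ℝ) ≤ 2 * B + 2 by linarith)
      have b1 := abs_le.1 (hAb 1 le_rfl)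
      have b2 := abs_le.1 (hAb (2 * B + 2) (by linarith))
      linarith
    · exact h
    · exfalso
      have h2 : (2 : ℝ) ≤ m := by exact_mod_cast (by lia : 2 ≤ m)
      have := growth_bd (F := A) (C := -1) (fun t ht => ⟨_, (hA' t ht), by
        nlinarith⟩) le_rfl (show (1:ℝ) ≤ 2 * B + 2 by linarith)
      have b1 := abs_le.1 (hAb 1 le_rfl)
      have b2 := abs_le.1 (hAb (2 * B + 2) (by linarith))
      linarith
  have hc : ∀ t, 1 ≤ t → gI (fun p => v p * k p) t = 2 * π := fun t ht => by
    rw [hct t ht, hm1]; simp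
  have hA0 : ∀ t, 1 ≤ t → HasDerivAt A 0 t := fun t ht => by
    refine (hA' t ht).congr_deriv ?_
    rw [hm1]; simp
  have hAc : ∀ t, 1 ≤ t → A t = A 1 := fun t ht => by
    have h1 := growth_bd (F := A) (C := 0) (fun t ht => ⟨_, hA0 t ht, le_rfl⟩) le_rfl ht
    have h2 := growth_bd (F := fun t => - A t) (C := 0)
      (fun t ht => ⟨_, (hA0 t ht).neg, by simp⟩) le_rfl ht
    linarith
  set D : ℝ → ℝ := gI fun p => f p ^ 2 * v p with hD
  have hLD : ∀ t, 1 ≤ t → HasDerivAt (gI v) (-D t) t := fun t ht => by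
    have := G.L_deriv (pos ht)
    rw [G.L_deriv1 (pos ht), hc t ht] at this
    simpa using this
  have hD0 : ∀ t, 1 ≤ t → 0 ≤ D t := fun t ht => G.D_nonneg (pos ht)
  have hApos : 0 < A 1 := by
    by_contra hcon
    push Not at hcon
    have hlow : ∀ t, 1 ≤ t → 1 / 4 ≤ gI v t * D t := fun t ht =>
      G.LD_lower (pos ht) (by have := hAc t ht; rw [hA] at this hcon; linarith)
    set Q := 2 * gI v 1 ^ 2 + 2
    have hQ : 0 ≤ gI v 1 ^ 2 := sq_nonneg _
    have := growth_bd (F := fun t => gI v t ^ 2) (C := - (1 / 2))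
      (fun t ht => ⟨_, (hLD t ht).pow 2, by
        have := hlow t ht
        simp only [Nat.cast_ofNat, Nat.add_one_sub_one, pow_one]
        nlinarith⟩) le_rfl (show (1:ℝ) ≤ Q by simp only [Q]; linarith)
    have h2 : 0 ≤ gI v Q ^ 2 := sq_nonneg _
    simp only [Q] at this h2
    linarith
  set K := 3 + 17 / 4 * (8 * π ^ 2 / A 1) with hK
  have hK0 : 0 < K := by positivity
  have hDd : ∀ t, 1 ≤ t → ∃ d, HasDerivAt D d t ∧ d ≤ K * D t * (1 + D t ^ 2) := by
    intro t ht
    obtain ⟨d, hd, hle⟩ := G.D_deriv (pos ht) (hc t ht)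
    refine ⟨d, hd, hle.trans ?_⟩
    have hL := G.Lpos (pos ht)
    have h1 : (2 * π / gI v t) ^ 2 ≤ 8 * π ^ 2 / A 1 := by
      have := (abs_le.1 (G.A_bd (pos ht))).2
      rw [← hA, hAc t ht] at this
      rw [div_pow, div_le_div_iff₀ (by positivity) hApos]
      nlinarith [sq_nonneg π]
    have h0 := hD0 t ht
    change (3 + 17 / 4 * (2 * π / gI v t) ^ 2) * D t * (1 + D t ^ 2) ≤ _
    rw [hK]
    gcongr
  obtain ⟨l, hl⟩ := conv_of_decr hL' fun t ht => (G.Lpos (pos ht)).le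
  obtain ⟨l', hl'⟩ := conv_of_decr (F := fun t => Real.arctan (D t) + K * gI v t)
    (fun t ht => by
      obtain ⟨d, hd, hle⟩ := hDd t ht
      refine ⟨_, hd.arctan.add ((hLD t ht).const_mul K), ?_⟩
      have : 1 / (1 + D t ^ 2) * d ≤ K * D t := by
        rw [one_div, inv_mul_le_iff₀ (by positivity)]
        linarith
      linarith)
    (fun t ht => by
      have h1 : 0 ≤ Real.arctan (D t) := Real.arctan_nonneg.2 (hD0 t ht)
      have h2 := G.Lpos (pos ht)
      positivity)
  have harc : Tendsto (fun t => Real.arctan (D t)) atTop (nhds (l' - K * l)) := by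
    refine (hl'.sub (hl.const_mul K)).congr fun t => ?_
    ring
  have hzero : l' - K * l = 0 := by
    have hge : 0 ≤ l' - K * l := ge_of_tendsto harc (by
      filter_upwards [eventually_ge_atTop 1] with t ht
      exact Real.arctan_nonneg.2 (hD0 t ht))
    by_contra hne
    set q := l' - K * l with hq
    have hqpos : 0 < q := lt_of_le_of_ne hge (Ne.symm hne)
    obtain ⟨T, hT⟩ := eventually_atTop.1 (harc.eventually (lt_mem_nhds (half_lt_self hqpos)))
    have hT1 : 1 ≤ max 1 T := le_max_left _ _
    have hdec := growth_bd (F := fun t => gI v (t + max 1 T)) (C := -(q / 2)) (fun t ht => by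
      have h1 : 1 ≤ t + max 1 T := by linarith
      refine ⟨_, (hLD _ h1).comp_add_const t (max 1 T), ?_⟩
      have h2 := hT (t + max 1 T) (by have := le_max_right 1 T; linarith)
      have h3 : Real.arctan (D (t + max 1 T)) ≤ D (t + max 1 T) :=
        (Real.le_tan (Real.arctan_nonneg.2 (hD0 _ h1)) (Real.arctan_lt_pi_div_two _)).trans_eq
          (Real.tan_arctan _)
      linarith) le_rfl (show (1:ℝ) ≤ 1 + 2 * gI v (1 + max 1 T) / q by
        have := G.Lpos (t := 1 + max 1 T) (by linarith)
        have : 0 ≤ 2 * gI v (1 + max 1 T) / q := by positivity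
        linarith)
    have hLp := G.Lpos (t := 1 + max 1 T) (by linarith)
    have : 0 ≤ 2 * gI v (1 + max 1 T) / q := by positivity
    have hLp2 := G.Lpos (t := 1 + 2 * gI v (1 + max 1 T) / q + max 1 T) (by linarith)
    have e : -(q / 2) * (1 + 2 * gI v (1 + max 1 T) / q - 1) = - gI v (1 + max 1 T) := by
      field_simp; ring
    simp only [e] at hdec
    linarith
  rw [hzero] at harc
  have htan : Tendsto Real.tan (nhds 0) (nhds 0) := by
    have := (Real.continuousAt_tan (x := 0)).2 (by simp)
    simpa [ContinuousAt] using this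
  exact (htan.comp harc).congr fun t => Real.tan_arctan _

/-- Along a global solution of Gage's area-preserving flow, the `L²` norm of
`κ − 2π/L` tends to zero as `t → ∞`. -/
theorem gapf_L2_curvature_difference_tendsto_zero
    (X : ℝ → ℝ → ℝ × ℝ) (X₀ : ℝ → ℝ × ℝ)
    (hX₀ : IsSmoothClosedCurve X₀) (hemb : IsEmbeddedCurve X₀)
    (hsol : IsGAPFSolutionOn X X₀ (Set.Ici 0)) :
    Filter.Tendsto (fun t => gapfDissipation X t) Filter.atTop (nhds 0) := by
  obtain ⟨α₀, hflow⟩ := hsol.flow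
  set x : ℝ × ℝ → ℝ := fun p => (X p.1 p.2).1 with hx
  set y : ℝ × ℝ → ℝ := fun p => (X p.1 p.2).2 with hy
  have hsub : gU ⊆ Set.Ici (0:ℝ) ×ˢ (Set.univ : Set ℝ) := fun p hp =>
    ⟨mem_Ici.2 (le_of_lt (show 0 < p.1 from hp)), mem_univ _⟩
  have hsm := hsol.smooth.mono hsub
  have sx : SP x := ⟨hsm.fst, fun t ht φ => by
    have := (hsol.curve t (mem_Ici.2 (le_of_lt ht))).periodic φ
    simp only [hx, this]⟩
  have sy : SP y := ⟨hsm.snd, fun t ht φ => by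
    have := (hsol.curve t (mem_Ici.2 (le_of_lt ht))).periodic φ
    simp only [hy, this]⟩
  have hd1 : ∀ t, 0 < t → ∀ φ, HasDerivAt (X t) (gDp x (t, φ), gDp y (t, φ)) φ :=
    fun t ht φ => (sx.hasDerivAt_p ht φ).prodMk (sy.hasDerivAt_p ht φ)
  have hd1' : ∀ t, 0 < t → deriv (X t) = fun φ => (gDp x (t, φ), gDp y (t, φ)) :=
    fun t ht => funext fun φ => (hd1 t ht φ).deriv
  have hd2 : ∀ t, 0 < t → ∀ φ,
      deriv (deriv (X t)) φ = (gDp (gDp x) (t, φ), gDp (gDp y) (t, φ)) := by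
    intro t ht φ
    rw [hd1' t ht]
    exact ((sx.dp.hasDerivAt_p ht φ).prodMk (sy.dp.hasDerivAt_p ht φ)).deriv
  set w : ℝ × ℝ → ℝ := fun p => gDp x p ^ 2 + gDp y p ^ 2 with hw
  have sw : SP w := (sx.dp.pow 2).add (sy.dp.pow 2)
  have wpos : ∀ p ∈ gU, 0 < w p := by
    rintro ⟨t, φ⟩ hp
    have hr := (hsol.curve t (mem_Ici.2 (le_of_lt (show 0 < t from hp)))).regular φ
    rw [hd1' t hp] at hr
    by_contra hcon
    push Not at hcon
    apply hr
    simp only [hw] at hcon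
    have h1 : gDp x (t, φ) = 0 := by
      nlinarith [sq_nonneg (gDp x (t, φ)), sq_nonneg (gDp y (t, φ))]
    have h2 : gDp y (t, φ) = 0 := by
      nlinarith [sq_nonneg (gDp x (t, φ)), sq_nonneg (gDp y (t, φ))]
    simp [h1, h2]
  set v : ℝ × ℝ → ℝ := fun p => Real.sqrt (w p) with hv
  have sv : SP v := sw.sqrt fun p hp => (wpos p hp).ne'
  have vpos : ∀ p ∈ gU, 0 < v p := fun p hp => Real.sqrt_pos.2 (wpos p hp)
  have v0 : ∀ p ∈ gU, v p ≠ 0 := fun p hp => (vpos p hp).ne'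
  have vsq : ∀ p ∈ gU, v p * v p = gDp x p ^ 2 + gDp y p ^ 2 := fun p hp =>
    Real.mul_self_sqrt (wpos p hp).le
  have hvn : ∀ t, 0 < t → ∀ φ, vnorm (deriv (X t) φ) = v (t, φ) := by
    intro t ht φ
    rw [hd1' t ht]; rfl
  have hlen : ∀ t, 0 < t → clen (X t) = gI v t := by
    intro t ht
    unfold clen gI
    simp only [hvn t ht]
  set a : ℝ × ℝ → ℝ := fun p => gDp x p / v p with ha
  set b : ℝ × ℝ → ℝ := fun p => gDp y p / v p with hb
  have sa : SP a := sx.dp.div sv v0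
  have sb : SP b := sy.dp.div sv v0
  set k : ℝ × ℝ → ℝ := fun p =>
    (gDp x p * gDp (gDp y) p - gDp y p * gDp (gDp x) p) / v p ^ 3 with hk
  have sk : SP k := ((sx.dp.mul sy.dp.dp).sub (sy.dp.mul sx.dp.dp)).div (sv.pow 3)
    fun p hp => pow_ne_zero _ (v0 p hp)
  have hcurv : ∀ t, 0 < t → ∀ φ, curv (X t) φ = k (t, φ) := by
    intro t ht φ
    unfold curv
    rw [hvn t ht, hd2 t ht, hd1' t ht]; rfl
  have ab : ∀ p ∈ gU, a p * a p + b p * b p = 1 := by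
    intro p hp
    have := vsq p hp
    have h0 := v0 p hp
    simp only [ha, hb]
    field_simp
    linear_combination -this
  have xp : ∀ p ∈ gU, gDp x p = v p * a p := by
    intro p hp
    have h0 := v0 p hp
    simp only [ha]; field_simp
  have yp : ∀ p ∈ gU, gDp y p = v p * b p := by
    intro p hp
    have h0 := v0 p hp
    simp only [hb]; field_simp
  have frenet : ∀ p ∈ gU, gDp a p = -(v p * k p * b p) ∧ gDp b p = v p * k p * a p := by
    intro p hp
    have h0 := v0 p hp
    have e1 : gDp (gDp x) p = gDp v p * a p + v p * gDp a p := by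
      rw [← gDp_mul sv sa hp]; exact gDp_congr xp hp
    have e2 : gDp (gDp y) p = gDp v p * b p + v p * gDp b p := by
      rw [← gDp_mul sv sb hp]; exact gDp_congr yp hp
    have e3 : gDp a p * a p + a p * gDp a p + (gDp b p * b p + b p * gDp b p) = 0 := by
      rw [← gDp_mul sa sa hp, ← gDp_mul sb sb hp, ← gDp_add (sa.mul sa) (sb.mul sb) hp,
        gDp_congr ab hp, gDp_const]
    have ek : v p * k p = a p * gDp b p - b p * gDp a p := by
      have : k p = (v p * a p * (gDp v p * b p + v p * gDp b p) -
          v p * b p * (gDp v p * a p + v p * gDp a p)) / v p ^ 3 := by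
        rw [← e1, ← e2, ← xp p hp, ← yp p hp]
      rw [this]
      field_simp
      ring
    have hab := ab p hp
    rw [ek]
    constructor
    · linear_combination a p / 2 * e3 - gDp a p * hab
    · linear_combination b p / 2 * e3 - gDp b p * hab
  set f : ℝ × ℝ → ℝ := fun p => gDt y p * a p - gDt x p * b p with hf
  set α : ℝ × ℝ → ℝ := fun p => gDt x p * a p + gDt y p * b p with hα
  have sf : SP f := (sy.dt.mul sa).sub (sx.dt.mul sb)
  have sα : SP α := (sx.dt.mul sa).add (sy.dt.mul sb)
  have hfl : ∀ p ∈ gU, f p = k p - 2 * π / gI v p.1 := by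
    rintro ⟨t, φ⟩ hp
    have ht : 0 < t := hp
    have h1 := (hflow t ht.le φ).hasDerivAt (Ici_mem_nhds ht)
    have h2 : HasDerivAt (fun τ => X τ φ) (gDt x (t, φ), gDt y (t, φ)) t :=
      (sx.hasDerivAt_t ht φ).prodMk (sy.hasDerivAt_t ht φ)
    have h3 := h2.unique h1
    have hT : unitTangent (X t) φ = (a (t, φ), b (t, φ)) := by
      unfold unitTangent
      rw [hvn t ht, hd1' t ht]
      simp only [ha, hb, Prod.smul_mk, smul_eq_mul]
      ext <;> simp <;> ring
    rw [hcurv t ht, hlen t ht] at h3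
    simp only [innerNormal, hT, Prod.smul_mk, smul_eq_mul, Prod.mk_add_mk, Prod.mk.injEq] at h3
    obtain ⟨h4, h5⟩ := h3
    simp only [hf]
    rw [h4, h5]
    linear_combination (k (t, φ) - 2 * π / gI v t) * ab (t, φ) hp
  have G : GData x y v a b k f α :=
    { sx := sx, sy := sy, sv := sv, sa := sa, sb := sb, sk := sk, sf := sf, sα := sα
      vpos := vpos, ab := ab, xp := xp, yp := yp
      ap := fun p hp => (frenet p hp).1
      bp := fun p hp => (frenet p hp).2
      xt := fun p hp => by
        simp only [hf, hα]
        linear_combination -gDt x p * ab p hp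
      yt := fun p hp => by
        simp only [hf, hα]
        linear_combination -gDt y p * ab p hp
      fk := hfl }
  refine G.main.congr' ?_
  filter_upwards [eventually_gt_atTop 0] with t ht
  unfold gI gapfDissipation
  refine intervalIntegral.integral_congr fun φ _ => ?_
  simp only
  rw [hcurv t ht, hlen t ht, hvn t ht, hfl (t, φ) ht]
end
end
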